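/- For all 1 <= i, j <= N and all k, l in Z, the following identities hold as operators on N_q^-: q^{(alpha_i|alpha_j)} Omega_{psi_i}(k+1) Omega_{psi_j}(l) - Omega_{psi_j}(l) Omega_{psi_i}(k+1) = Omega_{psi_i}(k) Omega_{psi_j}(l+1) - q^{(alpha_i|alpha_j)} Omega_{psi_j}(l+1) Omega_{psi_i}(k), and the same identity with every Omega_{psi} replaced by Omega_{phi}. -/

import Mathlib

/-!
STATEMENT 10: the quadratic relations among the `Ω_{ψ}` operators, and among the
`Ω_{φ}` operators, as operators on `N_q^-`.
-/


noncomputable section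
open scoped BigOperators

/-- The base field `ℚ(q^{1/2})`. -/
abbrev Fq : Type := RatFunc ℚ

/-- `q^{1/2}`. -/
def sqq : Fq := RatFunc.X

/-- `q`. -/
def qq : Fq := sqq ^ 2

/-- Generators of the quantum affine algebra `U_q(ĝ)` in the Drinfeld realization. -/
inductive Gen (N : ℕ) : Type
  | xp (i : Fin N) (r : ℤ)
  | xm (i : Fin N) (r : ℤ)
  | h  (i : Fin N) (s : ℤ)
  | K (i : Fin N)
  | Kinv (i : Fin N)
  | g2
  | g2inv
  | D
  | Dinv

open Gen

/-- The free algebra on the Drinfeld generators. -/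
abbrev FA (N : ℕ) : Type := FreeAlgebra Fq (Gen N)

variable {N : ℕ}

def e (x : Gen N) : FA N := FreeAlgebra.ι Fq x

variable (d : Fin N → ℤ) (A : Fin N → Fin N → ℤ)

/-- `q_i = q^{d_i}`. -/
def qi (i : Fin N) : Fq := qq ^ (d i)

/-- `q^{(α_i|α_j)} = q^{d_i a_{ij}}`. -/
def qp (i j : Fin N) : Fq := qq ^ (d i * A i j)

/-- The quantum integer `[n]_i`. -/
def qint (i : Fin N) (n : ℤ) : Fq := (qi d i ^ n - qi d i ^ (-n)) / (qi d i - (qi d i)⁻¹)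

/-- `[n]_i!`. -/
def qfact (i : Fin N) : ℕ → Fq
  | 0 => 1
  | n + 1 => qint d i (n + 1) * qfact i n

/-- The `q_i`-binomial coefficient `[n choose r]_{q_i}`. -/
def qbinom (i : Fin N) (n r : ℕ) : Fq := qfact d i n / (qfact d i r * qfact d i (n - r))

/-- `γ^{m/2}` as a (noncommutative) word in the free algebra. -/
def gammaHalf (m : ℤ) : FA N := if 0 ≤ m then (e g2) ^ m.toNat else (e g2inv) ^ (-m).toNat

/-- `γ^{k}`. -/
def gammaPow (k : ℤ) : FA N := gammaHalf (2 * k)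

/-- The Schur-like polynomials `S_k((q_i - q_i^{-1}) h_{i,1}, (q_i - q_i^{-1}) h_{i,2}, …)`
appearing in `ψ_{i,k} = K_i S_k`, defined by the recursion
`k S_k = ∑_{l=1}^{k} l x_l S_{k-l}` for `exp(∑ x_l z^l) = ∑ S_k z^k`. -/
def Ppos (i : Fin N) : ℕ → FA N
  | 0 => 1
  | k + 1 =>
      ((k + 1 : Fq))⁻¹ •
        ∑ l ∈ Finset.range (k + 1),
          (((l + 1 : ℕ) : Fq) * (qi d i - (qi d i)⁻¹)) •
            (e (h i ((l : ℤ) + 1)) * Ppos i (k - l))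

/-- The analogous polynomials in the `h_{i,-l}`, `l > 0`, with coefficient
`-(q_i - q_i^{-1})`, appearing in `φ_{i,-k} = K_i^{-1} S_k`. -/
def Pneg (i : Fin N) : ℕ → FA N
  | 0 => 1
  | k + 1 =>
      ((k + 1 : Fq))⁻¹ •
        ∑ l ∈ Finset.range (k + 1),
          (((l + 1 : ℕ) : Fq) * (-(qi d i - (qi d i)⁻¹))) •
            (e (h i (-((l : ℤ) + 1))) * Pneg i (k - l))

/-- The element `ψ_{i,m}` (zero for `m < 0`). -/
def psiEl (i : Fin N) (m : ℤ) : FA N := if 0 ≤ m then e (K i) * Ppos d i m.toNat else 0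

/-- The element `φ_{i,m}` (zero for `m > 0`). -/
def phiEl (i : Fin N) (m : ℤ) : FA N := if m ≤ 0 then e (Kinv i) * Pneg d i (-m).toNat else 0

/-- A summand of the Drinfeld–Serre relation:
`x_{i,k_{σ(1)}} ⋯ x_{i,k_{σ(r)}} x_{j,l} x_{i,k_{σ(r+1)}} ⋯ x_{i,k_{σ(n)}}`
(`pm = true` for the `x^+` relation, `pm = false` for `x^-`). -/
def dsTerm (pm : Bool) (i j : Fin N) (n' : ℕ) (ks : Fin n' → ℤ) (l : ℤ)
    (σ : Equiv.Perm (Fin n')) (r : ℕ) : FA N :=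
  (((List.finRange n').take r).map fun t =>
      e (if pm then xp i (ks (σ t)) else xm i (ks (σ t)))).prod *
    e (if pm then xp j l else xm j l) *
  (((List.finRange n').drop r).map fun t =>
      e (if pm then xp i (ks (σ t)) else xm i (ks (σ t)))).prod

/-- The defining relations of the quantum affine algebra `U_q(ĝ)`
(Drinfeld realization). -/
inductive QRel (N : ℕ) (d : Fin N → ℤ) (A : Fin N → Fin N → ℤ) : FA N → FA N → Prop
  | K_Kinv (i : Fin N) : QRel N d A (e (K i) * e (Kinv i)) 1
  | Kinv_K (i : Fin N) : QRel N d A (e (Kinv i) * e (K i)) 1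
  | D_Dinv : QRel N d A (e D * e Dinv) 1
  | Dinv_D : QRel N d A (e Dinv * e D) 1
  | g_ginv : QRel N d A (e g2 * e g2inv) 1
  | ginv_g : QRel N d A (e g2inv * e g2) 1
  | g2_comm (x : Gen N) : QRel N d A (e g2 * e x) (e x * e g2)
  | g2inv_comm (x : Gen N) : QRel N d A (e g2inv * e x) (e x * e g2inv)
  | K_comm_K (i j : Fin N) : QRel N d A (e (K i) * e (K j)) (e (K j) * e (K i))
  | K_comm_D (i : Fin N) : QRel N d A (e (K i) * e D) (e D * e (K i))
  | K_comm_h (i j : Fin N) (s : ℤ) :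
      QRel N d A (e (K i) * e (h j s)) (e (h j s) * e (K i))
  | h_zero (i : Fin N) : QRel N d A (e (h i 0)) 0
  | D_h (i : Fin N) (s : ℤ) :
      QRel N d A (e D * e (h i s) * e Dinv) ((qq ^ s) • e (h i s))
  | D_xp (i : Fin N) (r : ℤ) :
      QRel N d A (e D * e (xp i r) * e Dinv) ((qq ^ r) • e (xp i r))
  | D_xm (i : Fin N) (r : ℤ) :
      QRel N d A (e D * e (xm i r) * e Dinv) ((qq ^ r) • e (xm i r))
  | K_xp (i j : Fin N) (r : ℤ) :
      QRel N d A (e (K i) * e (xp j r) * e (Kinv i)) (qp d A i j • e (xp j r))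
  | K_xm (i j : Fin N) (r : ℤ) :
      QRel N d A (e (K i) * e (xm j r) * e (Kinv i)) ((qp d A i j)⁻¹ • e (xm j r))
  | h_h (i j : Fin N) (k l : ℤ) (hk : k ≠ 0) (hl : l ≠ 0) :
      QRel N d A (e (h i k) * e (h j l) - e (h j l) * e (h i k))
        (if l = -k then
          ((k : Fq)⁻¹ * qint d i (k * A i j) * (qi d j - (qi d j)⁻¹)⁻¹) •
            (gammaPow k - gammaPow (-k))
         else 0)
  | h_xp (i j : Fin N) (k l : ℤ) (hk : k ≠ 0) :
      QRel N d A (e (h i k) * e (xp j l) - e (xp j l) * e (h i k))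
        (((k : Fq)⁻¹ * qint d i (k * A i j)) • (gammaHalf (-|k|) * e (xp j (k + l))))
  | h_xm (i j : Fin N) (k l : ℤ) (hk : k ≠ 0) :
      QRel N d A (e (h i k) * e (xm j l) - e (xm j l) * e (h i k))
        ((-((k : Fq)⁻¹ * qint d i (k * A i j))) • (gammaHalf |k| * e (xm j (k + l))))
  | serre_p (i j : Fin N) (k l : ℤ) :
      QRel N d A
        (e (xp i (k+1)) * e (xp j l) - qp d A i j • (e (xp j l) * e (xp i (k+1))))
        (qp d A i j • (e (xp i k) * e (xp j (l+1))) - e (xp j (l+1)) * e (xp i k))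
  | serre_m (i j : Fin N) (k l : ℤ) :
      QRel N d A
        (e (xm i (k+1)) * e (xm j l) - (qp d A i j)⁻¹ • (e (xm j l) * e (xm i (k+1))))
        ((qp d A i j)⁻¹ • (e (xm i k) * e (xm j (l+1))) - e (xm j (l+1)) * e (xm i k))
  | xp_xm (i j : Fin N) (k l : ℤ) :
      QRel N d A (e (xp i k) * e (xm j l) - e (xm j l) * e (xp i k))
        (if i = j then
          ((qi d i - (qi d i)⁻¹)⁻¹) •
            (gammaHalf (k - l) * psiEl d i (k + l) - gammaHalf (l - k) * phiEl d i (k + l))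
         else 0)
  | dserre (pm : Bool) (i j : Fin N) (hij : i ≠ j)
      (ks : Fin (1 - A i j).toNat → ℤ) (l : ℤ) :
      QRel N d A
        (∑ σ : Equiv.Perm (Fin (1 - A i j).toNat),
          ∑ r ∈ Finset.range ((1 - A i j).toNat + 1),
            ((-1 : Fq) ^ r * qbinom d i (1 - A i j).toNat r) •
              dsTerm pm i j (1 - A i j).toNat ks l σ r)
        0

/-- The quantum affine algebra `U_q(ĝ)` (Drinfeld realization). -/
abbrev Uq (N : ℕ) (d : Fin N → ℤ) (A : Fin N → Fin N → ℤ) : Type := RingQuot (QRel N d A)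

/-- The image of a generator in `U_q(ĝ)`. -/
def G (x : Gen N) : Uq N d A := RingQuot.mkAlgHom Fq (QRel N d A) (e x)

/-- The image of `ψ_{i,m}` in `U_q(ĝ)`. -/
def psiU (i : Fin N) (m : ℤ) : Uq N d A := RingQuot.mkAlgHom Fq (QRel N d A) (psiEl d i m)

/-- The image of `φ_{i,m}` in `U_q(ĝ)`. -/
def phiU (i : Fin N) (m : ℤ) : Uq N d A := RingQuot.mkAlgHom Fq (QRel N d A) (phiEl d i m)

/-- The image of `γ^{m/2}` in `U_q(ĝ)`. -/
def gU (m : ℤ) : Uq N d A := RingQuot.mkAlgHom Fq (QRel N d A) (gammaHalf m)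


/-- The generating set of the subalgebra `N_q^-`. -/
def NqSet : Set (Uq N d A) :=
  {G d A Gen.g2, G d A Gen.g2inv} ∪ Set.range (fun p : Fin N × ℤ => G d A (Gen.xm p.1 p.2))

/-- The subalgebra `N_q^-` of `U_q(ĝ)` generated by `γ^{±1/2}` and the `x^-_{i,l}`. -/
def Nq : Subalgebra Fq (Uq N d A) := Algebra.adjoin Fq (NqSet d A)

/-- `γ^{1/2}` as an element of `N_q^-`. -/
def g2N : Nq d A :=
  ⟨G d A Gen.g2, Algebra.subset_adjoin (Set.mem_union_left _ (Set.mem_insert _ _))⟩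

/-- `γ^{-1/2}` as an element of `N_q^-`. -/
def g2invN : Nq d A :=
  ⟨G d A Gen.g2inv, Algebra.subset_adjoin (Set.mem_union_left _ (Set.mem_insert_of_mem _ rfl))⟩

/-- `x^-_{i,m}` as an element of `N_q^-`. -/
def xmN (i : Fin N) (m : ℤ) : Nq d A :=
  ⟨G d A (Gen.xm i m), Algebra.subset_adjoin (Set.mem_union_right _ ⟨(i, m), rfl⟩)⟩

/-- `γ^{m/2}` as an element of `N_q^-`. -/
def gN (m : ℤ) : Nq d A :=
  if 0 ≤ m then (g2N d A) ^ m.toNat else (g2invN d A) ^ (-m).toNat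

/-- The characterizing property of the family of operators
`Ω_{ψ_i}(m), Ω_{φ_i}(m) : N_q^- → N_q^-`: they vanish for small (resp. large) index, and
`[x^+_{i,k}, P] = (q_i - q_i^{-1})^{-1} (∑_{p ≥ 0} ψ_{i,p} γ^{p/2} Ω_{ψ_i}(k-p)(P)
   - ∑_{r ≥ 0} φ_{i,-r} γ^{r/2} Ω_{φ_i}(k+r)(P))`,
both sums having only finitely many nonzero terms.  (By the commutator lemma there is a
unique such family.) -/
def IsOmegaFamily (Ωψ Ωφ : Fin N → ℤ → ((Nq d A) →ₗ[Fq] (Nq d A))) : Prop :=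
  (∀ (i : Fin N) (P : Nq d A), ∃ b : ℤ, ∀ m : ℤ, m ≤ b → Ωψ i m P = 0) ∧
  (∀ (i : Fin N) (P : Nq d A), ∃ b : ℤ, ∀ m : ℤ, b ≤ m → Ωφ i m P = 0) ∧
  (∀ (i : Fin N) (k : ℤ) (P : Nq d A), ∃ M : ℕ,
    (∀ p : ℕ, M < p → Ωψ i (k - (p : ℤ)) P = 0 ∧ Ωφ i (k + (p : ℤ)) P = 0) ∧
    G d A (Gen.xp i k) * (P : Uq N d A) - (P : Uq N d A) * G d A (Gen.xp i k) =
      ((qi d i - (qi d i)⁻¹)⁻¹) •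
        ((∑ p ∈ Finset.range (M + 1),
            psiU d A i (p : ℤ) * gU d A (p : ℤ) *
              ((Ωψ i (k - (p : ℤ)) P : Nq d A) : Uq N d A)) -
         (∑ r ∈ Finset.range (M + 1),
            phiU d A i (-(r : ℤ)) * gU d A (r : ℤ) *
              ((Ωφ i (k + (r : ℤ)) P : Nq d A) : Uq N d A))))

/-- The Taylor coefficients at `t = 0` of `(a t - 1)/(t - a)` (for `a = q^{(α_i|α_j)}`
this is the series `g_{i,j}(t)`; for `a = q^{-(α_i|α_j)}` it is `g_{i,j,q^{-1}}(t)`). -/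
def gcoef (a : Fq) : ℕ → Fq
  | 0 => a⁻¹
  | r + 1 => a ^ (-(r : ℤ) - 2) - a ^ (-(r : ℤ))

namespace QAff

/-- A system of adjacent variables `z 0, …, z (n-1)` exchanged by ring endomorphisms `σ s`,
together with a subgroup `I` containing `(z s - c z (s+1)) P` for `σ s`-invariant `P`. -/
structure SwapSystem {A : Type*} [CommRing A] (w c : A) (z : ℕ → A) (σ : ℕ → A →+* A)
    (I : AddSubgroup A) (n : ℕ) : Prop where
  map_left : ∀ s, s + 1 < n → σ s (z s) = z (s + 1)
  map_right : ∀ s, s + 1 < n → σ s (z (s + 1)) = z s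
  map_other : ∀ s, s + 1 < n → ∀ t, t < n → t ≠ s → t ≠ s + 1 → σ s (z t) = z t
  map_w : ∀ s, s + 1 < n → σ s w = w
  map_c : ∀ s, s + 1 < n → σ s c = c
  mem : ∀ s, s + 1 < n → ∀ P, σ s P = P → (z s - c * z (s + 1)) * P ∈ I

namespace SwapSystem

variable {A : Type*} [CommRing A] {w c : A} {z : ℕ → A} {σ : ℕ → A →+* A} {I : AddSubgroup A}
  {n : ℕ}

lemma mono (h : SwapSystem w c z σ I n) {n' : ℕ} (hn : n' ≤ n) : SwapSystem w c z σ I n' where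
  map_left s hs := h.map_left s (by omega)
  map_right s hs := h.map_right s (by omega)
  map_other s hs t ht := h.map_other s (by omega) t (by omega)
  map_w s hs := h.map_w s (by omega)
  map_c s hs := h.map_c s (by omega)
  mem s hs := h.mem s (by omega)

lemma tail (h : SwapSystem w c z σ I (n + 1)) :
    SwapSystem w c (fun s => z (s + 1)) (fun s => σ (s + 1)) I n where
  map_left s hs := h.map_left (s + 1) (by omega)
  map_right s hs := h.map_right (s + 1) (by omega)
  map_other s hs t ht h1 h2 := h.map_other (s + 1) (by omega) (t + 1) (by omega) (by omega)
    (by omega)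
  map_w s hs := h.map_w (s + 1) (by omega)
  map_c s hs := h.map_c (s + 1) (by omega)
  mem s hs := h.mem (s + 1) (by omega)

/-- `∏ (w - c α z_s) ≡ ∏_{s<L} (w - α z_s) · (w - c^{L+1} α z_L)`. -/
lemma prod_push_last (α : A) (L : ℕ) (h : SwapSystem w c z σ I (L + 1))
    (hα : ∀ s, s < L → σ s α = α) (P : A) (hP : ∀ s, s < L → σ s P = P) :
    (∏ s ∈ Finset.range (L + 1), (w - c * α * z s)) * P -
      (∏ s ∈ Finset.range L, (w - α * z s)) * (w - c ^ (L + 1) * α * z L) * P ∈ I := by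
  induction L generalizing P with
  | zero => simp
  | succ L ih =>
    have h1 := ih (h.mono (by omega)) (fun s hs => hα s (by omega))
      ((w - c * α * z (L + 1)) * P) (by
        intro s hs
        rw [map_mul, hP s (by omega), map_sub, map_mul, map_mul, hα s (by omega),
          h.map_w s (by omega), h.map_c s (by omega),
          h.map_other s (by omega) (L + 1) (by omega) (by omega) (by omega)])
    have h2 := h.mem L (by omega)
      (w * α * (1 - c ^ (L + 1)) * ((∏ s ∈ Finset.range L, (w - α * z s)) * P)) (by
        have : σ L (∏ s ∈ Finset.range L, (w - α * z s)) =
            ∏ s ∈ Finset.range L, (w - α * z s) := by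
          rw [map_prod]
          refine Finset.prod_congr rfl fun s hs => ?_
          have := Finset.mem_range.1 hs
          rw [map_sub, map_mul, h.map_w L (by omega), hα L (by omega),
            h.map_other L (by omega) s (by omega) (by omega) (by omega)]
        simp only [map_mul, map_sub, map_one, map_pow, this, h.map_w L (by omega),
          hα L (by omega), h.map_c L (by omega), hP L (by omega)])
    have h3 := I.add_mem h1 h2
    convert h3 using 1
    rw [Finset.prod_range_succ, Finset.prod_range_succ, Finset.prod_range_succ]
    ring

/-- `∏ (c w - z_s) ≡ (c^{L+1} w - z_0) ∏_{s≥1} (w - z_s)`. -/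
lemma prod_push_first (L : ℕ) (h : SwapSystem w c z σ I (L + 1))
    (P : A) (hP : ∀ s, s < L → σ s P = P) :
    (∏ s ∈ Finset.range (L + 1), (c * w - z s)) * P -
      (c ^ (L + 1) * w - z 0) * (∏ s ∈ Finset.range L, (w - z (s + 1))) * P ∈ I := by
  induction L generalizing P z σ with
  | zero => simp
  | succ L ih =>
    have h1 := ih h.tail ((c * w - z 0) * P) (by
        intro s hs
        rw [map_mul, hP (s + 1) (by omega), map_sub, map_mul,
          h.map_w (s + 1) (by omega), h.map_c (s + 1) (by omega),
          h.map_other (s + 1) (by omega) 0 (by omega) (by omega) (by omega)])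
    have h2 := h.mem 0 (by omega)
      (w * (1 - c ^ (L + 1)) * ((∏ s ∈ Finset.range L, (w - z (s + 2))) * P)) (by
        have : σ 0 (∏ s ∈ Finset.range L, (w - z (s + 2))) =
            ∏ s ∈ Finset.range L, (w - z (s + 2)) := by
          rw [map_prod]
          refine Finset.prod_congr rfl fun s hs => ?_
          have := Finset.mem_range.1 hs
          rw [map_sub, h.map_w 0 (by omega),
            h.map_other 0 (by omega) (s + 2) (by omega) (by omega) (by omega)]
        simp only [map_mul, map_sub, map_one, map_pow, this, h.map_w 0 (by omega),
          h.map_c 0 (by omega), hP 0 (by omega)])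
    have h3 := I.add_mem h1 h2
    convert h3 using 1
    rw [Finset.prod_range_succ' (fun s => c * w - z s) (L + 1),
      Finset.prod_range_succ' (fun s => w - z (s + 1)) L]
    ring

/-- `∑_t ∏_{s<t} (w - c z_s) ∏_{t≤s} (c w - z_s) ≡ (1 + c + ⋯ + c^L) ∏ (w - z_s)`. -/
lemma sum_prod (L : ℕ) (h : SwapSystem w c z σ I L)
    (P : A) (hP : ∀ s, s + 1 < L → σ s P = P) :
    (∑ t ∈ Finset.range (L + 1), (∏ s ∈ Finset.range t, (w - c * z s)) *
        ∏ s ∈ Finset.Ico t L, (c * w - z s)) * P -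
      (∑ k ∈ Finset.range (L + 1), c ^ k) * (∏ s ∈ Finset.range L, (w - z s)) * P ∈ I := by
  induction L generalizing P with
  | zero => simp
  | succ L ih =>
    have h1 := ih (h.mono (by omega)) ((c * w - z L) * P) (by
        intro s hs
        rw [map_mul, hP s (by omega), map_sub, map_mul, h.map_w s (by omega),
          h.map_c s (by omega),
          h.map_other s (by omega) L (by omega) (by omega) (by omega)])
    have h2 := prod_push_last 1 L h (by simp) P (fun s hs => hP s (by omega))
    have h3 := I.add_mem h1 h2
    convert h3 using 1
    rw [Finset.sum_range_succ _ (L + 1)]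
    have e1 : ∑ t ∈ Finset.range (L + 1), (∏ s ∈ Finset.range t, (w - c * z s)) *
        ∏ s ∈ Finset.Ico t (L + 1), (c * w - z s) =
        (∑ t ∈ Finset.range (L + 1), (∏ s ∈ Finset.range t, (w - c * z s)) *
        ∏ s ∈ Finset.Ico t L, (c * w - z s)) * (c * w - z L) := by
      rw [Finset.sum_mul]
      refine Finset.sum_congr rfl fun t ht => ?_
      have := Finset.mem_range.1 ht
      rw [Finset.prod_Ico_succ_top (by omega)]
      ring
    have e2 : (∑ k ∈ Finset.range (L + 2), c ^ k) = 1 + c * ∑ k ∈ Finset.range (L + 1), c ^ k := by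
      rw [Finset.sum_range_succ', Finset.mul_sum]
      simp [pow_succ', add_comm]
    have e3 : (∑ k ∈ Finset.range (L + 2), c ^ k) = (∑ k ∈ Finset.range (L + 1), c ^ k)
        + c ^ (L + 1) := Finset.sum_range_succ _ _
    have e4 : (∑ k ∈ Finset.range (L + 2), c ^ k) * (w - z L) =
      (∑ k ∈ Finset.range (L + 1), c ^ k) * (c * w - z L) + (w - c ^ (L + 1) * z L) := by
      rw [mul_sub]
      nth_rewrite 1 [e2]
      rw [e3]; ring
    rw [e1, Finset.Ico_self, Finset.prod_empty, Finset.prod_range_succ (fun s => w - z s)]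
    simp only [mul_one, one_mul]
    linear_combination (-(∏ s ∈ Finset.range L, (w - z s)) * P) * e4

/-- The partial sums of the Serre-type alternating sum. -/
lemma serre_partial {p p'' : A} (hp : p = c * p'') (n : ℕ) (h : SwapSystem w c z σ I n)
    (hp'' : ∀ s, s + 1 < n → σ s p'' = p'')
    (β S : ℕ → A) (hβσ : ∀ r s, s + 1 < n → σ s (β r) = β r)
    (h0 : S 0 = β 0)
    (h1 : ∀ r, r < n → S (r + 1) = β (r + 1) - p * S r)
    (h2 : ∀ r, r < n → S (r + 1) * p'' = β (r + 1) * c ^ (r + 1) * p'' - S r)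
    (P : A) (hP : ∀ s, s + 1 < n → σ s P = P) (R : ℕ) (hR : R ≤ n) :
    (∑ r ∈ Finset.range (R + 1), (-1) ^ r * β r * ((∏ s ∈ Finset.range r, (w - p * z s)) *
        ∏ s ∈ Finset.Ico r n, (p * w - z s))) * P -
      (-1) ^ R * S R * ((∏ s ∈ Finset.range R, (w - p'' * z s)) *
        ∏ s ∈ Finset.Ico R n, (p * w - z s)) * P ∈ I := by
  have hpσ : ∀ s, s + 1 < n → σ s p = p := by
    intro s hs; rw [hp, map_mul, h.map_c s hs, hp'' s hs]
  induction R with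
  | zero => simp [h0]
  | succ R ih =>
    have h3 := ih (by omega)
    have h4 := prod_push_last p'' R (h.mono (by omega)) (fun s hs => hp'' s (by omega))
      ((-1) ^ (R + 1) * β (R + 1) * (∏ s ∈ Finset.Ico (R + 1) n, (p * w - z s)) * P) (by
        intro s hs
        have : σ s (∏ s ∈ Finset.Ico (R + 1) n, (p * w - z s)) =
            ∏ s ∈ Finset.Ico (R + 1) n, (p * w - z s) := by
          rw [map_prod]
          refine Finset.prod_congr rfl fun t ht => ?_
          have := Finset.mem_Ico.1 ht
          rw [map_sub, map_mul, h.map_w s (by omega), hpσ s (by omega),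
            h.map_other s (by omega) t (by omega) (by omega) (by omega)]
        simp only [map_mul, map_neg, map_one, map_pow, this, hP s (by omega),
          hβσ _ s (by omega)])
    have h5 := I.add_mem h3 h4
    convert h5 using 1
    rw [Finset.sum_range_succ _ (R + 1), Finset.prod_range_succ (fun s => w - p'' * z s),
      Finset.prod_eq_prod_Ico_succ_bot (show R < n by omega), hp]
    have e1 := h1 R (by omega)
    have e2 := h2 R (by omega)
    rw [hp] at e1
    generalize (∏ s ∈ Finset.range R, (w - p'' * z s)) = X
    generalize (∏ s ∈ Finset.Ico (R+1) n, (c * p'' * w - z s)) = Y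
    rw [pow_succ (-1 : A) R]
    linear_combination (-(-1) ^ R * X * Y * P * (-w)) * e1 - (-(-1) ^ R * X * Y * P * (-z R)) * e2

end SwapSystem
end QAff

namespace QAff

section Insert

lemma insert_middle {A : Type*} [CommRing A] (a b ai bi w y z z' : A) (ha : a * ai = 1)
    (hb : b * bi = 1) :
    a * (w - ai * bi * y) * (w - b * b * z) * (w - z') -
        b * (ai * bi * w - y) * (w - z) * (a * a * w - z') =
      w * (-(a * b * (b - bi)) * (z - ai * bi * y) * (w - z') -
        a * b * (a - ai) * (ai * bi * z' - y) * (w - z)) := by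
  grind

lemma insert_last {A : Type*} [CommRing A] (b bi w y z : A) (hb : b * bi = 1) :
    (w - bi * y) * (w - b * b * z) - b * (bi * w - y) * (w - z) =
      w * (-(b * (b - bi)) * (z - bi * y)) := by
  grind

lemma insert_first {A : Type*} [CommRing A] (b bi w y z : A) (hb : b * bi = 1) :
    b * (w - bi * y) * (w - z) - (bi * w - y) * (b * b * w - z) =
      - (w * (b * (b - bi)) * (bi * z - y)) := by
  grind

variable {A E : Type*} [CommRing A] [AddCommGroup E]

/-- The data for the Serre-type identity in which one of the repeated letters is replaced:
words `U r` in which the letter `y` is inserted after `r` of the letters `z`. -/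
structure InsertSystem (w y c p : A) (z : ℕ → A) (σ : ℕ → A →+* A) (U : ℕ → A →+ E)
    (m : ℕ) : Prop where
  left : ∀ r, r ≤ m → SwapSystem w c z σ (U r).ker r
  right : ∀ r, r ≤ m →
    SwapSystem w c (fun s => z (r + s)) (fun s => σ (r + s)) (U r).ker (m - r)
  map_other : ∀ s, s + 1 < m → ∀ t, t < m → t ≠ s → t ≠ s + 1 → σ s (z t) = z t
  map_w : ∀ s, s + 1 < m → σ s w = w
  map_y : ∀ s, s + 1 < m → σ s y = y
  map_c : ∀ s, s + 1 < m → σ s c = c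
  map_p : ∀ s, s + 1 < m → σ s p = p
  exchange : ∀ r, r < m → ∀ P, U (r + 1) ((z r - p * y) * P) = U r ((p * z r - y) * P)

namespace InsertSystem

variable {w y c p : A} {z : ℕ → A} {σ : ℕ → A →+* A} {U : ℕ → A →+ E} {m : ℕ}

lemma map_right_prod (h : InsertSystem w y c p z σ U m) (a b : A) {r s : ℕ} (hs : s + 1 < r)
    (hr : r ≤ m) (ha : σ s a = a) (hb : σ s b = b) :
    σ s (∏ t ∈ Finset.range (m - r), (a - b * z (r + t))) =
      ∏ t ∈ Finset.range (m - r), (a - b * z (r + t)) := by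
  rw [map_prod]
  refine Finset.prod_congr rfl fun t ht => ?_
  have := Finset.mem_range.1 ht
  rw [map_sub, map_mul, ha, hb, h.map_other s (by omega) _ (by omega) (by omega) (by omega)]

lemma map_left_prod (h : InsertSystem w y c p z σ U m) (a b : A) {r s : ℕ} (hs : r ≤ s)
    (hr : s + 1 < m) (ha : σ s a = a) (hb : σ s b = b) :
    σ s (∏ t ∈ Finset.range r, (a - b * z t)) =
      ∏ t ∈ Finset.range r, (a - b * z t) := by
  rw [map_prod]
  refine Finset.prod_congr rfl fun t ht => ?_
  have := Finset.mem_range.1 ht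
  rw [map_sub, map_mul, ha, hb, h.map_other s (by omega) _ (by omega) (by omega) (by omega)]

lemma left_last (h : InsertSystem w y c p z σ U m) {r : ℕ} (hr : r ≤ m) (P : A)
    (hP : ∀ s, s + 1 < m → s + 1 ≠ r → σ s P = P) :
    U r ((∏ s ∈ Finset.range r, (w - c * z s)) * P) =
      U r ((if r = 0 then 1 else (∏ s ∈ Finset.range (r - 1), (w - z s)) *
        (w - c ^ r * z (r - 1))) * P) := by
  rcases r with _ | r
  · simp
  · have := (h.left (r + 1) hr).prod_push_last 1 r (by simp) P
      (fun s hs => hP s (by omega) (by omega))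
    simp only [mul_one, one_mul, AddMonoidHom.mem_ker, map_sub, sub_eq_zero] at this
    simpa using this

lemma right_first (h : InsertSystem w y c p z σ U m) {r : ℕ} (hr : r ≤ m) (P : A)
    (hP : ∀ s, s + 1 < m → s + 1 ≠ r → σ s P = P) :
    U r ((∏ s ∈ Finset.range (m - r), (c * w - z (r + s))) * P) =
      U r ((if r = m then 1 else (c ^ (m - r) * w - z r) *
        ∏ s ∈ Finset.range (m - r - 1), (w - z (r + (s + 1)))) * P) := by
  obtain ⟨L, rfl⟩ := Nat.exists_eq_add_of_le hr
  rcases L with _ | L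
  · simp
  · have h1 := h.right r hr
    simp only [Nat.add_sub_cancel_left] at h1
    have := h1.prod_push_first L P (fun s hs => hP _ (by omega) (by omega))
    simp only [AddMonoidHom.mem_ker, map_sub, sub_eq_zero] at this
    simpa using this

lemma sum_above (h : InsertSystem w y c p z σ U m) {r : ℕ} (hr : r ≤ m) (P : A)
    (hP : ∀ s, s + 1 < m → s + 1 ≠ r → σ s P = P) :
    U r ((∑ t ∈ Finset.Ico r (m + 1), (∏ s ∈ Finset.range t, (w - c * z s)) *
        ∏ s ∈ Finset.Ico t m, (c * w - z s)) * P) =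
      U r ((∑ k ∈ Finset.range (m - r + 1), c ^ k) *
        ((if r = 0 then 1 else (∏ s ∈ Finset.range (r - 1), (w - z s)) *
          (w - c ^ r * z (r - 1))) * (∏ s ∈ Finset.range (m - r), (w - z (r + s)))) * P) := by
  have e1 : (∑ t ∈ Finset.Ico r (m + 1), (∏ s ∈ Finset.range t, (w - c * z s)) *
        ∏ s ∈ Finset.Ico t m, (c * w - z s)) = (∏ s ∈ Finset.range r, (w - c * z s)) *
      ∑ t ∈ Finset.range (m - r + 1), (∏ s ∈ Finset.range t, (w - c * z (r + s))) *
        ∏ s ∈ Finset.Ico t (m - r), (c * w - z (r + s)) := by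
    rw [Finset.sum_Ico_eq_sum_range, Finset.mul_sum, show m + 1 - r = m - r + 1 by omega]
    refine Finset.sum_congr rfl fun t ht => ?_
    rw [Finset.prod_range_add, mul_assoc]
    congr 2
    rw [Finset.prod_Ico_add (fun s => c * w - z s)]
    congr 1
    rw [Nat.add_comm t r, show m - r + r = m by omega]
  have h1 := (h.right r hr).sum_prod (m - r) ((∏ s ∈ Finset.range r, (w - c * z s)) * P) (by
    intro s hs
    rw [map_mul, h.map_left_prod w c (by omega) (by omega) (h.map_w _ (by omega))
      (h.map_c _ (by omega)), hP _ (by omega) (by omega)])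
  rw [AddMonoidHom.mem_ker, map_sub, sub_eq_zero] at h1
  rw [e1, mul_comm (∏ s ∈ Finset.range r, (w - c * z s)), mul_assoc, h1]
  have h2 := h.left_last hr ((∑ k ∈ Finset.range (m - r + 1), c ^ k) *
      (∏ s ∈ Finset.range (m - r), (w - z (r + s))) * P) (by
    intro s hs hs'
    have e2 : σ s (∏ t ∈ Finset.range (m - r), (w - z (r + t))) =
        ∏ t ∈ Finset.range (m - r), (w - z (r + t)) := by
      rcases Nat.lt_or_ge s r with hsr | hsr
      · simpa using h.map_right_prod w 1 (r := r) (s := s) (by omega) hr (h.map_w _ hs) (map_one _)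
      · have h3 := h.right r hr
        obtain ⟨s, rfl⟩ := Nat.exists_eq_add_of_le hsr
        rw [map_prod]
        refine Finset.prod_bij' (fun t _ => Equiv.swap s (s + 1) t)
          (fun t _ => Equiv.swap s (s + 1) t) ?_ ?_ (by simp) (by simp) ?_
        · intro t ht
          have := Finset.mem_range.1 ht
          rw [Finset.mem_range, Equiv.swap_apply_def]
          split_ifs <;> omega
        · intro t ht
          have := Finset.mem_range.1 ht
          rw [Finset.mem_range, Equiv.swap_apply_def]
          split_ifs <;> omega
        · intro t ht
          have := Finset.mem_range.1 ht
          rw [map_sub, h.map_w _ hs, Equiv.swap_apply_def]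
          split_ifs with h4 h5
          · subst h4; rw [h3.map_left t (by omega)]
          · subst h5; rw [h3.map_right s (by omega)]
          · rw [h3.map_other s (by omega) t (by omega) h4 h5]
    simp only [map_mul, map_sum, map_pow, h.map_c _ hs, e2, hP _ hs hs'])
  convert h2 using 2 <;> ring

lemma sum_below (h : InsertSystem w y c p z σ U m) {r : ℕ} (hr : r ≤ m) (P : A)
    (hP : ∀ s, s + 1 < m → s + 1 ≠ r → σ s P = P) :
    U r ((∑ t ∈ Finset.range (r + 1), (∏ s ∈ Finset.range t, (w - c * z s)) *
        ∏ s ∈ Finset.Ico t m, (c * w - z s)) * P) =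
      U r ((∑ k ∈ Finset.range (r + 1), c ^ k) *
        ((∏ s ∈ Finset.range r, (w - z s)) * (if r = m then 1 else (c ^ (m - r) * w - z r) *
        ∏ s ∈ Finset.range (m - r - 1), (w - z (r + (s + 1))))) * P) := by
  have e1 : (∑ t ∈ Finset.range (r + 1), (∏ s ∈ Finset.range t, (w - c * z s)) *
        ∏ s ∈ Finset.Ico t m, (c * w - z s)) =
      (∑ t ∈ Finset.range (r + 1), (∏ s ∈ Finset.range t, (w - c * z s)) *
        ∏ s ∈ Finset.Ico t r, (c * w - z s)) *
        ∏ s ∈ Finset.range (m - r), (c * w - z (r + s)) := by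
    rw [Finset.sum_mul]
    refine Finset.sum_congr rfl fun t ht => ?_
    have := Finset.mem_range.1 ht
    rw [← Finset.prod_Ico_consecutive _ (show t ≤ r by omega) hr, mul_assoc,
      Finset.prod_Ico_eq_prod_range _ r m]
  have h1 := (h.left r hr).sum_prod r
      ((∏ s ∈ Finset.range (m - r), (c * w - z (r + s))) * P) (by
    intro s hs
    have e2 := h.map_right_prod (c * w) 1 (r := r) (s := s) (by omega) hr
      (by rw [map_mul, h.map_c _ (by omega), h.map_w _ (by omega)]) (map_one _)
    simp only [one_mul] at e2
    rw [map_mul, e2, hP _ (by omega) (by omega)])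
  rw [AddMonoidHom.mem_ker, map_sub, sub_eq_zero] at h1
  rw [e1, mul_assoc, h1]
  have h2 := h.right_first hr ((∑ k ∈ Finset.range (r + 1), c ^ k) *
      (∏ s ∈ Finset.range r, (w - z s)) * P) (by
    intro s hs hs'
    have e2 : σ s (∏ t ∈ Finset.range r, (w - z t)) =
        ∏ t ∈ Finset.range r, (w - z t) := by
      rcases Nat.lt_or_ge s r with hsr | hsr
      · have h3 := h.left r hr
        rw [map_prod]
        refine Finset.prod_bij' (fun t _ => Equiv.swap s (s + 1) t)
          (fun t _ => Equiv.swap s (s + 1) t) ?_ ?_ (by simp) (by simp) ?_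
        · intro t ht
          have := Finset.mem_range.1 ht
          rw [Finset.mem_range, Equiv.swap_apply_def]
          split_ifs <;> omega
        · intro t ht
          have := Finset.mem_range.1 ht
          rw [Finset.mem_range, Equiv.swap_apply_def]
          split_ifs <;> omega
        · intro t ht
          have := Finset.mem_range.1 ht
          rw [map_sub, h.map_w _ hs, Equiv.swap_apply_def]
          split_ifs with h4 h5
          · subst h4; rw [h3.map_left t (by omega)]
          · subst h5; rw [h3.map_right s (by omega)]
          · rw [h3.map_other s (by omega) t (by omega) h4 h5]
      · simpa using h.map_left_prod w 1 (r := r) (s := s) (by omega) hs (h.map_w _ hs) (map_one _)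
    simp only [map_mul, map_sum, map_pow, h.map_c _ hs, e2, hP _ hs hs'])
  convert h2 using 2 <;> ring

/-- The alternating sum over insertion positions vanishes by telescoping. -/
theorem alternating_sum (h : InsertSystem w y c p z σ U m) {Q Qi : A} (hQ : Q * Qi = 1)
    (hc : c = Q ^ 2) (hp : p = Qi ^ m) (β κ : ℕ → A)
    (hβ : ∀ r s, s + 1 < m → σ s (β r) = β r)
    (h1 : ∀ r, r ≤ m → β r * ∑ k ∈ Finset.range (m - r + 1), c ^ k = κ r * Q ^ (m - r))
    (h2 : ∀ r, r ≤ m → β (r + 1) * ∑ k ∈ Finset.range (r + 1), c ^ k = κ r * Q ^ r)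
    (h3 : ∀ r, r < m → κ (r + 1) * (Q ^ (r + 1) - Qi ^ (r + 1)) =
      κ r * (Q ^ (m - r) - Qi ^ (m - r)))
    (P : A) (hP : ∀ s, s + 1 < m → σ s P = P) :
    ∑ r ∈ Finset.range (m + 1), U r ((-1) ^ r * (β r * (w - p * y) *
        (∑ t ∈ Finset.Ico r (m + 1), (∏ s ∈ Finset.range t, (w - c * z s)) *
          ∏ s ∈ Finset.Ico t m, (c * w - z s)) -
        β (r + 1) * (p * w - y) *
        (∑ t ∈ Finset.range (r + 1), (∏ s ∈ Finset.range t, (w - c * z s)) *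
          ∏ s ∈ Finset.Ico t m, (c * w - z s))) * P) = 0 := by
  set ρ : ℕ → A := fun r => (-1) ^ r * κ r * Q ^ m * (Q ^ (m - r) - Qi ^ (m - r)) with hρ
  set X : ℕ → E := fun r => U r (w * ρ r * (p * z r - y) *
    ((∏ s ∈ Finset.range r, (w - z s)) * ∏ s ∈ Finset.range (m - r - 1), (w - z (r + (s + 1)))) * P)
    with hX
  have hQa : ∀ n : ℕ, Q ^ n * Qi ^ n = 1 := fun n => by rw [← mul_pow, hQ, one_pow]
  have hXm : X m = 0 := by simp [hX, hρ]
  suffices H : ∀ r, r ≤ m → U r ((-1) ^ r * (β r * (w - p * y) *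
        (∑ t ∈ Finset.Ico r (m + 1), (∏ s ∈ Finset.range t, (w - c * z s)) *
          ∏ s ∈ Finset.Ico t m, (c * w - z s)) -
        β (r + 1) * (p * w - y) *
        (∑ t ∈ Finset.range (r + 1), (∏ s ∈ Finset.range t, (w - c * z s)) *
          ∏ s ∈ Finset.Ico t m, (c * w - z s))) * P) =
      (if r = 0 then 0 else X (r - 1)) - X r by
    rw [Finset.sum_congr rfl fun r hr => H r (by have := Finset.mem_range.1 hr; omega)]
    have : ∀ n, ∑ r ∈ Finset.range (n + 1), ((if r = 0 then 0 else X (r - 1)) - X r) = - X n := by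
      intro n
      induction n with
      | zero => simp
      | succ n ih => rw [Finset.sum_range_succ, ih]; simp [sub_eq_add_neg]
    rw [this, hXm, neg_zero]
  intro r hr
  have a1 := h.sum_above hr ((-1) ^ r * β r * (w - p * y) * P) (by
    intro s hs _
    simp only [map_mul, map_pow, map_neg, map_one, map_sub, hβ _ _ hs, h.map_w _ hs,
      h.map_p _ hs, h.map_y _ hs, hP _ hs])
  have a2 := h.sum_below hr ((-1) ^ r * β (r + 1) * (p * w - y) * P) (by
    intro s hs _
    simp only [map_mul, map_pow, map_neg, map_one, map_sub, hβ _ _ hs, h.map_w _ hs,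
      h.map_p _ hs, h.map_y _ hs, hP _ hs])
  have a3 : (if r = 0 then 0 else X (r - 1)) = U r (if r = 0 then 0 else
      w * ρ (r - 1) * (z (r - 1) - p * y) *
    ((∏ s ∈ Finset.range (r - 1), (w - z s)) * ∏ s ∈ Finset.range (m - r), (w - z (r + s)))
      * P) := by
    rcases r with _ | r
    · simp
    · simp only [Nat.add_one_ne_zero, if_false, Nat.add_sub_cancel]
      have := h.exchange r (by omega) (w * ρ r *
        ((∏ s ∈ Finset.range r, (w - z s)) *
          ∏ s ∈ Finset.range (m - (r + 1)), (w - z (r + 1 + s))) * P)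
      have e3 : (∏ s ∈ Finset.range (m - r - 1), (w - z (r + (s + 1)))) =
          ∏ s ∈ Finset.range (m - (r + 1)), (w - z (r + 1 + s)) := by
        rw [Nat.sub_sub]
        refine Finset.prod_congr rfl fun s _ => ?_
        rw [show r + (s + 1) = r + 1 + s by omega]
      simp only [hX, e3]
      convert this.symm using 2 <;> ring
  rw [a3]
  refine Eq.trans (Eq.trans (congrArg (U r) (by ring))
    ((map_sub (U r) _ _).trans (congrArg₂ (· - ·) a1 a2))) ?_
  rw [hX]
  simp only
  rw [← map_sub, ← map_sub]
  congr 1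
  have b1 := h1 r hr
  have b2 := h2 r hr
  rcases r with _ | r
  · rcases m with _ | m
    · simp only [pow_zero] at hp
      simp [hp] at b1 b2 ⊢
      rw [b1, b2]; simp [hρ]
    · simp only [if_true, (show (0 : ℕ) ≠ m + 1 by omega), if_false, Finset.prod_range_zero,
        Nat.sub_zero, Finset.prod_range_succ', hρ, Nat.add_sub_cancel, zero_add, pow_zero, one_mul,
        mul_one] at b1 b2 ⊢
      have q := insert_first _ _ w y (z 0) (hQa (m + 1))
      have e5 : c ^ (m + 1) = Q ^ (m + 1) * Q ^ (m + 1) := by rw [hc]; ring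
      rw [e5, hp]
      simp only [Finset.sum_range_one, pow_zero, mul_one] at b2 ⊢
      linear_combination ((∏ s ∈ Finset.range m, (w - z (s + 1))) * (w - z 0) *
        (w - Qi ^ (m + 1) * y) * P) * b1 -
        ((Qi ^ (m + 1) * w - y) * (Q ^ (m + 1) * Q ^ (m + 1) * w - z 0) *
          (∏ s ∈ Finset.range m, (w - z (s + 1))) * P) * b2 +
        κ 0 * (∏ s ∈ Finset.range m, (w - z (s + 1))) * P * q
  · have b3 := h3 r (by omega)
    obtain ⟨L, rfl⟩ := Nat.exists_eq_add_of_le hr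
    have e5 : c ^ (r + 1) = Q ^ (r + 1) * Q ^ (r + 1) := by rw [hc]; ring
    simp only [Nat.add_one_ne_zero, if_false, Nat.add_sub_cancel, Nat.add_sub_cancel_left,
      hρ, Finset.prod_range_succ (fun s => w - z s), e5, hp,
      show r + 1 + L - r = L + 1 by omega] at b1 b2 b3 ⊢
    rcases L with _ | L
    · have q := insert_last _ _ w y (z r) (hQa (r + 1))
      simp [hp] at b1 b2 b3 ⊢
      generalize (∏ s ∈ Finset.range r, (w - z s)) = Z at *
      linear_combination ((-1) ^ (r + 1) * Z * (w - Q ^ (r + 1) * Q ^ (r + 1) * z r) *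
        (w - Qi ^ (r + 1) * y) * P) * b1 -
        ((-1) ^ (r + 1) * (Qi ^ (r + 1) * w - y) * Z * (w - z r) * P) * b2 +
        (-1) ^ (r + 1) * κ (r + 1) * Z * P * q
        + (w * (-1) ^ r * Q ^ (r + 1) * (z r - Qi ^ (r + 1) * y) * Z * P) * b3
    · have q := insert_middle (Q ^ (L + 1)) _ (Qi ^ (L + 1)) _ w y (z r) (z (r + 1))
        (hQa (L + 1)) (hQa (r + 1))
      have e6 : c ^ (L + 1) = Q ^ (L + 1) * Q ^ (L + 1) := by rw [hc]; ring
      simp only [Finset.prod_range_succ', e6, Nat.add_sub_cancel, Nat.add_zero,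
        show ¬ (r + 1 = r + 1 + (L + 1)) by omega, if_false]
      generalize (∏ s ∈ Finset.range r, (w - z s)) = Z at *
      generalize (∏ s ∈ Finset.range L, (w - z (r + 1 + (s + 1)))) = Z' at *
      rw [show r + 1 + (L + 1) = (L + 1) + (r + 1) by omega, pow_add Qi, pow_add Q]
      linear_combination ((-1) ^ (r + 1) * Z * Z' * (w - Q ^ (r + 1) * Q ^ (r + 1) * z r) *
        (w - z (r + 1)) * (w - Qi ^ (L + 1) * Qi ^ (r + 1) * y) * P) * b1 -
        ((-1) ^ (r + 1) * (Qi ^ (L + 1) * Qi ^ (r + 1) * w - y) * Z * (w - z r) *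
          (Q ^ (L + 1) * Q ^ (L + 1) * w - z (r + 1)) * Z' * P) * b2 +
        (-1) ^ (r + 1) * κ (r + 1) * Z * Z' * P * q
        + (w * (-1) ^ r * Q ^ (L + 1) * Q ^ (r + 1) *
          (z r - Qi ^ (L + 1) * Qi ^ (r + 1) * y) * (w - z (r + 1)) * Z * Z' * P) * b3

end InsertSystem
end Insert
end QAff

namespace QAff

section Words

variable {R E : Type*} [CommRing R] [Ring E] [Algebra R E]

/-- The quadratic exchange relation between two families of modes. -/
def QuadRel (p : R) (f g : ℤ → E) : Prop :=
  ∀ k l, f (k + 1) * g l - p • (g l * f (k + 1)) = p • (f k * g (l + 1)) - g (l + 1) * f k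

/-- Laurent polynomials in countably many variables. -/
abbrev LPol (R : Type*) [CommRing R] := AddMonoidAlgebra R (ℕ → ℤ)

/-- The `v`-th variable. -/
def LPol.X (v : ℕ) : LPol R := AddMonoidAlgebra.single (Pi.single v 1) 1

/-- Scalars as Laurent polynomials. -/
abbrev LPol.C : R →+* LPol R := algebraMap R (LPol R)

open LPol

/-- The product of the letters `f v`, `v ∈ l`, with modes given by `κ`. -/
def word (f : ℕ → ℤ → E) (l : List ℕ) (κ : ℕ → ℤ) : E := (l.map fun v => f v (κ v)).prod

/-- The linear extension of `word` to Laurent polynomials. -/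
def wordMap (f : ℕ → ℤ → E) (l : List ℕ) : LPol R →ₗ[R] E :=
  Finsupp.linearCombination R (word f l) ∘ₗ (AddMonoidAlgebra.coeffLinearEquiv R).toLinearMap

@[simp] lemma wordMap_single (f : ℕ → ℤ → E) (l : List ℕ) (κ : ℕ → ℤ) (r : R) :
    wordMap f l (AddMonoidAlgebra.single κ r) = r • word f l κ := by
  simp [wordMap]

lemma LPol.X_mul_single (v : ℕ) (κ : ℕ → ℤ) (r : R) :
    X v * AddMonoidAlgebra.single κ r = AddMonoidAlgebra.single (κ + Pi.single v 1) r := by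
  rw [X, AddMonoidAlgebra.single_mul_single, one_mul, add_comm]

lemma word_append (f : ℕ → ℤ → E) (l l' : List ℕ) (κ : ℕ → ℤ) :
    word f (l ++ l') κ = word f l κ * word f l' κ := by
  simp [word]

lemma word_cons (f : ℕ → ℤ → E) (v : ℕ) (l : List ℕ) (κ : ℕ → ℤ) :
    word f (v :: l) κ = f v (κ v) * word f l κ := by
  simp [word]

lemma word_congr (f g : ℕ → ℤ → E) (l : List ℕ) (κ κ' : ℕ → ℤ)
    (h : ∀ v ∈ l, f v (κ v) = g v (κ' v)) : word f l κ = word g l κ' := by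
  rw [word, word, List.map_congr_left h]

lemma word_add_single (f : ℕ → ℤ → E) (l : List ℕ) (κ : ℕ → ℤ) {v : ℕ} (hv : v ∉ l) :
    word f l (κ + Pi.single v 1) = word f l κ :=
  word_congr f f l _ _ fun u hu => by
    rw [Pi.add_apply, Pi.single_eq_of_ne (by rintro rfl; exact hv hu), add_zero]

lemma wordMap_exchange (f : ℕ → ℤ → E) {p : R} {u v : ℕ} (huv : u ≠ v) {l₁ l₂ : List ℕ}
    (hu₁ : u ∉ l₁) (hv₁ : v ∉ l₁) (hu₂ : u ∉ l₂) (hv₂ : v ∉ l₂) (h : QuadRel p (f u) (f v))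
    (P : LPol R) :
    wordMap f (l₁ ++ u :: v :: l₂) ((X u - C p * X v) * P) =
      wordMap f (l₁ ++ v :: u :: l₂) ((C p * X u - X v) * P) := by
  induction P using AddMonoidAlgebra.induction_linear with
  | zero => simp
  | add P P' h1 h2 => rw [mul_add, mul_add, map_add, map_add, h1, h2]
  | single κ r =>
    have key := h (κ u) (κ v)
    rw [sub_mul, sub_mul, mul_assoc, mul_assoc, ← Algebra.smul_def, ← Algebra.smul_def,
      X_mul_single, X_mul_single, map_sub, map_sub, map_smul, map_smul]
    simp only [wordMap_single, word_append, word_cons, word_add_single f _ κ hu₁,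
      word_add_single f _ κ hu₂, word_add_single f _ κ hv₁, word_add_single f _ κ hv₂,
      Pi.add_apply, Pi.single_eq_same, Pi.single_eq_of_ne huv, Pi.single_eq_of_ne huv.symm,
      add_zero]
    have := congrArg (fun t => r • (word f l₁ κ * t * word f l₂ κ)) key
    simp only [mul_sub, sub_mul, smul_sub, mul_smul_comm, smul_mul_assoc, mul_assoc] at this
    rw [smul_comm p r, smul_comm p r]
    rw [sub_eq_sub_iff_sub_eq_sub]
    simpa only [mul_assoc] using this

/-- Renaming of variables. -/
def LPol.perm (π : Equiv.Perm ℕ) : LPol R →+* LPol R :=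
  AddMonoidAlgebra.mapDomainRingHom R
    { toFun := fun κ : ℕ → ℤ => κ ∘ π, map_zero' := rfl, map_add' := fun _ _ => rfl }

@[simp] lemma LPol.perm_single (π : Equiv.Perm ℕ) (κ : ℕ → ℤ) (r : R) :
    perm π (AddMonoidAlgebra.single κ r) = AddMonoidAlgebra.single (κ ∘ π) r := by
  simp [perm]

lemma LPol.perm_X (π : Equiv.Perm ℕ) (v : ℕ) : perm π (X (R := R) v) = X (π.symm v) := by
  rw [X, perm_single, X]
  congr 1
  funext u
  by_cases h : π u = v
  · subst h; simp
  · rw [Function.comp_apply, Pi.single_eq_of_ne h, Pi.single_eq_of_ne]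
    rintro rfl; simp at h

lemma LPol.perm_C (π : Equiv.Perm ℕ) (r : R) : perm π (C r) = C r := by
  simp only [AddMonoidAlgebra.coe_algebraMap, Function.comp_apply, perm_single]
  rfl

lemma wordMap_swap (f : ℕ → ℤ → E) {u v : ℕ} (hf : f u = f v) {l₁ l₂ : List ℕ}
    (hu₁ : u ∉ l₁) (hv₁ : v ∉ l₁) (hu₂ : u ∉ l₂) (hv₂ : v ∉ l₂) (P : LPol R) :
    wordMap f (l₁ ++ u :: v :: l₂) (perm (Equiv.swap u v) P) =
      wordMap f (l₁ ++ v :: u :: l₂) P := by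
  induction P using AddMonoidAlgebra.induction_linear with
  | zero => simp
  | add P P' h1 h2 => rw [map_add, map_add, map_add, h1, h2]
  | single κ r =>
    have : ∀ l : List ℕ, u ∉ l → v ∉ l → word f l (κ ∘ Equiv.swap u v) = word f l κ := by
      intro l h1 h2
      refine word_congr f f l _ _ fun t ht => ?_
      rw [Function.comp_apply, Equiv.swap_apply_of_ne_of_ne]
      · rintro rfl; exact h1 ht
      · rintro rfl; exact h2 ht
    simp only [perm_single, wordMap_single, word_append, word_cons, this _ hu₁ hv₁,
      this _ hu₂ hv₂, Function.comp_apply, Equiv.swap_apply_left, Equiv.swap_apply_right, hf]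

lemma wordMap_invariant (h2 : ∀ x : E, x + x = 0 → x = 0) (f : ℕ → ℤ → E) {c : R} {u v : ℕ}
    (huv : u ≠ v) (hf : f u = f v) {l₁ l₂ : List ℕ}
    (hu₁ : u ∉ l₁) (hv₁ : v ∉ l₁) (hu₂ : u ∉ l₂) (hv₂ : v ∉ l₂) (h : QuadRel c (f u) (f u))
    (P : LPol R) (hP : perm (Equiv.swap u v) P = P) :
    wordMap f (l₁ ++ u :: v :: l₂) ((X u - C c * X v) * P) = 0 := by
  apply h2
  have h1 := wordMap_exchange f huv hu₁ hv₁ hu₂ hv₂ (by rw [← hf]; exact h) P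
  rw [← wordMap_swap f hf hu₁ hv₁ hu₂ hv₂, map_mul (perm _), hP, map_sub (perm _),
    map_mul (perm _), perm_C, perm_X, perm_X,
    Equiv.symm_swap, Equiv.swap_apply_left, Equiv.swap_apply_right] at h1
  nth_rewrite 2 [h1]
  rw [← map_add]
  convert map_zero (wordMap (R := R) f (l₁ ++ u :: v :: l₂))
  ring

lemma wordMap_move (f : ℕ → ℤ → E) (p : ℕ → R) {w : ℕ} {l₁ l₂ : List ℕ}
    (h : ∀ v ∈ l₁, QuadRel (p v) (f w) (f v)) (hw₁ : w ∉ l₁) (hw₂ : w ∉ l₂)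
    (hl : (l₁ ++ l₂).Nodup) (P : LPol R) :
    wordMap f (l₁ ++ w :: l₂) ((l₁.map fun v => C (p v) * X w - X v).prod * P) =
      wordMap f (w :: (l₁ ++ l₂)) ((l₁.map fun v => X w - C (p v) * X v).prod * P) := by
  induction l₁ using List.reverseRecOn generalizing l₂ P with
  | nil => simp
  | append_singleton l v ih =>
    have e1 := wordMap_exchange f (p := p v) (u := w) (v := v) (l₁ := l) (l₂ := l₂)
      (by rintro rfl; simp at hw₁) (by simp at hw₁; tauto)
      (by simp [List.nodup_append] at hl; intro hv; have := (hl.2.2 v hv).1; simp at this) hw₂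
      (by simp [List.nodup_append] at hl; tauto)
      (h v (by simp)) ((l.map fun v => C (p v) * X w - X v).prod * P)
    have e2 := ih (l₂ := v :: l₂) (fun u hu => h u (by simp [hu])) (by simp at hw₁; tauto)
      (by simp at hw₁ ⊢; tauto) (by simpa using hl) ((X w - C (p v) * X v) * P)
    simp only [List.map_append, List.prod_append, List.map_cons, List.map_nil, List.prod_cons,
      List.prod_nil, mul_one, List.append_assoc, List.cons_append, List.nil_append] at *
    rw [mul_assoc, mul_assoc, mul_left_comm, ← e1, mul_left_comm, e2]

end Words

section Cancel

/-- Cancellation of a factor that is invertible up to lower filtration. -/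
lemma eq_zero_of_filtration {A E : Type*} [CommRing A] [AddCommGroup E] (F : ℤ → AddSubgroup A)
    (hmul : ∀ a b x y, x ∈ F a → y ∈ F b → x * y ∈ F (a + b))
    (S : Subring A) (Z : A →+ E) (e₀ : ℤ) (hZ : ∀ P ∈ F e₀, Z P = 0)
    (B u' : A) (hB : B ∈ S) (hu' : u' ∈ S)
    (hBu : B * u' - 1 ∈ F (-1)) (h : ∀ P ∈ S, Z (B * P) = 0) (n : ℕ) :
    ∀ P ∈ S, P ∈ F (e₀ + n) → Z P = 0 := by
  induction n with
  | zero => intro P _ hP; exact hZ P (by simpa using hP)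
  | succ n ih =>
    intro P hPS hP
    have h1 := h (u' * P) (S.mul_mem hu' hPS)
    have h2 := ih ((B * u' - 1) * P)
      (S.mul_mem (S.sub_mem (S.mul_mem hB hu') S.one_mem) hPS) (by
        have := hmul _ _ _ _ hBu hP
        convert this using 2
        push_cast; ring)
    have : Z P = Z (B * (u' * P)) - Z ((B * u' - 1) * P) := by
      rw [← map_sub]; congr 1; ring
    rw [this, h1, h2, sub_zero]

end Cancel
end QAff

namespace QAff

section LPolCancel

variable {R E : Type*} [CommRing R] [Ring E] [Algebra R E]
open LPol

/-- The inverse of the `v`-th variable. -/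
def LPol.Xinv (v : ℕ) : LPol R := AddMonoidAlgebra.single (Pi.single v (-1)) 1

lemma LPol.X_mul_Xinv (v : ℕ) : X (R := R) v * Xinv v = 1 := by
  rw [X, Xinv, AddMonoidAlgebra.single_mul_single, ← Pi.single_add]
  simp [AddMonoidAlgebra.one_def]

lemma LPol.perm_Xinv (π : Equiv.Perm ℕ) (v : ℕ) :
    perm π (Xinv (R := R) v) = Xinv (π.symm v) := by
  have h1 := congrArg (perm π) (X_mul_Xinv (R := R) v)
  rw [map_mul, perm_X, map_one] at h1
  have h2 := X_mul_Xinv (R := R) (π.symm v)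
  calc perm π (Xinv v) = (X (π.symm v) * Xinv (π.symm v)) * perm π (Xinv v) := by rw [h2, one_mul]
    _ = (X (π.symm v) * perm π (Xinv v)) * Xinv (π.symm v) := by ring
    _ = _ := by rw [h1, one_mul]

/-- Laurent polynomials of degree at most `e`, the degree being `ε` times the degree in the
variable `0`. -/
def LPol.filt (R : Type*) [CommRing R] (ε e : ℤ) : Submodule R (LPol R) :=
  Submodule.span R ((fun κ => AddMonoidAlgebra.single κ 1) '' {κ : ℕ → ℤ | ε * κ 0 ≤ e})

lemma LPol.single_mem_filt {ε e : ℤ} {κ : ℕ → ℤ} (r : R) (h : ε * κ 0 ≤ e) :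
    (AddMonoidAlgebra.single κ r : LPol R) ∈ filt R ε e := by
  have : (AddMonoidAlgebra.single κ r : LPol R) = r • AddMonoidAlgebra.single κ 1 := by simp
  rw [this]
  exact Submodule.smul_mem _ _ (Submodule.subset_span ⟨κ, h, rfl⟩)

lemma LPol.filt_mono (ε : ℤ) {a b : ℤ} (h : a ≤ b) : filt R ε a ≤ filt R ε b :=
  Submodule.span_mono (Set.image_mono fun _ hκ => le_trans hκ h)

lemma LPol.mul_mem_filt {ε a b : ℤ} {x y : LPol R} (hx : x ∈ filt R ε a) (hy : y ∈ filt R ε b) :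
    x * y ∈ filt R ε (a + b) := by
  have h := Submodule.mul_mem_mul hx hy
  rw [filt, filt, Submodule.span_mul_span] at h
  refine Submodule.span_mono ?_ h
  rintro _ ⟨_, ⟨κ, hκ, rfl⟩, _, ⟨κ', hκ', rfl⟩, rfl⟩
  refine ⟨κ + κ', ?_, by simp [AddMonoidAlgebra.single_mul_single]⟩
  simp only [Set.mem_ofPred_eq, Pi.add_apply] at *
  rw [mul_add]; omega

lemma LPol.exists_mem_filt (ε : ℤ) (P : LPol R) : ∃ e, P ∈ filt R ε e := by
  induction P using AddMonoidAlgebra.induction_linear with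
  | zero => exact ⟨0, Submodule.zero_mem _⟩
  | add P P' h1 h2 =>
    obtain ⟨a, ha⟩ := h1
    obtain ⟨b, hb⟩ := h2
    exact ⟨max a b, Submodule.add_mem _ (filt_mono ε (le_max_left _ _) ha)
      (filt_mono ε (le_max_right _ _) hb)⟩
  | single κ r => exact ⟨_, single_mem_filt r le_rfl⟩

lemma LPol.prod_sub_one_mem_filt (ε : ℤ) (L : Finset ℕ) (g : ℕ → LPol R)
    (h : ∀ v ∈ L, g v - 1 ∈ filt R ε (-1)) : ∏ v ∈ L, g v - 1 ∈ filt R ε (-1) := by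
  induction L using Finset.induction_on with
  | empty => simp
  | insert v L hv ih =>
    have h1 := ih fun u hu => h u (Finset.mem_insert_of_mem hu)
    have h2 := h v (Finset.mem_insert_self _ _)
    rw [Finset.prod_insert hv]
    have : g v * ∏ u ∈ L, g u - 1 = (g v - 1) * (∏ u ∈ L, g u - 1) + (g v - 1)
        + (∏ u ∈ L, g u - 1) := by ring
    rw [this]
    exact Submodule.add_mem _ (Submodule.add_mem _
      (filt_mono ε (by norm_num) (mul_mem_filt h2 h1)) h2) h1

/-- The Laurent polynomials invariant under the adjacent transpositions of the variables
`2, …, m + 1`. -/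
def LPol.symm (R : Type*) [CommRing R] (m : ℕ) : Subring (LPol R) where
  carrier := {P | ∀ s, s + 1 < m → perm (Equiv.swap (s + 2) (s + 3)) P = P}
  mul_mem' ha hb s hs := by rw [map_mul, ha s hs, hb s hs]
  one_mem' s _ := map_one _
  add_mem' ha hb s hs := by rw [map_add, ha s hs, hb s hs]
  zero_mem' s _ := map_zero _
  neg_mem' ha s hs := by rw [map_neg, ha s hs]

lemma LPol.prod_mem_symm {m : ℕ} (L : Finset ℕ) (g : ℕ → LPol R)
    (hL : ∀ s, s + 1 < m → ∀ v, v ∈ L ↔ Equiv.swap (s + 2) (s + 3) v ∈ L)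
    (hg : ∀ s, s + 1 < m → ∀ v ∈ L,
      perm (Equiv.swap (s + 2) (s + 3)) (g v) = g (Equiv.swap (s + 2) (s + 3) v)) :
    ∏ v ∈ L, g v ∈ symm R m := by
  intro s hs
  rw [map_prod]
  exact Finset.prod_equiv (Equiv.swap (s + 2) (s + 3)) (fun v => hL s hs v) fun v hv => hg s hs v hv

/-- If `Z` kills all monomials whose degree in the variable `0` is small (or large), then the
factor `∏ (p_v X_0 - X_v)` can be cancelled. -/
theorem LPol.cancel (Z : LPol R →ₗ[R] E) (m : ℕ) (L : Finset ℕ) (h0 : 0 ∉ L) (p p' : ℕ → R)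
    (hp : ∀ v, p v * p' v = 1)
    (hL : ∀ s, s + 1 < m → ∀ v, v ∈ L ↔ Equiv.swap (s + 2) (s + 3) v ∈ L)
    (hpL : ∀ s, s + 1 < m → ∀ v ∈ L, p (Equiv.swap (s + 2) (s + 3) v) = p v)
    (hZ : (∃ b : ℤ, ∀ κ r, κ 0 < b → Z (AddMonoidAlgebra.single κ r) = 0) ∨
      (∃ b : ℤ, ∀ κ r, b < κ 0 → Z (AddMonoidAlgebra.single κ r) = 0))
    (h : ∀ P ∈ symm R m, Z ((∏ v ∈ L, (C (p v) * X 0 - X v)) * P) = 0) (P : LPol R)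
    (hP : P ∈ symm R m) : Z P = 0 := by
  have hπ0 : ∀ s, Equiv.swap (s + 2) (s + 3) 0 = 0 := fun s =>
    Equiv.swap_apply_of_ne_of_ne (by omega) (by omega)
  have hpL' : ∀ s, s + 1 < m → ∀ v ∈ L, p' (Equiv.swap (s + 2) (s + 3) v) = p' v := by
    intro s hs v hv
    have h1 := hp (Equiv.swap (s + 2) (s + 3) v)
    rw [hpL s hs v hv] at h1
    calc _ = (p v * p' v) * p' (Equiv.swap (s + 2) (s + 3) v) := by rw [hp, one_mul]
      _ = (p v * p' (Equiv.swap (s + 2) (s + 3) v)) * p' v := by ring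
      _ = _ := by rw [h1, one_mul]
  have hB : ∏ v ∈ L, (C (p v) * X 0 - X v) ∈ symm R m := by
    refine prod_mem_symm L _ hL fun s hs v hv => ?_
    rw [map_sub (perm _), map_mul (perm _), perm_C, perm_X, perm_X, Equiv.symm_swap, hπ0,
      hpL s hs v hv]
  suffices H : ∃ (ε e₀ : ℤ) (u' : ℕ → LPol R), (∀ P ∈ filt R ε e₀, Z P = 0) ∧
      (∀ s, s + 1 < m → ∀ v ∈ L,
        perm (Equiv.swap (s + 2) (s + 3)) (u' v) = u' (Equiv.swap (s + 2) (s + 3) v)) ∧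
      (∀ v ∈ L, (C (p v) * X 0 - X v) * u' v - 1 ∈ filt R ε (-1)) by
    obtain ⟨ε, e₀, u', hk, hu', hBu⟩ := H
    obtain ⟨e, he⟩ := exists_mem_filt ε P
    refine eq_zero_of_filtration (fun e => (filt R ε e).toAddSubgroup)
      (fun a b x y hx hy => mul_mem_filt hx hy) (symm R m) Z.toAddMonoidHom e₀ hk _
      (∏ v ∈ L, u' v) hB (prod_mem_symm L _ hL hu') ?_ h (e - e₀).toNat P hP
      (filt_mono ε (by omega) he)
    rw [← Finset.prod_mul_distrib]
    exact prod_sub_one_mem_filt ε L _ hBu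
  have hkill : ∀ ε e₀ : ℤ, (∀ κ r, ε * κ 0 ≤ e₀ → Z (AddMonoidAlgebra.single κ r) = 0) →
      ∀ P ∈ filt R ε e₀, Z P = 0 := by
    intro ε e₀ hh P hP
    have : filt R ε e₀ ≤ LinearMap.ker Z := Submodule.span_le.2 (by
      rintro _ ⟨κ, hκ, rfl⟩
      exact hh κ 1 hκ)
    exact this hP
  rcases hZ with ⟨b, hb⟩ | ⟨b, hb⟩
  · refine ⟨1, b - 1, fun v => C (p' v) * Xinv 0, hkill _ _ fun κ r hκ => hb κ r (by omega), ?_, ?_⟩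
    · intro s hs v hv
      rw [map_mul (perm _), perm_C, perm_Xinv, Equiv.symm_swap, hπ0]
      show _ = C (p' (Equiv.swap (s + 2) (s + 3) v)) * Xinv 0
      rw [hpL' s hs v hv]
    · intro v hv
      have e1 : (C (p v) * X 0 - X v) * (C (p' v) * Xinv 0) - 1 =
          C (p v * p' v) * (X 0 * Xinv 0) - 1 - C (p' v) * (X v * Xinv 0) := by
        rw [map_mul]; ring
      rw [e1, hp, X_mul_Xinv, map_one, one_mul, sub_self, zero_sub, ← Algebra.smul_def]
      refine Submodule.neg_mem _ (Submodule.smul_mem _ _ ?_)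
      rw [X, Xinv, AddMonoidAlgebra.single_mul_single]
      apply single_mem_filt
      have : (0 : ℕ) ≠ v := by rintro rfl; exact h0 hv
      simp [Pi.single_eq_of_ne this]
  · refine ⟨-1, -b - 1, fun v => -Xinv v, hkill _ _ fun κ r hκ => hb κ r (by omega), ?_, ?_⟩
    · intro s hs v hv
      rw [map_neg (perm _), perm_Xinv, Equiv.symm_swap]
    · intro v hv
      have e1 : (C (p v) * X 0 - X v) * (-Xinv v) - 1 =
          (X v * Xinv v) - 1 - C (p v) * (X 0 * Xinv v) := by ring
      rw [e1, X_mul_Xinv, sub_self, zero_sub, ← Algebra.smul_def]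
      refine Submodule.neg_mem _ (Submodule.smul_mem _ _ ?_)
      rw [X, Xinv, AddMonoidAlgebra.single_mul_single]
      apply single_mem_filt
      have : (0 : ℕ) ≠ v := by rintro rfl; exact h0 hv
      simp [Pi.single_eq_of_ne this]

end LPolCancel
end QAff

namespace QAff

section SerreTarget

variable {R E : Type*} [CommRing R] [Ring E] [Algebra R E]
open LPol

/-- The properties of the Gaussian binomial coefficients used in the Serre relations. -/
structure SerreCoeffs (Q Qi : R) (m : ℕ) (β : ℕ → R) : Prop where
  inv : Q * Qi = 1
  partial_sums : ∃ S : ℕ → R, S 0 = β 0 ∧ (∀ r, r < m + 1 → S (r + 1) = β (r + 1) - Qi ^ m * S r) ∧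
    (∀ r, r < m + 1 →
      S (r + 1) * Qi ^ (m + 2) = β (r + 1) * (Q ^ 2) ^ (r + 1) * Qi ^ (m + 2) - S r) ∧
    S (m + 1) = 0
  products : ∃ κ : ℕ → R,
    (∀ r, r ≤ m → β r * ∑ k ∈ Finset.range (m - r + 1), (Q ^ 2) ^ k = κ r * Q ^ (m - r)) ∧
    (∀ r, r ≤ m → β (r + 1) * ∑ k ∈ Finset.range (r + 1), (Q ^ 2) ^ k = κ r * Q ^ r) ∧
    (∀ r, r < m → κ (r + 1) * (Q ^ (r + 1) - Qi ^ (r + 1)) =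
      κ r * (Q ^ (m - r) - Qi ^ (m - r)))

/-- One of the two sides of a family of modes vanishes. -/
def OneSided (Θ : ℤ → E) : Prop :=
  (∃ b : ℤ, ∀ l, l < b → Θ l = 0) ∨ (∃ b : ℤ, ∀ l, b < l → Θ l = 0)

/-- The left-hand side of the Serre relation. -/
def serreSum (β : ℕ → R) (n : ℕ) (x y : ℤ → E) (k : Fin n → ℤ) (l : ℤ) : E :=
  ∑ σ : Equiv.Perm (Fin n), ∑ r ∈ Finset.range (n + 1), ((-1) ^ r * β r) •
    ((((List.finRange n).take r).map fun t => x (k (σ t))).prod * y l *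
      (((List.finRange n).drop r).map fun t => x (k (σ t))).prod)

lemma finRange_map_add (n a : ℕ) : (List.finRange n).map (fun t => t.val + a) = List.range' a n := by
  apply List.ext_getElem <;> simp [add_comm]

lemma map_take_finRange {B : Type*} {n r a : ℕ} (g : Fin n → B) (g' : ℕ → B) (hr : r ≤ n)
    (h : ∀ t : Fin n, g' (t + a) = g t) :
    ((List.finRange n).take r).map g = (List.range' a r).map g' := by
  have : (List.finRange n).map g = (List.range' a n).map g' := by
    rw [← finRange_map_add, List.map_map]
    exact List.map_congr_left fun t _ => (h t).symm
  rw [List.map_take, this, ← List.map_take]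
  conv_lhs => rw [show n = r + (n - r) by omega, ← List.range'_append_1]
  rw [List.take_left' (by simp)]

lemma map_drop_finRange {B : Type*} {n r a : ℕ} (g : Fin n → B) (g' : ℕ → B)
    (h : ∀ t : Fin n, g' (t + a) = g t) :
    ((List.finRange n).drop r).map g = (List.range' (a + r) (n - r)).map g' := by
  have : (List.finRange n).map g = (List.range' a n).map g' := by
    rw [← finRange_map_add, List.map_map]
    exact List.map_congr_left fun t _ => (h t).symm
  rw [List.map_drop, this, ← List.map_drop, List.drop_range', mul_one]

lemma LPol.sum_single_mem_symm {G : Type*} [Group G] [Fintype G] {m : ℕ} (κ : G → ℕ → ℤ)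
    (h : ∀ s, s + 1 < m → ∃ τ : G, ∀ σ, κ σ ∘ Equiv.swap (s + 2) (s + 3) = κ (σ * τ)) :
    ∑ σ, AddMonoidAlgebra.single (κ σ) 1 ∈ symm R m := by
  intro s hs
  obtain ⟨τ, hτ⟩ := h s hs
  rw [map_sum]
  refine Fintype.sum_equiv (Equiv.mulRight τ) _ _ fun σ => ?_
  rw [perm_single, hτ]; rfl

lemma prod_range'_map (g : ℕ → LPol R) (a n : ℕ) :
    ((List.range' a n).map g).prod = ∏ s ∈ Finset.range n, g (s + a) := by
  rw [← finRange_map_add, List.map_map, Finset.prod_range, ← List.prod_ofFn, List.ofFn_eq_map]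
  rfl

lemma X_swap_left {s : ℕ} : perm (Equiv.swap (s + 2) (s + 3)) (X (R := R) (s + 2)) = X (s + 3) := by
  rw [perm_X, Equiv.symm_swap, Equiv.swap_apply_left]

lemma X_swap_right {s : ℕ} : perm (Equiv.swap (s + 2) (s + 3)) (X (R := R) (s + 3)) = X (s + 2) := by
  rw [perm_X, Equiv.symm_swap, Equiv.swap_apply_right]

lemma X_swap_other {s t : ℕ} (h1 : t ≠ s + 2) (h2 : t ≠ s + 3) :
    perm (Equiv.swap (s + 2) (s + 3)) (X (R := R) t) = X t := by
  rw [perm_X, Equiv.symm_swap, Equiv.swap_apply_of_ne_of_ne h1 h2]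

/-- The words with letters `z_a, …, z_{a+n-1}` in consecutive positions form a swap system. -/
lemma swapSystem_wordMap (h2 : ∀ x : E, x + x = 0 → x = 0) (f : ℕ → ℤ → E) {c : R} {a n : ℕ}
    {x : ℤ → E} (hf : ∀ s, s < n → f (a + s + 2) = x) (hx : QuadRel c x x) (l₁ l₂ : List ℕ)
    (hl₁ : ∀ s, s < n → a + s + 2 ∉ l₁) (hl₂ : ∀ s, s < n → a + s + 2 ∉ l₂) :
    SwapSystem (X 0) (C c) (fun s => X (a + s + 2))
      (fun s => perm (Equiv.swap (a + s + 2) (a + s + 3)))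
      (wordMap (R := R) f (l₁ ++ (List.range' (a + 2) n ++ l₂))).toAddMonoidHom.ker n where
  map_left s _ := X_swap_left
  map_right s _ := X_swap_right
  map_other s _ t _ h1 h2 := X_swap_other (by omega) (by omega)
  map_w s _ := X_swap_other (by omega) (by omega)
  map_c s _ := perm_C _ _
  mem s hs P hP := by
    have e1 : List.range' (a + 2) n = List.range' (a + 2) s ++
        ((a + s + 2) :: (a + s + 3) :: List.range' (a + s + 4) (n - s - 2)) := by
      conv_lhs => rw [show n = s + (n - s - 2 + 1 + 1) by omega, ← List.range'_append_1,
        List.range'_succ, List.range'_succ]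
      simp only [show a + 2 + s = a + s + 2 by ring]
    have e2 : l₁ ++ (List.range' (a + 2) n ++ l₂) = (l₁ ++ List.range' (a + 2) s) ++
        (a + s + 2) :: (a + s + 3) :: (List.range' (a + s + 4) (n - s - 2) ++ l₂) := by
      rw [e1]; simp
    rw [AddMonoidHom.mem_ker, e2]
    have i1 := hl₁ s (by omega)
    have i2 := hl₁ (s + 1) (by omega)
    have i3 := hl₂ s (by omega)
    have i4 := hl₂ (s + 1) (by omega)
    refine wordMap_invariant h2 f (by omega) ((hf s (by omega)).trans (hf (s + 1) (by omega)).symm)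
      ?_ ?_ ?_ ?_ (by rw [hf s (by omega)]; exact hx) P hP <;>
    simp only [List.mem_append, List.mem_range'_1, not_or] <;> refine ⟨?_, ?_⟩ <;>
    first | assumption | omega

/-- The Serre relation is preserved when the letter in the middle is replaced. -/
theorem serreSum_replace_middle (h2 : ∀ x : E, x + x = 0 → x = 0) {Q Qi : R} {m : ℕ} {β : ℕ → R}
    (hβ : SerreCoeffs Q Qi m β) {x Θ : ℤ → E} (hx : QuadRel (Q ^ 2) x x)
    (hΘx : QuadRel (Qi ^ m) Θ x) (hΘ : OneSided Θ) (k : Fin (m + 1) → ℤ) (l : ℤ) :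
    serreSum β (m + 1) x Θ k l = 0 := by
  obtain ⟨S, hS0, hS1, hS2, hS3⟩ := hβ.partial_sums
  set f : ℕ → ℤ → E := fun v => if v = 0 then Θ else x with hf
  set κ : Equiv.Perm (Fin (m + 1)) → ℕ → ℤ := fun σ v =>
    if v = 0 then l else if h : v - 2 < m + 1 ∧ 2 ≤ v then k (σ ⟨v - 2, h.1⟩) else 0 with hκ
  set Z : LPol R →ₗ[R] E := ∑ r ∈ Finset.range (m + 1 + 1), ((-1) ^ r * β r) •
    wordMap f (List.range' 2 r ++ 0 :: List.range' (2 + r) (m + 1 - r)) with hZ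
  have hZM : serreSum β (m + 1) x Θ k l = Z (∑ σ, AddMonoidAlgebra.single (κ σ) 1) := by
    rw [serreSum, map_sum]
    refine Finset.sum_congr rfl fun σ _ => ?_
    rw [hZ, LinearMap.sum_apply]
    refine Finset.sum_congr rfl fun r hr => ?_
    have hr' := Finset.mem_range.1 hr
    rw [LinearMap.smul_apply, wordMap_single, one_smul, word_append, word_cons, word, word,
      ← mul_assoc]
    have hg : ∀ t : Fin (m + 1), f (t + 2) (κ σ (t + 2)) = x (k (σ t)) := by
      intro t; simp [hf, hκ, show (t : ℕ) ≤ m by omega]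
    rw [map_take_finRange (a := 2) _ (fun v => f v (κ σ v)) (by omega) hg,
      map_drop_finRange (a := 2) _ (fun v => f v (κ σ v)) hg]
    rfl
  have hM : ∑ σ, AddMonoidAlgebra.single (κ σ) 1 ∈ symm R (m + 1) := by
    refine sum_single_mem_symm κ fun s hs => ⟨Equiv.swap ⟨s, by omega⟩ ⟨s + 1, hs⟩, fun σ => ?_⟩
    funext v
    simp only [hκ, Function.comp_apply]
    by_cases h1 : v = s + 2
    · subst h1; rw [Equiv.swap_apply_left]
      simp [hs, show s < m + 1 by omega, show s + 3 - 2 = s + 1 by omega, show 2 ≤ s + 3 by omega]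
    · by_cases h3 : v = s + 3
      · subst h3; rw [Equiv.swap_apply_right]
        simp [hs, show s < m + 1 by omega, show s + 3 - 2 = s + 1 by omega, show 2 ≤ s + 3 by omega]
      · rw [Equiv.swap_apply_of_ne_of_ne h1 h3]
        split_ifs with h4 h5
        · rfl
        · rw [Equiv.Perm.mul_apply, Equiv.swap_apply_of_ne_of_ne] <;> simp <;> omega
        · rfl
  rw [hZM]
  have hmem : ∀ s : ℕ, s + 1 < m + 1 → ∀ v,
      v ∈ Finset.Ico 2 (m + 3) ↔ Equiv.swap (s + 2) (s + 3) v ∈ Finset.Ico 2 (m + 3) := by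
    intro s hs v
    by_cases h1 : v = s + 2
    · subst h1; rw [Equiv.swap_apply_left]; simp; omega
    · by_cases h3 : v = s + 3
      · subst h3; rw [Equiv.swap_apply_right]; simp; omega
      · rw [Equiv.swap_apply_of_ne_of_ne h1 h3]
  refine LPol.cancel Z (m + 1) (Finset.Ico 2 (m + 3)) (by simp) (fun _ => Qi ^ m) (fun _ => Q ^ m)
    (fun _ => by rw [← mul_pow, mul_comm, hβ.inv, one_pow]) hmem (fun _ _ _ _ => rfl) ?_ ?_ _ hM
  · have h0 : ∀ κ' r, Θ (κ' 0) = 0 → Z (AddMonoidAlgebra.single κ' r) = 0 := by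
      intro κ' r h
      rw [hZ, LinearMap.sum_apply]
      refine Finset.sum_eq_zero fun r _ => ?_
      rw [LinearMap.smul_apply, wordMap_single, word_append, word_cons]
      simp [hf, h]
    exact hΘ.imp (fun ⟨b, hb⟩ => ⟨b, fun κ r h => h0 κ r (hb _ h)⟩)
      (fun ⟨b, hb⟩ => ⟨b, fun κ r h => h0 κ r (hb _ h)⟩)
  · intro P hP
    have hsys : SwapSystem (X 0) (C (Q ^ 2)) (fun s => X (s + 2))
        (fun s => perm (Equiv.swap (s + 2) (s + 3)))
        (wordMap (R := R) f (0 :: List.range' 2 (m + 1))).toAddMonoidHom.ker (m + 1) := by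
      have := swapSystem_wordMap (R := R) h2 f (a := 0) (n := m + 1) (x := x) (by simp [hf]) hx [0] []
        (by simp) (by simp)
      simpa using this
    have key := hsys.serre_partial (p := C (Qi ^ m)) (p'' := C (Qi ^ (m + 2)))
      (by rw [← map_mul]; congr 1
          rw [pow_add, mul_comm (Qi ^ m), ← mul_assoc, ← mul_pow, hβ.inv, one_pow, one_mul])
      (m + 1) (fun s _ => perm_C _ _) (fun r => C (β r)) (fun r => C (S r))
      (fun _ _ _ => perm_C _ _) (by rw [hS0])
      (fun r hr => by rw [hS1 r hr, map_sub, map_mul])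
      (fun r hr => by rw [← map_mul, hS2 r hr, map_sub, map_mul, map_mul, map_pow C (Q ^ 2)])
      P hP (m + 1) le_rfl
    rw [hS3, map_zero, mul_zero, zero_mul, zero_mul, sub_zero, AddMonoidHom.mem_ker] at key
    rw [← key]
    rw [hZ, LinearMap.sum_apply, Finset.sum_mul, map_sum]
    refine Finset.sum_congr rfl fun r hr => ?_
    have hr' := Finset.mem_range.1 hr
    have e1 := wordMap_move (R := R) f (fun _ => Qi ^ m) (w := 0) (l₁ := List.range' 2 r)
      (l₂ := List.range' (2 + r) (m + 1 - r))
      (fun v hv => by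
        have : v ≠ 0 := by simp at hv; omega
        simpa [hf, this] using hΘx) (by simp) (by simp)
      (by rw [List.range'_append_1]; exact List.nodup_range')
      ((∏ s ∈ Finset.Ico r (m + 1), (C (Qi ^ m) * X 0 - X (s + 2))) * P)
    rw [List.range'_append_1, show r + (m + 1 - r) = m + 1 by omega, prod_range'_map,
      prod_range'_map] at e1
    have e2 : ∏ v ∈ Finset.Ico 2 (m + 3), (C (Qi ^ m) * X 0 - X v : LPol R) =
        (∏ s ∈ Finset.range r, (C (Qi ^ m) * X 0 - X (s + 2))) *
          ∏ s ∈ Finset.Ico r (m + 1), (C (Qi ^ m) * X 0 - X (s + 2)) := by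
      rw [Finset.prod_range_mul_prod_Ico _ (by omega), Finset.prod_Ico_eq_prod_range]
      simp [add_comm]
    rw [e2, LinearMap.smul_apply, mul_assoc, e1, ← map_smul, Algebra.smul_def]
    show wordMap f _ _ = wordMap f _ _
    congr 1
    rw [map_mul, map_pow, map_neg, map_one]
    ring

end SerreTarget
end QAff

namespace QAff

section SerreSource

variable {R E : Type*} [CommRing R] [Ring E] [Algebra R E]
open LPol

/-- The letter at position `s` of a word when the letter `0` is inserted at position `t` into
`2, 3, …`. -/
def insertedLetter (t s : ℕ) : ℕ := if s < t then s + 2 else if s = t then 0 else s + 1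

lemma map_insertedLetter_of_le {t a n : ℕ} (h : a + n ≤ t) :
    (List.range' a n).map (insertedLetter t) = List.range' (a + 2) n := by
  rw [← finRange_map_add n a, ← finRange_map_add n (a + 2), List.map_map]
  refine List.map_congr_left fun s _ => ?_
  have := s.2
  simp only [Function.comp_apply, insertedLetter]
  rw [if_pos (by omega)]; omega

lemma map_insertedLetter_of_lt {t a n : ℕ} (h : t < a) :
    (List.range' a n).map (insertedLetter t) = List.range' (a + 1) n := by
  rw [← finRange_map_add n a, ← finRange_map_add n (a + 1), List.map_map]
  refine List.map_congr_left fun s _ => ?_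
  simp only [Function.comp_apply, insertedLetter]
  rw [if_neg (by omega), if_neg (by omega)]; omega

lemma map_insertedLetter_of_mem {t a n : ℕ} (h1 : a ≤ t) (h2 : t < a + n) :
    (List.range' a n).map (insertedLetter t) =
      List.range' (a + 2) (t - a) ++ 0 :: List.range' (t + 2) (a + n - t - 1) := by
  conv_lhs => rw [show n = (t - a) + (a + n - t - 1 + 1) by omega, ← List.range'_append_1,
    List.range'_succ, List.map_append, List.map_cons]
  rw [map_insertedLetter_of_le (by omega), map_insertedLetter_of_lt (by omega)]
  simp [insertedLetter, show a + (t - a) = t by omega]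

/-- The Serre relation is preserved when one of the repeated letters is replaced. -/
theorem serreSum_replace_outer (h2 : ∀ x : E, x + x = 0 → x = 0) {Q Qi : R} {m : ℕ} {β : ℕ → R}
    (hβ : SerreCoeffs Q Qi m β) {x y Θ : ℤ → E} (hx : QuadRel (Q ^ 2) x x)
    (hxy : QuadRel (Qi ^ m) x y)
    (hΘx : QuadRel (Q ^ 2) Θ x) (hΘy : QuadRel (Qi ^ m) Θ y)
    (hΘ : OneSided Θ) (k : Fin (m + 1) → ℤ) (l : ℤ) :
    ∑ σ : Equiv.Perm (Fin (m + 1)), ∑ r ∈ Finset.range (m + 1 + 1), ((-1) ^ r * β r) •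
      ∑ t : Fin (m + 1),
      ((((List.finRange (m + 1)).take r).map fun s =>
          if s = t then Θ (k (σ s)) else x (k (σ s))).prod * y l *
        (((List.finRange (m + 1)).drop r).map fun s =>
          if s = t then Θ (k (σ s)) else x (k (σ s))).prod) = 0 := by
  obtain ⟨B, hB1, hB2, hB3⟩ := hβ.products
  set f : ℕ → ℤ → E := fun v => if v = 0 then Θ else if v = 1 then y else x with hf
  set κ : Equiv.Perm (Fin (m + 1)) → ℕ → ℤ := fun σ v =>
    if v = 0 then k (σ 0) else if v = 1 then l else
      if h : v - 1 < m + 1 then k (σ ⟨v - 1, h⟩) else 0 with hκ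
  set Z : LPol R →ₗ[R] E := ∑ r ∈ Finset.range (m + 1 + 1), ((-1) ^ r * β r) •
    ∑ t : Fin (m + 1), wordMap f ((List.range' 0 r).map (insertedLetter t) ++
      1 :: (List.range' r (m + 1 - r)).map (insertedLetter t)) with hZ
  have hZM : ∑ σ : Equiv.Perm (Fin (m + 1)), ∑ r ∈ Finset.range (m + 1 + 1), ((-1) ^ r * β r) •
      ∑ t : Fin (m + 1),
      ((((List.finRange (m + 1)).take r).map fun s =>
          if s = t then Θ (k (σ s)) else x (k (σ s))).prod * y l *
        (((List.finRange (m + 1)).drop r).map fun s =>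
          if s = t then Θ (k (σ s)) else x (k (σ s))).prod) =
      Z (∑ σ, AddMonoidAlgebra.single (κ σ) 1) := by
    rw [Finset.sum_comm, hZ, LinearMap.sum_apply]
    refine Finset.sum_congr rfl fun r hr => ?_
    have hr' := Finset.mem_range.1 hr
    rw [← Finset.smul_sum, Finset.sum_comm, LinearMap.smul_apply, LinearMap.sum_apply]
    congr 1
    refine Finset.sum_congr rfl fun t _ => ?_
    rw [map_sum]
    refine Fintype.sum_equiv (Equiv.mulRight (Fin.cycleRange t).symm) _ _ fun σ => ?_
    rw [wordMap_single, one_smul, word_append, word_cons, word, word, List.map_map, List.map_map,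
      ← mul_assoc]
    have hg : ∀ s : Fin (m + 1), ((fun v => f v (κ (Equiv.mulRight (Fin.cycleRange t).symm σ) v)) ∘
        insertedLetter t) (s + 0) = if s = t then Θ (k (σ s)) else x (k (σ s)) := by
      intro s
      rcases eq_or_ne s t with rfl | hst
      · simp [hf, hκ, insertedLetter]
      · obtain ⟨u, rfl⟩ := Fin.exists_succAbove_eq hst
        rw [if_neg hst]
        have hu : ((fun v => insertedLetter t v) ((t.succAbove u : Fin (m + 1)) : ℕ)) = u + 2 := by
          simp only [insertedLetter]
          rcases lt_or_ge u.castSucc t with h | h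
          · rw [Fin.succAbove_of_castSucc_lt _ _ h]
            have : (u : ℕ) < t := h
            simp [this]
          · rw [Fin.succAbove_of_le_castSucc _ _ h]
            have : (t : ℕ) ≤ u := h
            rw [Fin.val_succ, if_neg (by omega), if_neg (by omega)]
        have hu' : (Fin.cycleRange t).symm u.succ = t.succAbove u := by
          rw [Equiv.symm_apply_eq, Fin.cycleRange_succAbove]
        have h3 : (⟨(u : ℕ) + 1, by omega⟩ : Fin (m + 1)) = u.succ := rfl
        simp only [add_zero, Function.comp_apply] at hu ⊢
        rw [hu]
        simp [hf, hκ, h3, hu']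
    rw [map_take_finRange (a := 0) _ _ (by omega) hg, map_drop_finRange (a := 0) _ _ hg, zero_add]
    rfl
  have hM : ∑ σ, AddMonoidAlgebra.single (κ σ) 1 ∈ symm R m := by
    refine sum_single_mem_symm κ fun s hs =>
      ⟨Equiv.swap ⟨s + 1, by omega⟩ ⟨s + 2, by omega⟩, fun σ => ?_⟩
    funext v
    simp only [hκ, Function.comp_apply]
    by_cases h1 : v = s + 2
    · subst h1; rw [Equiv.swap_apply_left]
      simp [show s < m by omega, show s + 2 ≤ m by omega]
    · by_cases h3 : v = s + 3
      · subst h3; rw [Equiv.swap_apply_right]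
        simp [show s < m by omega, show s + 2 ≤ m by omega]
      · rw [Equiv.swap_apply_of_ne_of_ne h1 h3]
        split_ifs with h4 h5 h6
        · rw [Equiv.Perm.mul_apply, Equiv.swap_apply_of_ne_of_ne] <;> simp [Fin.ext_iff]
        · rfl
        · rw [Equiv.Perm.mul_apply, Equiv.swap_apply_of_ne_of_ne] <;> simp <;> omega
        · rfl
  rw [hZM]
  have hmem : ∀ s : ℕ, s + 1 < m → ∀ v,
      v ∈ Finset.Ico 1 (m + 2) ↔ Equiv.swap (s + 2) (s + 3) v ∈ Finset.Ico 1 (m + 2) := by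
    intro s hs v
    by_cases h1 : v = s + 2
    · subst h1; rw [Equiv.swap_apply_left]; simp; omega
    · by_cases h3 : v = s + 3
      · subst h3; rw [Equiv.swap_apply_right]; simp; omega
      · rw [Equiv.swap_apply_of_ne_of_ne h1 h3]
  refine LPol.cancel Z m (Finset.Ico 1 (m + 2)) (by simp)
    (fun v => if v = 1 then Qi ^ m else Q ^ 2) (fun v => if v = 1 then Q ^ m else Qi ^ 2)
    (fun v => by
      split_ifs
      · rw [← mul_pow, mul_comm, hβ.inv, one_pow]
      · rw [← mul_pow, hβ.inv, one_pow]) hmem ?_ ?_ ?_ _ hM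
  · intro s hs v hv
    by_cases h1 : v = s + 2
    · subst h1; rw [Equiv.swap_apply_left]; simp
    · by_cases h3 : v = s + 3
      · subst h3; rw [Equiv.swap_apply_right]; simp
      · rw [Equiv.swap_apply_of_ne_of_ne h1 h3]
  · have h0 : ∀ κ' r, Θ (κ' 0) = 0 → Z (AddMonoidAlgebra.single κ' r) = 0 := by
      intro κ' r h
      rw [hZ, LinearMap.sum_apply]
      refine Finset.sum_eq_zero fun r hr => ?_
      have hr' := Finset.mem_range.1 hr
      rw [LinearMap.smul_apply, LinearMap.sum_apply]
      rw [Finset.sum_eq_zero, smul_zero]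
      intro t _
      have ht := t.2
      rw [wordMap_single, word_append, word_cons]
      rcases lt_or_ge (t : ℕ) r with htr | htr
      · rw [map_insertedLetter_of_mem (by omega) (by omega), word_append, word_cons]
        simp [hf, h]
      · rw [map_insertedLetter_of_mem (a := r) htr (by omega), word_append, word_cons]
        simp [hf, h]
    exact hΘ.imp (fun ⟨b, hb⟩ => ⟨b, fun κ r h => h0 κ r (hb _ h)⟩)
      (fun ⟨b, hb⟩ => ⟨b, fun κ r h => h0 κ r (hb _ h)⟩)
  · intro P hP
    set U : ℕ → LPol R →ₗ[R] E := fun r =>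
      wordMap f (0 :: (List.range' 2 r ++ 1 :: List.range' (r + 2) (m - r))) with hU
    have hsys : InsertSystem (X 0) (X 1) (C (Q ^ 2)) (C (Qi ^ m)) (fun s => X (s + 2))
        (fun s => perm (Equiv.swap (s + 2) (s + 3))) (fun r => (U r).toAddMonoidHom) m :=
      { left := by
          intro r hr
          have := swapSystem_wordMap (R := R) h2 f (a := 0) (n := r) (x := x) (by simp [hf]) hx [0]
            (1 :: List.range' (r + 2) (m - r)) (by simp)
            (by intro s hs; simp; omega)
          simpa using this
        right := by
          intro r hr
          have := swapSystem_wordMap (R := R) h2 f (a := r) (n := m - r) (x := x)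
            (by simp [hf]) hx (0 :: (List.range' 2 r ++ [1])) []
            (by intro s hs; simp; omega) (by simp)
          simpa [hU] using this
        map_other := fun s _ t _ h1 h2 => X_swap_other (by omega) (by omega)
        map_w := fun s _ => X_swap_other (by omega) (by omega)
        map_y := fun s _ => X_swap_other (by omega) (by omega)
        map_c := fun s _ => perm_C _ _
        map_p := fun s _ => perm_C _ _
        exchange := by
          intro r hr P
          have := wordMap_exchange f (p := Qi ^ m) (u := r + 2) (v := 1)
            (l₁ := 0 :: List.range' 2 r) (l₂ := List.range' (r + 3) (m - r - 1))
            (by omega) (by simp; omega) (by simp) (by simp) (by simp) (by simpa [hf] using hxy) P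
          have e1 : 0 :: (List.range' 2 (r + 1) ++ 1 :: List.range' (r + 1 + 2) (m - (r + 1))) =
              0 :: List.range' 2 r ++ (r + 2) :: 1 :: List.range' (r + 3) (m - r - 1) := by
            rw [← List.range'_append_1]
            simp [add_comm, Nat.sub_add_eq]
          have e2 : 0 :: (List.range' 2 r ++ 1 :: List.range' (r + 2) (m - r)) =
              0 :: List.range' 2 r ++ 1 :: (r + 2) :: List.range' (r + 3) (m - r - 1) := by
            conv_lhs => rw [show m - r = m - r - 1 + 1 by omega, List.range'_succ]
            simp
          simp only [hU]
          rw [e1, e2]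
          exact this }
    have key := hsys.alternating_sum (Q := C Q) (Qi := C Qi) (by rw [← map_mul, hβ.inv, map_one])
      (map_pow _ _ _) (map_pow _ _ _) (fun r => C (β r)) (fun r => C (B r))
      (fun _ _ _ => perm_C _ _)
      (fun r hr => by
        have := congrArg (C (R := R)) (hB1 r hr)
        simpa only [map_mul, map_sum, map_pow] using this)
      (fun r hr => by
        have := congrArg (C (R := R)) (hB2 r hr)
        simpa only [map_mul, map_sum, map_pow] using this)
      (fun r hr => by
        have := congrArg (C (R := R)) (hB3 r hr)
        simpa only [map_mul, map_sum, map_pow, map_sub] using this) P hP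
    rw [← key]
    have hfac : ∏ v ∈ Finset.Ico 1 (m + 2), (C (if v = 1 then Qi ^ m else Q ^ 2) * X 0 - X v : LPol R) =
        (C (Qi ^ m) * X 0 - X 1) * ∏ s ∈ Finset.range m, (C (Q ^ 2) * X 0 - X (s + 2)) := by
      rw [Finset.prod_eq_prod_Ico_succ_bot (by omega), Finset.prod_Ico_eq_prod_range]
      simp [add_comm]
    have hQx : ∀ v, 2 ≤ v → QuadRel (if v = 1 then Qi ^ m else Q ^ 2) (f 0) (f v) := by
      intro v hv
      rw [if_neg (by omega)]
      simpa [hf, show v ≠ 0 by omega, show v ≠ 1 by omega] using hΘx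
    have hbefore : ∀ r t, t ≤ r → r ≤ m →
        wordMap f ((List.range' 0 (r + 1)).map (insertedLetter t) ++
          1 :: (List.range' (r + 1) (m + 1 - (r + 1))).map (insertedLetter t))
          ((C (Qi ^ m) * X 0 - X 1) * (∏ s ∈ Finset.range m, (C (Q ^ 2) * X 0 - X (s + 2))) * P) =
        U r ((C (Qi ^ m) * X 0 - X 1) * ((∏ s ∈ Finset.range t, (X 0 - C (Q ^ 2) * X (s + 2))) *
          ∏ s ∈ Finset.Ico t m, (C (Q ^ 2) * X 0 - X (s + 2))) * P) := by
      intro r t ht hr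
      rw [map_insertedLetter_of_mem (by omega) (by omega), map_insertedLetter_of_lt (by omega)]
      have e1 := wordMap_move (R := R) f (fun _ => Q ^ 2) (w := 0) (l₁ := List.range' 2 t)
        (l₂ := List.range' (t + 2) (r - t) ++ 1 :: List.range' (r + 2) (m - r))
        (fun v hv => by
          have : 2 ≤ v := by simp at hv; omega
          simpa [show v ≠ 1 by omega] using hQx v this) (by simp) (by simp)
        (by
          rw [← List.append_assoc, show t + 2 = 2 + t by ring, List.range'_append_1,
            List.nodup_append]
          refine ⟨List.nodup_range', ?_, ?_⟩
          · simp [List.nodup_range']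
          · intro a ha b hb
            simp at ha hb; omega)
        ((C (Qi ^ m) * X 0 - X 1) * (∏ s ∈ Finset.Ico t m, (C (Q ^ 2) * X 0 - X (s + 2))) * P)
      rw [← List.append_assoc, show t + 2 = 2 + t by ring, List.range'_append_1,
        show t + (r - t) = r by omega, prod_range'_map, prod_range'_map] at e1
      rw [← Finset.prod_range_mul_prod_Ico _ (show t ≤ m by omega)]
      have e3 : List.range' (0 + 2) (t - 0) ++ 0 :: List.range' (t + 2) (0 + (r + 1) - t - 1) ++
          1 :: List.range' (r + 1 + 1) (m + 1 - (r + 1)) =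
          List.range' 2 t ++ 0 :: (List.range' (2 + t) (r - t) ++ 1 :: List.range' (r + 2) (m - r)) := by
        rw [show 0 + (r + 1) - t - 1 = r - t by omega, show m + 1 - (r + 1) = m - r by omega,
          show t + 2 = 2 + t by ring]
        simp
      rw [e3]
      simp only [hU]
      refine Eq.trans ?_ (e1.trans ?_) <;> congr 1 <;> ring
    have hafter : ∀ r t, r ≤ t → t ≤ m →
        wordMap f ((List.range' 0 r).map (insertedLetter t) ++
          1 :: (List.range' r (m + 1 - r)).map (insertedLetter t))
          ((C (Qi ^ m) * X 0 - X 1) * (∏ s ∈ Finset.range m, (C (Q ^ 2) * X 0 - X (s + 2))) * P) =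
        U r ((X 0 - C (Qi ^ m) * X 1) * ((∏ s ∈ Finset.range t, (X 0 - C (Q ^ 2) * X (s + 2))) *
          ∏ s ∈ Finset.Ico t m, (C (Q ^ 2) * X 0 - X (s + 2))) * P) := by
      intro r t hr ht
      rw [map_insertedLetter_of_le (by omega), map_insertedLetter_of_mem (by omega) (by omega)]
      have e1 := wordMap_move (R := R) f (fun v => if v = 1 then Qi ^ m else Q ^ 2) (w := 0)
        (l₁ := List.range' 2 r ++ 1 :: List.range' (r + 2) (t - r))
        (l₂ := List.range' (t + 2) (m - t))
        (fun v hv => by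
          rcases eq_or_ne v 1 with rfl | h1
          · simpa [hf] using hΘy
          · exact hQx v (by simp at hv; omega)) (by simp) (by simp)
        (by
          rw [List.append_assoc, List.cons_append, show t + 2 = (r + 2) + (t - r) by omega,
            List.range'_append_1, List.nodup_append]
          refine ⟨List.nodup_range', ?_, ?_⟩
          · simp [List.nodup_range']
          · intro a ha b hb
            simp at ha hb; omega)
        ((∏ s ∈ Finset.Ico t m, (C (Q ^ 2) * X 0 - X (s + 2))) * P)
      have hlist : ∀ g : ℕ → LPol R,
          ((List.range' 2 r ++ 1 :: List.range' (r + 2) (t - r)).map g).prod =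
          g 1 * ∏ s ∈ Finset.range t, g (s + 2) := by
        intro g
        rw [List.map_append, List.prod_append, List.map_cons, List.prod_cons, mul_left_comm,
          ← List.prod_append, ← List.map_append, show r + 2 = 2 + r by ring, List.range'_append_1,
          show r + (t - r) = t by omega, prod_range'_map]
      rw [hlist, hlist] at e1
      have hlist' : List.range' 2 r ++ 1 :: List.range' (r + 2) (t - r) ++
          List.range' (t + 2) (m - t) = List.range' 2 r ++ 1 :: List.range' (r + 2) (m - r) := by
        rw [List.append_assoc, List.cons_append, show t + 2 = (r + 2) + (t - r) by omega,
            List.range'_append_1, show t - r + (m - t) = m - r by omega]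
      rw [hlist'] at e1
      rw [← Finset.prod_range_mul_prod_Ico _ (show t ≤ m by omega)]
      have e3 : List.range' (0 + 2) r ++
          1 :: (List.range' (r + 2) (t - r) ++ 0 :: List.range' (t + 2) (r + (m + 1 - r) - t - 1)) =
          List.range' 2 r ++ 1 :: List.range' (r + 2) (t - r) ++ 0 :: List.range' (t + 2) (m - t) := by
        rw [show r + (m + 1 - r) - t - 1 = m - t by omega]
        simp
      rw [e3]
      simp only [hU]
      simp only [show ∀ s : ℕ, ¬ (s + 2 = 1) by omega, if_true, if_false] at e1
      refine Eq.trans ?_ (e1.trans ?_) <;> congr 1 <;> ring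
    rw [hfac]
    set Y := (C (Qi ^ m) * X 0 - X 1) * (∏ s ∈ Finset.range m, (C (Q ^ 2) * X 0 - X (s + 2))) * P with hY
    set T : ℕ → LPol R := fun t => (∏ s ∈ Finset.range t, (X 0 - C (Q ^ 2) * X (s + 2))) *
          ∏ s ∈ Finset.Ico t m, (C (Q ^ 2) * X 0 - X (s + 2)) with hT
    set W : ℕ → ℕ → E := fun r t => wordMap f ((List.range' 0 r).map (insertedLetter t) ++
          1 :: (List.range' r (m + 1 - r)).map (insertedLetter t)) Y with hW
    have e1 : Z Y = ∑ r ∈ Finset.range (m + 1 + 1), ((-1) ^ r * β r) •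
        ((∑ t ∈ Finset.range r, W r t) + ∑ t ∈ Finset.Ico r (m + 1), W r t) := by
      rw [hZ, LinearMap.sum_apply]
      refine Finset.sum_congr rfl fun r hr => ?_
      have hr' := Finset.mem_range.1 hr
      rw [LinearMap.smul_apply, LinearMap.sum_apply,
        Finset.sum_range_add_sum_Ico _ (show r ≤ m + 1 by omega), Finset.sum_range]
    rw [e1]
    simp only [smul_add]
    rw [Finset.sum_add_distrib, Finset.sum_range_succ', Finset.sum_range_succ _ (m + 1)]
    simp only [Finset.range_zero, Finset.sum_empty, Finset.Ico_self, smul_zero, add_zero]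
    rw [← Finset.sum_add_distrib]
    refine Finset.sum_congr rfl fun r hr => ?_
    have hr' := Finset.mem_range.1 hr
    have e2 : ∑ t ∈ Finset.range (r + 1), W (r + 1) t =
        U r ((C (Qi ^ m) * X 0 - X 1) * (∑ t ∈ Finset.range (r + 1), T t) * P) := by
      rw [Finset.mul_sum, Finset.sum_mul, map_sum]
      exact Finset.sum_congr rfl fun t ht =>
        hbefore r t (by have := Finset.mem_range.1 ht; omega) (by omega)
    have e3 : ∑ t ∈ Finset.Ico r (m + 1), W r t =
        U r ((X 0 - C (Qi ^ m) * X 1) * (∑ t ∈ Finset.Ico r (m + 1), T t) * P) := by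
      rw [Finset.mul_sum, Finset.sum_mul, map_sum]
      exact Finset.sum_congr rfl fun t ht =>
        hafter r t (by have := Finset.mem_Ico.1 ht; omega) (by have := Finset.mem_Ico.1 ht; omega)
    rw [e2, e3, ← map_smul, ← map_smul, ← map_add, Algebra.smul_def, Algebra.smul_def]
    show U r _ = U r _
    congr 1
    simp only [map_mul, map_pow, map_neg, map_one]
    ring

end SerreSource
end QAff

namespace QAff

section Dual

variable {R E F : Type*} [CommRing R] [Ring E] [Algebra R E] [Ring F] [Algebra R F]
open TrivSqZeroExt

lemma QuadRel.symm {p : R} {f g : ℤ → E} (h : QuadRel p f g) : QuadRel p g f := by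
  intro k l
  have := h l k
  linear_combination (norm := abel) this

lemma QuadRel.zero_left (p : R) (g : ℤ → E) : QuadRel p 0 g := by
  intro k l; simp

lemma QuadRel.add_left {p : R} {f f' g : ℤ → E} (h : QuadRel p f g) (h' : QuadRel p f' g) :
    QuadRel p (f + f') g := by
  intro k l
  have h1 := h k l
  have h2 := h' k l
  simp only [Pi.add_apply, add_mul, mul_add, smul_add]
  linear_combination (norm := abel) h1 + h2

lemma QuadRel.map {p : R} {f g : ℤ → E} (h : QuadRel p f g) (φ : E →ₐ[R] F) :
    QuadRel p (fun k => φ (f k)) (fun k => φ (g k)) := by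
  intro k l
  have := congrArg φ (h k l)
  simpa using this

lemma OneSided.zero : OneSided (0 : ℤ → E) := Or.inl ⟨0, fun _ _ => rfl⟩

/-- A sum of two one-sided families satisfying exchange relations with `x` and `y`. -/
def OneSidedSum (c : R) (x : ℤ → E) (p : R) (y Θ : ℤ → E) : Prop :=
  ∃ Θ₁ Θ₂ : ℤ → E, Θ = Θ₁ + Θ₂ ∧ OneSided Θ₁ ∧ OneSided Θ₂ ∧ QuadRel c Θ₁ x ∧ QuadRel c Θ₂ x ∧
    QuadRel p Θ₁ y ∧ QuadRel p Θ₂ y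

lemma OneSidedSum.zero (c : R) (x : ℤ → E) (p : R) (y : ℤ → E) : OneSidedSum c x p y 0 :=
  ⟨0, 0, by simp, .zero, .zero, .zero_left _ _, .zero_left _ _, .zero_left _ _, .zero_left _ _⟩

lemma QuadRel.dual {p : R} {x y : ℤ → DualNumber E}
    (h : QuadRel p (fun k => (x k).fst) (fun k => (y k).fst))
    (h1 : QuadRel p (fun k => (x k).snd) (fun k => (y k).fst))
    (h2 : QuadRel p (fun k => (y k).snd) (fun k => (x k).fst)) : QuadRel p x y := by
  intro k l
  have e0 := h k l
  have e1 := h1 k l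
  have e2 := h2.symm k l
  ext
  · simpa using e0
  · simp only [snd_sub, DualNumber.snd_mul, snd_smul, smul_add]
    linear_combination (norm := abel) e1 + e2

lemma snd_list_prod_map {ι : Type*} [DecidableEq ι] (L : List ι) (hL : L.Nodup)
    (g : ι → DualNumber E) :
    (L.map g).prod.snd = ∑ t ∈ L.toFinset,
      (L.map fun s => if s = t then (g s).snd else (g s).fst).prod := by
  induction L with
  | nil => simp
  | cons a L ih =>
    rw [List.nodup_cons] at hL
    have hfst : (L.map g).prod.fst = (L.map fun s => (g s).fst).prod := by
      have := map_list_prod (fstHom ℤ E E) (L.map g)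
      simpa [List.map_map, Function.comp_def] using this
    rw [List.map_cons, List.prod_cons, DualNumber.snd_mul, ih hL.2, List.toFinset_cons,
      Finset.sum_insert (by simpa using hL.1), hfst, add_comm]
    congr 1
    · rw [List.map_cons, List.prod_cons, if_pos rfl]
      congr 2
      refine List.map_congr_left fun s hs => ?_
      rw [if_neg]; rintro rfl; exact hL.1 hs
    · rw [Finset.mul_sum]
      refine Finset.sum_congr rfl fun t ht => ?_
      rw [List.map_cons, List.prod_cons, if_neg]
      rintro rfl; exact hL.1 (by simpa using ht)

lemma map_serreSum (β : ℕ → R) (n : ℕ) (x y : ℤ → E) (k : Fin n → ℤ) (l : ℤ) (φ : E →ₐ[R] F) :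
    φ (serreSum β n x y k l) = serreSum β n (fun k => φ (x k)) (fun k => φ (y k)) k l := by
  simp only [serreSum, map_sum, map_smul, map_mul, map_list_prod, List.map_map, Function.comp_def]

lemma serreSum_add_middle (β : ℕ → R) (n : ℕ) (x y y' : ℤ → E) (k : Fin n → ℤ) (l : ℤ) :
    serreSum β n x (y + y') k l = serreSum β n x y k l + serreSum β n x y' k l := by
  simp only [serreSum, Pi.add_apply, mul_add, add_mul, smul_add, Finset.sum_add_distrib]

/-- The first order part of the Serre relation. -/
lemma snd_serreSum (β : ℕ → R) (n : ℕ) (x y : ℤ → DualNumber E) (k : Fin n → ℤ) (l : ℤ) :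
    (serreSum β n x y k l).snd =
      serreSum β n (fun k => (x k).fst) (fun k => (y k).snd) k l +
      ∑ σ : Equiv.Perm (Fin n), ∑ r ∈ Finset.range (n + 1), ((-1) ^ r * β r) •
      ∑ t : Fin n,
      ((((List.finRange n).take r).map fun s =>
          if s = t then (x (k (σ s))).snd else (x (k (σ s))).fst).prod * (y l).fst *
        (((List.finRange n).drop r).map fun s =>
          if s = t then (x (k (σ s))).snd else (x (k (σ s))).fst).prod) := by
  simp only [serreSum]
  rw [snd_sum, ← Finset.sum_add_distrib]
  refine Finset.sum_congr rfl fun σ _ => ?_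
  rw [snd_sum, ← Finset.sum_add_distrib]
  refine Finset.sum_congr rfl fun r _ => ?_
  rw [snd_smul, ← smul_add]
  congr 1
  set L₁ := (List.finRange n).take r with hL₁
  set L₂ := (List.finRange n).drop r with hL₂
  have hnd : (L₁ ++ L₂).Nodup := by
    rw [hL₁, hL₂, List.take_append_drop]; exact List.nodup_finRange n
  have hun : L₁.toFinset ∪ L₂.toFinset = Finset.univ := by
    rw [← List.toFinset_append, hL₁, hL₂, List.take_append_drop]; ext; simp
  rw [List.nodup_append] at hnd
  have hdisj : Disjoint L₁.toFinset L₂.toFinset := by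
    rw [Finset.disjoint_left]
    intro a h1 h2
    exact hnd.2.2 a (by simpa using h1) a (by simpa using h2) rfl
  have hfst : ∀ L : List (Fin n), ((L.map fun t => x (k (σ t))).prod).fst =
      (L.map fun t => (x (k (σ t))).fst).prod := by
    intro L
    have := map_list_prod (fstHom R E E).toRingHom (L.map fun t => x (k (σ t)))
    simpa [List.map_map, Function.comp_def] using this
  have hne : ∀ (L : List (Fin n)) t, t ∉ L →
      (L.map fun s => if s = t then (x (k (σ s))).snd else (x (k (σ s))).fst) =
        L.map fun s => (x (k (σ s))).fst := by
    intro L t ht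
    refine List.map_congr_left fun s hs => ?_
    rw [if_neg]; rintro rfl; exact ht hs
  rw [DualNumber.snd_mul, DualNumber.snd_mul, fst_mul, hfst, hfst,
    snd_list_prod_map L₁ hnd.1, snd_list_prod_map L₂ hnd.2.1, ← hun, Finset.sum_union hdisj]
  have e1 : ∑ t ∈ L₁.toFinset, (L₁.map fun s =>
          if s = t then (x (k (σ s))).snd else (x (k (σ s))).fst).prod * (y l).fst *
        (L₂.map fun s => if s = t then (x (k (σ s))).snd else (x (k (σ s))).fst).prod =
      (∑ t ∈ L₁.toFinset, (L₁.map fun s =>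
          if s = t then (x (k (σ s))).snd else (x (k (σ s))).fst).prod) * (y l).fst *
        (L₂.map fun s => (x (k (σ s))).fst).prod := by
    rw [Finset.sum_mul, Finset.sum_mul]
    refine Finset.sum_congr rfl fun t ht => ?_
    rw [hne L₂ t fun h => hnd.2.2 t (by simpa using ht) t h rfl]
  have e2 : ∑ t ∈ L₂.toFinset, (L₁.map fun s =>
          if s = t then (x (k (σ s))).snd else (x (k (σ s))).fst).prod * (y l).fst *
        (L₂.map fun s => if s = t then (x (k (σ s))).snd else (x (k (σ s))).fst).prod =
      (L₁.map fun s => (x (k (σ s))).fst).prod * (y l).fst * ∑ t ∈ L₂.toFinset,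
        (L₂.map fun s => if s = t then (x (k (σ s))).snd else (x (k (σ s))).fst).prod := by
    rw [Finset.mul_sum]
    refine Finset.sum_congr rfl fun t ht => ?_
    rw [hne L₁ t fun h => hnd.2.2 t h t (by simpa using ht) rfl]
  rw [e1, e2]
  noncomm_ring

lemma prod_map_ite_add {ι : Type*} [DecidableEq ι] (L : List ι) (hL : L.Nodup) (a b c : ι → E)
    {t : ι} (ht : t ∈ L) :
    (L.map fun s => if s = t then a s + b s else c s).prod =
      (L.map fun s => if s = t then a s else c s).prod +
        (L.map fun s => if s = t then b s else c s).prod := by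
  induction L with
  | nil => simp at ht
  | cons u L ih =>
    rw [List.nodup_cons] at hL
    simp only [List.map_cons, List.prod_cons]
    by_cases hu : u = t
    · subst hu
      have : ∀ d : ι → E, (L.map fun s => if s = u then d s else c s) = L.map c := by
        intro d
        refine List.map_congr_left fun s hs => ?_
        rw [if_neg]; rintro rfl; exact hL.1 hs
      rw [this, this, this, if_pos rfl, if_pos rfl, if_pos rfl, add_mul]
    · rw [if_neg hu, if_neg hu, if_neg hu,
        ih hL.2 ((List.mem_cons.1 ht).resolve_left (Ne.symm hu)), mul_add]

/-- The first order part of the Serre relation vanishes for deformations by one-sided families. -/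
theorem snd_serreSum_eq_zero (h2 : ∀ x : E, x + x = 0 → x = 0) {Q Qi : R} {m : ℕ} {β : ℕ → R}
    (hβ : SerreCoeffs Q Qi m β) {x y : ℤ → DualNumber E}
    (hx : QuadRel (Q ^ 2) (fun k => (x k).fst) (fun k => (x k).fst))
    (hxy : QuadRel (Qi ^ m) (fun k => (x k).fst) (fun k => (y k).fst))
    (hΘx : OneSidedSum (Q ^ 2) (fun k => (x k).fst) (Qi ^ m) (fun k => (y k).fst)
      (fun k => (x k).snd))
    {c : R} {z : ℤ → E}
    (hΘy : OneSidedSum (Qi ^ m) (fun k => (x k).fst) c z (fun k => (y k).snd))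
    (k : Fin (m + 1) → ℤ) (l : ℤ) : (serreSum β (m + 1) x y k l).snd = 0 := by
  rw [snd_serreSum]
  obtain ⟨Θ₁, Θ₂, e1, o1, o2, q1, q2, _, _⟩ := hΘy
  rw [e1, serreSum_add_middle, serreSum_replace_middle h2 hβ hx q1 o1,
    serreSum_replace_middle h2 hβ hx q2 o2, add_zero, zero_add]
  obtain ⟨Θ₁, Θ₂, e1, o1, o2, q1, q2, r1, r2⟩ := hΘx
  have hlin : ∀ σ : Equiv.Perm (Fin (m + 1)), ∀ r, ∀ t : Fin (m + 1),
      (((List.finRange (m + 1)).take r).map fun s =>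
        if s = t then (x (k (σ s))).snd else (x (k (σ s))).fst).prod * (y l).fst *
      (((List.finRange (m + 1)).drop r).map fun s =>
        if s = t then (x (k (σ s))).snd else (x (k (σ s))).fst).prod =
      (((List.finRange (m + 1)).take r).map fun s =>
        if s = t then Θ₁ (k (σ s)) else (x (k (σ s))).fst).prod * (y l).fst *
      (((List.finRange (m + 1)).drop r).map fun s =>
        if s = t then Θ₁ (k (σ s)) else (x (k (σ s))).fst).prod +
      (((List.finRange (m + 1)).take r).map fun s =>
        if s = t then Θ₂ (k (σ s)) else (x (k (σ s))).fst).prod * (y l).fst *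
      (((List.finRange (m + 1)).drop r).map fun s =>
        if s = t then Θ₂ (k (σ s)) else (x (k (σ s))).fst).prod := by
    intro σ r t
    have e2 : ∀ k, (x k).snd = Θ₁ k + Θ₂ k := fun k => congrFun e1 k
    simp only [e2]
    set L₁ := (List.finRange (m + 1)).take r with hL₁
    set L₂ := (List.finRange (m + 1)).drop r with hL₂
    have hnd : (L₁ ++ L₂).Nodup := by
      rw [hL₁, hL₂, List.take_append_drop]; exact List.nodup_finRange _
    have hun : t ∈ L₁ ++ L₂ := by
      rw [hL₁, hL₂, List.take_append_drop]; exact List.mem_finRange t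
    rw [List.nodup_append] at hnd
    have hne : ∀ (L : List (Fin (m + 1))), t ∉ L → ∀ a : Fin (m + 1) → E,
        (L.map fun s => if s = t then a s else (x (k (σ s))).fst) =
          L.map fun s => (x (k (σ s))).fst := by
      intro L ht a
      refine List.map_congr_left fun s hs => ?_
      rw [if_neg]; rintro rfl; exact ht hs
    by_cases h1 : t ∈ L₁
    · have h2 : t ∉ L₂ := fun h => hnd.2.2 t h1 t h rfl
      rw [prod_map_ite_add L₁ hnd.1 _ _ _ h1, hne L₂ h2, hne L₂ h2, hne L₂ h2, add_mul, add_mul]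
    · rw [prod_map_ite_add L₂ hnd.2.1 _ _ _ ((List.mem_append.1 hun).resolve_left h1), hne L₁ h1,
        hne L₁ h1, hne L₁ h1, mul_add]
  simp only [hlin, Finset.sum_add_distrib, smul_add]
  have k1 := serreSum_replace_outer h2 hβ hx hxy q1 r1 o1 k l
  have k2 := serreSum_replace_outer h2 hβ hx hxy q2 r2 o2 k l
  rw [k1, k2, add_zero]

/-- The Serre relation is preserved under first order deformations by one-sided families. -/
theorem serreSum_dual (h2 : ∀ x : E, x + x = 0 → x = 0) {Q Qi : R} {m : ℕ} {β : ℕ → R}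
    (hβ : SerreCoeffs Q Qi m β) {x y : ℤ → DualNumber E}
    (hx : QuadRel (Q ^ 2) (fun k => (x k).fst) (fun k => (x k).fst))
    (hxy : QuadRel (Qi ^ m) (fun k => (x k).fst) (fun k => (y k).fst))
    (hΘx : OneSidedSum (Q ^ 2) (fun k => (x k).fst) (Qi ^ m) (fun k => (y k).fst)
      (fun k => (x k).snd))
    {c : R} {z : ℤ → E}
    (hΘy : OneSidedSum (Qi ^ m) (fun k => (x k).fst) c z (fun k => (y k).snd))
    (k : Fin (m + 1) → ℤ) (l : ℤ)
    (h : serreSum β (m + 1) (fun k => (x k).fst) (fun k => (y k).fst) k l = 0) :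
    serreSum β (m + 1) x y k l = 0 := by
  ext
  · have := map_serreSum β (m + 1) x y k l (fstHom R E E)
    simpa [h] using this
  · exact snd_serreSum_eq_zero h2 hβ hx hxy hΘx hΘy k l

end Dual
end QAff

namespace QAff

section Schur

variable {R E : Type*} [CommRing R] [Ring E] [Algebra R E]

/-- `S` is the family of coefficients of `exp (∑ y_l z^l)`, for commuting or ordered `y_l`. -/
def IsSchur (y S : ℕ → E) : Prop :=
  S 0 = 1 ∧ ∀ n, (n + 1) • S (n + 1) =
    ∑ l ∈ Finset.range (n + 1), (l + 1) • (y (l + 1) * S (n - l))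

/-- Multiplication by positive integers is injective. -/
def TorsionFree (E : Type*) [AddMonoid E] : Prop := ∀ (n : ℕ) (x : E), (n + 1) • x = 0 → x = 0

lemma TorsionFree.eq (h : TorsionFree E) {n : ℕ} {x y : E} (hxy : (n + 1) • x = (n + 1) • y) :
    x = y := by
  rw [← sub_eq_zero]; apply h n; rw [smul_sub, hxy, sub_self]

lemma IsSchur.graded (htf : TorsionFree E) {y S : ℕ → E} (hS : IsSchur y S) (a : E) (u : R)
    (h : ∀ l, a * y (l + 1) = u ^ (l + 1) • (y (l + 1) * a)) (n : ℕ) :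
    a * S n = u ^ n • (S n * a) := by
  induction n using Nat.strong_induction_on with
  | _ n ih =>
  rcases n with _ | n
  · simp [hS.1]
  · apply htf.eq (n := n)
    rw [← mul_smul_comm, hS.2, smul_comm, ← smul_mul_assoc, hS.2, Finset.mul_sum, Finset.sum_mul,
      Finset.smul_sum]
    refine Finset.sum_congr rfl fun l hl => ?_
    have hl' := Finset.mem_range.1 hl
    rw [mul_smul_comm, ← mul_assoc, h, smul_mul_assoc, mul_assoc, ih (n - l) (by omega),
      mul_smul_comm, smul_smul, ← pow_add, show l + 1 + (n - l) = n + 1 by omega, smul_mul_assoc,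
      smul_comm, mul_assoc]

lemma IsSchur.commutator (htf : TorsionFree E) {y S : ℕ → E} (hS : IsSchur y S) (a : E) (ζ : R)
    (k : ℕ)
    (h : ∀ l, a * y (l + 1) - y (l + 1) * a = if l = k then ζ • 1 else 0) (n : ℕ) :
    a * S n - S n * a = if k + 1 ≤ n then ζ • S (n - (k + 1)) else 0 := by
  induction n using Nat.strong_induction_on with
  | _ n ih =>
  rcases n with _ | n
  · simp [hS.1]
  · apply htf.eq (n := n)
    have e1 : (n + 1) • (a * S (n + 1) - S (n + 1) * a) =
        ∑ l ∈ Finset.range (n + 1), ((l + 1) • ((a * y (l + 1) - y (l + 1) * a) * S (n - l)) +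
          (l + 1) • (y (l + 1) * (a * S (n - l) - S (n - l) * a))) := by
      rw [smul_sub, ← mul_smul_comm, ← smul_mul_assoc, hS.2, Finset.mul_sum, Finset.sum_mul,
        ← Finset.sum_sub_distrib]
      refine Finset.sum_congr rfl fun l _ => ?_
      rw [← smul_add, mul_smul_comm, smul_mul_assoc, ← smul_sub]
      congr 1
      noncomm_ring
    rw [e1, Finset.sum_add_distrib]
    have e2 : ∑ l ∈ Finset.range (n + 1), (l + 1) • (y (l + 1) * (a * S (n - l) - S (n - l) * a)) =
        if k + 1 ≤ n then (n - k) • ζ • S (n - k) else 0 := by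
      split_ifs with hk
      · obtain ⟨d, rfl⟩ := Nat.exists_eq_add_of_le hk
        have := hS.2 d
        rw [show k + 1 + d - k = d + 1 by omega, smul_comm, this, Finset.smul_sum,
          show k + 1 + d + 1 = (d + 1) + (k + 1) by ring, Finset.sum_range_add,
          Finset.sum_eq_zero (s := Finset.range (k + 1)), add_zero]
        · refine Finset.sum_congr rfl fun l hl => ?_
          have hl' := Finset.mem_range.1 hl
          rw [ih _ (by omega), if_pos (by omega), mul_smul_comm, smul_comm,
            show k + 1 + d - l - (k + 1) = d - l by omega]
        · intro l hl
          rw [ih _ (by omega), if_neg (by omega), mul_zero, smul_zero]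
      · refine Finset.sum_eq_zero fun l hl => ?_
        rw [ih _ (by omega), if_neg (by omega), mul_zero, smul_zero]
    have e3 : ∑ l ∈ Finset.range (n + 1), (l + 1) • ((a * y (l + 1) - y (l + 1) * a) * S (n - l)) =
        if k ≤ n then (k + 1) • ζ • S (n - k) else 0 := by
      simp only [h, ite_mul, zero_mul, smul_ite, smul_zero, smul_mul_assoc, one_mul,
        Finset.sum_ite_eq', Finset.mem_range, Nat.lt_succ_iff]
    rw [e2, e3]
    by_cases h1 : k + 1 ≤ n
    · rw [if_pos h1, if_pos (by omega), if_pos (by omega), ← add_smul,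
        show k + 1 + (n - k) = n + 1 by omega, show n + 1 - (k + 1) = n - k by omega]
    · by_cases h2 : k ≤ n
      · obtain rfl : k = n := by omega
        simp
      · rw [if_neg h1, if_neg h2, if_neg (by omega)]; simp

/-- The Taylor coefficients of `(1 - P t) / (1 - P⁻¹ t)`. -/
def expCoeff (P : Rˣ) : ℕ → R
  | 0 => 1
  | r + 1 => ↑P⁻¹ ^ (r + 1) - P * ↑P⁻¹ ^ r

lemma expCoeff_succ (P : Rˣ) (r : ℕ) :
    expCoeff P (r + 1) = ↑P⁻¹ * expCoeff P r - if r = 0 then (P : R) else 0 := by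
  rcases r with _ | r
  · simp [expCoeff]
  · simp only [expCoeff, Nat.succ_ne_zero, if_false]; ring

lemma sum_mul_expCoeff (P : Rˣ) (r : ℕ) :
    ∑ j ∈ Finset.range r, ((P : R) ^ (j + 1) - ↑P⁻¹ ^ (j + 1)) * expCoeff P (r - 1 - j) =
      -(r * expCoeff P r) := by
  induction r with
  | zero => simp
  | succ r ih =>
    have hP : (P : R) * ↑P⁻¹ = 1 := P.mul_inv
    have e1 : ∀ j ∈ Finset.range r,
        ((P : R) ^ (j + 1) - ↑P⁻¹ ^ (j + 1)) * expCoeff P (r + 1 - 1 - j) =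
        ↑P⁻¹ * (((P : R) ^ (j + 1) - ↑P⁻¹ ^ (j + 1)) * expCoeff P (r - 1 - j)) -
          if j = r - 1 then ((P : R) ^ (j + 1) - ↑P⁻¹ ^ (j + 1)) * P else 0 := by
      intro j hj
      have := Finset.mem_range.1 hj
      rw [show r + 1 - 1 - j = r - 1 - j + 1 by omega, expCoeff_succ]
      by_cases h : j = r - 1
      · rw [if_pos (by omega), if_pos h]; ring
      · rw [if_neg (by omega), if_neg h]; ring
    rw [Finset.sum_range_succ, Finset.sum_congr rfl e1, Finset.sum_sub_distrib, ← Finset.mul_sum, ih,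
      Finset.sum_ite_eq']
    rcases r with _ | r
    · simp [expCoeff]
    · rw [if_pos (by simp), show r + 1 - 1 = r by omega, show r + 1 + 1 - 1 - (r + 1) = 0 by omega]
      simp only [expCoeff]
      push_cast
      grind

lemma IsSchur.mul_eq_sum (htf : TorsionFree E) {y S : ℕ → E} (hS : IsSchur y S) (P θ : Rˣ)
    (x : ℤ → E) (h : ∀ (k : ℕ) l, (k + 1) • (y (k + 1) * x l - x l * y (k + 1)) =
      (((P : R) ^ (k + 1) - ↑P⁻¹ ^ (k + 1)) * (θ : R) ^ (k + 1)) • x (l + (k + 1))) (n : ℕ) :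
    ∀ l, x l * S n = ∑ r ∈ Finset.range (n + 1),
      (expCoeff P r * (θ : R) ^ r) • (S (n - r) * x (l + r)) := by
  induction n using Nat.strong_induction_on with
  | _ n ih =>
  rcases n with _ | n
  · simp [hS.1, expCoeff]
  intro l
  apply htf.eq (n := n)
  have e1 : (n + 1) • (x l * S (n + 1)) =
      ∑ j ∈ Finset.range (n + 1), (j + 1) • (y (j + 1) * (x l * S (n - j))) -
      ∑ j ∈ Finset.range (n + 1), (((P : R) ^ (j + 1) - ↑P⁻¹ ^ (j + 1)) * (θ : R) ^ (j + 1)) •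
        (x (l + (j + 1)) * S (n - j)) := by
    rw [← mul_smul_comm, hS.2, Finset.mul_sum, ← Finset.sum_sub_distrib]
    refine Finset.sum_congr rfl fun j _ => ?_
    have e0 := congrArg (fun t => t * S (n - j)) (h j l)
    simp only [smul_mul_assoc] at e0
    rw [← e0, mul_smul_comm, ← smul_sub, sub_mul, mul_assoc, mul_assoc, sub_sub_cancel]
  have e2 : ∑ j ∈ Finset.range (n + 1), (j + 1) • (y (j + 1) * (x l * S (n - j))) =
      ∑ r ∈ Finset.range (n + 2), (expCoeff P r * (θ : R) ^ r) •
        (((n + 1 - r : ℕ) : R) • (S (n + 1 - r) * x (l + r))) := by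
    rw [Finset.sum_range_succ _ (n + 1), show n + 1 - (n + 1) = 0 by omega, Nat.cast_zero, zero_smul,
      smul_zero, add_zero]
    have : ∀ j ∈ Finset.range (n + 1), (j + 1) • (y (j + 1) * (x l * S (n - j))) =
        ∑ r ∈ Finset.range (n - j + 1), (expCoeff P r * (θ : R) ^ r) •
          ((j + 1) • (y (j + 1) * S (n - r - j)) * x (l + r)) := by
      intro j hj
      rw [ih _ (by omega), Finset.mul_sum, Finset.smul_sum]
      refine Finset.sum_congr rfl fun r _ => ?_
      rw [mul_smul_comm, smul_comm, smul_mul_assoc, mul_assoc, show n - j - r = n - r - j by omega]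
    rw [Finset.sum_congr rfl this,
      Finset.sum_comm' (t' := Finset.range (n + 1)) (s' := fun r => Finset.range (n - r + 1))
        (by intro a b; simp only [Finset.mem_range]; omega)]
    refine Finset.sum_congr rfl fun r hr => ?_
    have hr' := Finset.mem_range.1 hr
    rw [← Finset.smul_sum, ← Finset.sum_mul, ← hS.2, show n + 1 - r = n - r + 1 by omega,
      Nat.cast_smul_eq_nsmul, smul_mul_assoc]
  have e3 : ∑ j ∈ Finset.range (n + 1), (((P : R) ^ (j + 1) - ↑P⁻¹ ^ (j + 1)) * (θ : R) ^ (j + 1)) •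
        (x (l + (j + 1)) * S (n - j)) =
      ∑ r ∈ Finset.range (n + 2), (expCoeff P r * (θ : R) ^ r) •
        (-(r : R) • (S (n + 1 - r) * x (l + r))) := by
    rw [Finset.sum_range_succ' _ (n + 1), Nat.cast_zero, neg_zero, zero_smul, smul_zero, add_zero]
    have : ∀ j ∈ Finset.range (n + 1),
        (((P : R) ^ (j + 1) - ↑P⁻¹ ^ (j + 1)) * (θ : R) ^ (j + 1)) •
          (x (l + (j + 1)) * S (n - j)) =
        ∑ r ∈ Finset.Ico j (n + 1), ((((P : R) ^ (j + 1) - ↑P⁻¹ ^ (j + 1)) * expCoeff P (r - j)) *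
          θ ^ (r + 1)) • (S (n - r) * x (l + (r + 1 : ℕ))) := by
      intro j hj
      have hj' := Finset.mem_range.1 hj
      rw [ih _ (by omega), Finset.smul_sum, Finset.sum_Ico_eq_sum_range,
        show n + 1 - j = n - j + 1 by omega]
      refine Finset.sum_congr rfl fun r _ => ?_
      rw [smul_smul, show n - j - r = n - (j + r) by omega, show j + r - j = r by omega]
      rw [show l + ((j : ℤ) + 1) + (r : ℤ) = l + ((j + r + 1 : ℕ) : ℤ) by push_cast; ring]
      congr 1
      ring
    rw [Finset.sum_congr rfl this,
      Finset.sum_comm' (t' := Finset.range (n + 1)) (s' := fun r => Finset.range (r + 1))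
        (by intro a b; simp only [Finset.mem_range, Finset.mem_Ico]; omega)]
    refine Finset.sum_congr rfl fun r hr => ?_
    rw [← Finset.sum_smul, ← Finset.sum_mul]
    have := sum_mul_expCoeff P (r + 1)
    rw [show r + 1 - 1 = r by omega] at this
    rw [this, smul_smul, show n + 1 - (r + 1) = n - r by omega]
    congr 1
    push_cast; ring
  rw [e1, e2, e3, ← Finset.sum_sub_distrib, Finset.smul_sum]
  refine Finset.sum_congr rfl fun r hr => ?_
  have hr' := Finset.mem_range.1 hr
  rw [← smul_sub, ← sub_smul, smul_comm (n + 1), ← Nat.cast_smul_eq_nsmul R (n + 1)]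
  congr 2
  rw [Nat.cast_sub (by omega)]
  ring

/-- The exchange relation between Cartan modes and the modes of `x`. -/
def ShiftRel (P θ : Rˣ) (Ψ x : ℤ → E) : Prop :=
  ∀ m l, Ψ (m + 1) * x l - (P : R) • (x l * Ψ (m + 1)) =
    (θ : R) • ((P : R) • (Ψ m * x (l + 1)) - x (l + 1) * Ψ m)

/-- The Cartan modes `K S_m`, `m ≥ 0`. -/
def cartanModes (K : E) (S : ℕ → E) (m : ℤ) : E := if 0 ≤ m then K * S m.toNat else 0

lemma IsSchur.shiftRel (htf : TorsionFree E) {y S : ℕ → E} (hS : IsSchur y S) (P θ : Rˣ)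
    (x : ℤ → E) (h : ∀ (k : ℕ) l, (k + 1) • (y (k + 1) * x l - x l * y (k + 1)) =
      (((P : R) ^ (k + 1) - ↑P⁻¹ ^ (k + 1)) * (θ : R) ^ (k + 1)) • x (l + (k + 1)))
    (K : E) (hK : ∀ l, K * x l = (P : R) • (x l * K)) : ShiftRel P θ (cartanModes K S) x := by
  have hP : (P : R) * ↑P⁻¹ = 1 := P.mul_inv
  intro m l
  rcases lt_trichotomy m (-1) with hm | rfl | hm
  · simp [cartanModes, show ¬ 0 ≤ m by omega, show ¬ 0 ≤ m + 1 by omega]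
  · simp [cartanModes, hS.1, hK]
  obtain ⟨n, rfl⟩ := Int.eq_ofNat_of_zero_le (show 0 ≤ m by omega)
  have e1 := hS.mul_eq_sum htf P θ x h (n + 1) l
  have e2 := hS.mul_eq_sum htf P θ x h n (l + 1)
  have key : x l * S (n + 1) - (↑P⁻¹ * θ : R) • (x (l + 1) * S n) =
      S (n + 1) * x l - (P * θ : R) • (S n * x (l + 1)) := by
    rw [e1, e2, Finset.sum_range_succ', Finset.sum_range_succ', Finset.sum_range_succ',
      smul_add, Finset.smul_sum]
    have : ∀ r ∈ Finset.range n, (expCoeff P (r + 1 + 1) * (θ : R) ^ (r + 1 + 1)) •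
        (S (n + 1 - (r + 1 + 1)) * x (l + (r + 1 + 1 : ℕ))) = (↑P⁻¹ * θ : R) •
        (expCoeff P (r + 1) * (θ : R) ^ (r + 1)) • (S (n - (r + 1)) * x (l + 1 + (r + 1 : ℕ))) := by
      intro r _
      rw [expCoeff_succ _ (r + 1), if_neg (by omega), sub_zero, smul_smul,
        show n + 1 - (r + 1 + 1) = n - (r + 1) by omega]
      rw [show l + ((r + 1 + 1 : ℕ) : ℤ) = l + 1 + ((r + 1 : ℕ) : ℤ) by push_cast; ring]
      congr 1
      ring
    rw [Finset.sum_congr rfl this]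
    simp only [expCoeff, Nat.cast_zero, add_zero, zero_add, Nat.cast_one, pow_zero, pow_one, mul_one,
      one_smul, Nat.sub_zero, Nat.add_sub_cancel, sub_mul, sub_smul]
    abel
  have e3 := congrArg (fun t => K * t) key
  simp only [mul_sub, mul_smul_comm, ← mul_assoc, hK, smul_mul_assoc] at e3
  have e4 : cartanModes K S ((n : ℤ) + 1) = K * S (n + 1) := by
    simp [cartanModes, show (0 : ℤ) ≤ n + 1 by omega]
  have e5 : cartanModes K S (n : ℤ) = K * S n := by simp [cartanModes]
  rw [e4, e5]
  rw [smul_smul, show (↑P⁻¹ * θ : R) * P = θ by rw [mul_right_comm, mul_comm _ (P : R), hP, one_mul]] at e3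
  simp only [← mul_assoc, smul_sub, smul_smul]
  rw [mul_comm (θ : R)]
  rw [← sub_eq_zero] at e3 ⊢
  rw [← neg_eq_zero, ← e3]
  simp only [mul_assoc]
  abel

lemma ShiftRel.reflect {P θ : Rˣ} {Ψ x : ℤ → E} (h : ShiftRel P θ Ψ x) :
    ShiftRel P⁻¹ θ⁻¹ (fun m => Ψ (-m)) (fun l => x (-l)) := by
  intro m l
  have e1 := h (-m - 1) (-l - 1)
  simp only [sub_add_cancel] at e1
  beta_reduce
  rw [show -(m + 1) = -m - 1 by ring, show -(l + 1) = -l - 1 by ring]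
  have hP : (↑P⁻¹ : R) * P = 1 := P.inv_mul
  have hθ : (↑θ⁻¹ : R) * θ = 1 := θ.inv_mul
  have e2 := congrArg (fun t => (↑P⁻¹ * ↑θ⁻¹ : R) • t) e1
  simp only [smul_sub, smul_smul] at e2 ⊢
  rw [show (↑P⁻¹ * ↑θ⁻¹ : R) * (θ * P) = 1 by grind, show (↑P⁻¹ * ↑θ⁻¹ : R) * θ = ↑P⁻¹ by grind,
    show (↑P⁻¹ * ↑θ⁻¹ : R) * P = ↑θ⁻¹ by grind, mul_comm (↑P⁻¹ : R) (↑θ⁻¹ : R)] at e2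
  rw [one_smul, ← sub_eq_zero] at e2
  rw [← sub_eq_zero, ← neg_eq_zero, ← e2]
  abel

lemma ShiftRel.quadRel {P θ : Rˣ} {Ψ x : ℤ → E} (h : ShiftRel P θ Ψ x) (a b : ℤ) :
    QuadRel (P : R) (fun t => ((θ ^ (a - t) : Rˣ) : R) • Ψ (t + b)) x := by
  intro k l
  have e1 := congrArg (fun t => ((θ ^ (a - (k + 1)) : Rˣ) : R) • t) (h (k + b) l)
  have e2 : ((θ ^ (a - (k + 1)) : Rˣ) : R) * θ = ((θ ^ (a - k) : Rˣ) : R) := by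
    rw [← Units.val_mul, ← zpow_add_one]; congr 2; ring
  simp only [smul_smul, e2, show k + b + 1 = k + 1 + b by ring] at e1
  simp only [smul_mul_assoc, mul_smul_comm]
  rw [smul_comm (P : R), ← smul_sub, e1, smul_sub, smul_comm (P : R)]

lemma ShiftRel.smul {P θ : Rˣ} {Ψ x : ℤ → E} (h : ShiftRel P θ Ψ x) (c : R) :
    ShiftRel P θ (fun m => c • Ψ m) x := by
  intro m l
  have e1 := congrArg (fun t => c • t) (h m l)
  simp only [smul_mul_assoc, mul_smul_comm]
  rw [smul_comm (P : R) c, ← smul_sub, e1, smul_comm c (θ : R), smul_sub c, smul_comm c (P : R)]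

end Schur
end QAff

namespace QAff

section Homogeneity

variable {R E : Type*} [CommRing R] [Ring E] [Algebra R E]
open TrivSqZeroExt

lemma prod_map_smul' {ι : Type*} (L : List ι) (c : ι → R) (x : ι → E) :
    (L.map fun t => c t • x t).prod = (L.map c).prod • (L.map x).prod := by
  induction L with
  | nil => simp
  | cons a L ih => simp only [List.map_cons, List.prod_cons, ih, smul_mul_smul_comm]

lemma serreSum_smul (β : ℕ → R) (n : ℕ) (c c' : ℤ → R) (x y : ℤ → E) (k : Fin n → ℤ) (l : ℤ) :
    serreSum β n (fun k => c k • x k) (fun k => c' k • y k) k l =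
      ((∏ t, c (k t)) * c' l) • serreSum β n x y k l := by
  simp only [serreSum, Finset.smul_sum]
  refine Finset.sum_congr rfl fun σ _ => Finset.sum_congr rfl fun r _ => ?_
  rw [prod_map_smul' _ (fun t => c (k (σ t))) (fun t => x (k (σ t))),
    prod_map_smul' _ (fun t => c (k (σ t))) (fun t => x (k (σ t))), smul_mul_smul_comm,
    smul_mul_smul_comm, smul_comm _ ((-1) ^ r * β r)]
  congr 2
  rw [mul_right_comm, ← List.prod_append, ← List.map_append, List.take_append_drop,
    ← List.ofFn_eq_map, List.prod_ofFn, Equiv.prod_comp σ (fun t => c (k t))]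

lemma QuadRel.smul_zpow {p : R} {f g : ℤ → E} (h : QuadRel p f g) (u w : R) (v : Rˣ) :
    QuadRel p (fun k => (u * ((v ^ k : Rˣ) : R)) • f k) (fun k => (w * ((v ^ k : Rˣ) : R)) • g k) := by
  intro k l
  have e1 : ∀ a b : ℤ, ((v ^ a : Rˣ) : R) * ((v ^ b : Rˣ) : R) = ((v ^ (a + b) : Rˣ) : R) := by
    intro a b; rw [zpow_add, Units.val_mul]
  have e0 := congrArg (fun t => (u * w * ((v ^ (k + l + 1) : Rˣ) : R)) • t) (h k l)
  simp only [smul_sub, smul_mul_smul_comm] at e0 ⊢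
  rw [show u * ((v ^ (k + 1) : Rˣ) : R) * (w * ((v ^ l : Rˣ) : R)) =
      u * w * ((v ^ (k + l + 1) : Rˣ) : R) by
        rw [mul_mul_mul_comm, e1]; congr 3; ring,
    show w * ((v ^ l : Rˣ) : R) * (u * ((v ^ (k + 1) : Rˣ) : R)) =
      u * w * ((v ^ (k + l + 1) : Rˣ) : R) by
        rw [mul_mul_mul_comm, e1, mul_comm w]; congr 3; ring,
    show u * ((v ^ k : Rˣ) : R) * (w * ((v ^ (l + 1) : Rˣ) : R)) =
      u * w * ((v ^ (k + l + 1) : Rˣ) : R) by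
        rw [mul_mul_mul_comm, e1]; congr 3; ring,
    show w * ((v ^ (l + 1) : Rˣ) : R) * (u * ((v ^ k : Rˣ) : R)) =
      u * w * ((v ^ (k + l + 1) : Rˣ) : R) by
        rw [mul_mul_mul_comm, e1, mul_comm w]; congr 3; ring,
    smul_comm p, smul_comm p, e0]

lemma QuadRel.shift_dual {p : R} {f g : ℤ → E} (h : QuadRel p f g) (a b : R) (s : ℤ) :
    QuadRel p (fun k => (inl (f k) + inr (a • f (k + s)) : DualNumber E))
      (fun k => (inl (g k) + inr (b • g (k + s)) : DualNumber E)) := by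
  apply QuadRel.dual
  · simpa using h
  · intro k l
    have e0 := congrArg (fun t => a • t) (h (k + s) l)
    simp only [fst_add, fst_inl, fst_inr, snd_add, snd_inl, snd_inr, add_zero, zero_add,
      smul_mul_assoc, mul_smul_comm, smul_sub, smul_comm p a] at e0 ⊢
    rw [show k + 1 + s = k + s + 1 by ring, e0]
  · intro k l
    have e0 := congrArg (fun t => b • t) (h.symm (k + s) l)
    simp only [fst_add, fst_inl, fst_inr, snd_add, snd_inl, snd_inr, add_zero, zero_add,
      smul_mul_assoc, mul_smul_comm, smul_sub, smul_comm p b] at e0 ⊢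
    rw [show k + 1 + s = k + s + 1 by ring, e0]

lemma serreSum_shift_dual {β : ℕ → R} {n : ℕ} {x y : ℤ → E}
    (h : ∀ k l, serreSum β n x y k l = 0) (a b : R) (s : ℤ) (k : Fin n → ℤ) (l : ℤ) :
    serreSum β n (fun k => (inl (x k) + inr (a • x (k + s)) : DualNumber E))
      (fun k => (inl (y k) + inr (b • y (k + s)) : DualNumber E)) k l = 0 := by
  ext
  · have := map_serreSum β n (fun k => (inl (x k) + inr (a • x (k + s)) : DualNumber E))
      (fun k => (inl (y k) + inr (b • y (k + s)) : DualNumber E)) k l (fstHom R E E)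
    simpa [h] using this
  · rw [snd_serreSum, snd_zero]
    simp only [fst_add, fst_inl, fst_inr, snd_add, snd_inl, snd_inr, add_zero, zero_add]
    have e1 : serreSum β n x (fun k => b • y (k + s)) k l = 0 := by
      have e2 : serreSum β n x (fun k => b • y (k + s)) k l = b • serreSum β n x y k (l + s) := by
        simp only [serreSum, Finset.smul_sum, mul_smul_comm, smul_mul_assoc, smul_comm b]
      rw [e2, h, smul_zero]
    have e3 : ∀ t : Fin n, ∑ σ : Equiv.Perm (Fin n), ∑ r ∈ Finset.range (n + 1), ((-1) ^ r * β r) •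
        ((((List.finRange n).take r).map fun u =>
          if u = σ.symm t then a • x (k (σ u) + s) else x (k (σ u))).prod * y l *
        (((List.finRange n).drop r).map fun u =>
          if u = σ.symm t then a • x (k (σ u) + s) else x (k (σ u))).prod) = 0 := by
      intro t
      have e4 := serreSum_smul β n (fun _ => (1 : R)) (fun _ => a) x y
        (Function.update k t (k t + s)) l
      have e5 : ∀ (σ : Equiv.Perm (Fin n)) (r : ℕ),
          (((List.finRange n).take r).map fun u =>
            if u = σ.symm t then a • x (k (σ u) + s) else x (k (σ u))).prod * y l *
          (((List.finRange n).drop r).map fun u =>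
            if u = σ.symm t then a • x (k (σ u) + s) else x (k (σ u))).prod =
          a • ((((List.finRange n).take r).map fun u => x (Function.update k t (k t + s) (σ u))).prod
            * y l *
          (((List.finRange n).drop r).map fun u =>
            x (Function.update k t (k t + s) (σ u))).prod) := by
        intro σ r
        have e6 : ∀ u, (if u = σ.symm t then a • x (k (σ u) + s) else x (k (σ u))) =
            (if u = σ.symm t then a else 1) • x (Function.update k t (k t + s) (σ u)) := by
          intro u
          by_cases hu : u = σ.symm t
          · subst hu; simp
          · have : σ u ≠ t := fun h => hu (by rw [← h]; simp)
            simp [hu, Function.update_of_ne this]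
        simp only [e6]
        rw [prod_map_smul' _ (fun u => if u = σ.symm t then a else (1 : R)),
          prod_map_smul' _ (fun u => if u = σ.symm t then a else (1 : R)), smul_mul_assoc,
          smul_mul_smul_comm, ← List.prod_append, ← List.map_append, List.take_append_drop,
          ← List.ofFn_eq_map, List.prod_ofFn, Finset.prod_ite_eq' Finset.univ (σ.symm t),
          if_pos (Finset.mem_univ _)]
      simp only [e5, smul_comm _ a]
      simp only [← Finset.smul_sum]
      have := h (Function.update k t (k t + s)) l
      rw [serreSum] at this
      rw [this, smul_zero]
    have e7 := Fintype.sum_eq_zero _ e3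
    rw [e1, zero_add]
    refine Eq.trans ?_ e7
    conv_rhs => rw [Finset.sum_comm]
    refine Finset.sum_congr rfl fun σ _ => ?_
    conv_rhs => rw [Finset.sum_comm]
    refine Finset.sum_congr rfl fun r _ => ?_
    rw [← Finset.smul_sum]
    congr 1
    exact (Equiv.sum_comp σ.symm _).symm

end Homogeneity

/-- The structure constants of a quantum affine algebra over `R`. -/
structure DrinfeldData (ι R : Type*) [CommRing R] where
  /-- `q^{(α_i|α_j)}` -/
  p : ι → ι → Rˣ
  /-- `γ^{1/2}` -/
  g : Rˣ
  /-- `q` -/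
  q : Rˣ
  /-- `q_i - q_i⁻¹` -/
  κ : ι → Rˣ
  /-- `q_i` -/
  Q : ι → Rˣ
  /-- `-a_{ij}` -/
  m : ι → ι → ℕ
  /-- Gaussian binomial coefficients -/
  β : ι → ι → ℕ → R
  p_comm : ∀ i j, p i j = p j i
  p_self : ∀ i, p i i = Q i ^ 2
  p_ne : ∀ i j, i ≠ j → p i j = (Q i)⁻¹ ^ m i j
  serre_pos : ∀ i j, i ≠ j → SerreCoeffs (Q i : R) ↑(Q i)⁻¹ (m i j) (β i j)
  serre_neg : ∀ i j, i ≠ j → SerreCoeffs (↑(Q i)⁻¹ : R) ↑(Q i) (m i j) (β i j)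

variable {ι R : Type*} [CommRing R] (X : DrinfeldData ι R)

/-- The relations satisfied by the negative currents. -/
def IsNegative {B : Type*} [Ring B] [Algebra R B] (f : ι → ℤ → B) : Prop :=
  (∀ i j, QuadRel (↑(X.p i j)⁻¹ : R) (f i) (f j)) ∧
  ∀ i j, i ≠ j → ∀ k l, serreSum (X.β i j) (X.m i j + 1) (f i) (f j) k l = 0

/-- The defining relations of the negative part, in the free algebra. -/
inductive NegRel : FreeAlgebra R (ι × ℤ) → FreeAlgebra R (ι × ℤ) → Prop
  | quad (i j : ι) (k l : ℤ) : NegRel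
      (FreeAlgebra.ι R (i, k + 1) * FreeAlgebra.ι R (j, l) -
        (↑(X.p i j)⁻¹ : R) • (FreeAlgebra.ι R (j, l) * FreeAlgebra.ι R (i, k + 1)))
      ((↑(X.p i j)⁻¹ : R) • (FreeAlgebra.ι R (i, k) * FreeAlgebra.ι R (j, l + 1)) -
        FreeAlgebra.ι R (j, l + 1) * FreeAlgebra.ι R (i, k))
  | serre (i j : ι) (hij : i ≠ j) (k : Fin (X.m i j + 1) → ℤ) (l : ℤ) : NegRel
      (serreSum (X.β i j) (X.m i j + 1) (fun t => FreeAlgebra.ι R (i, t))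
        (fun t => FreeAlgebra.ι R (j, t)) k l) 0

/-- The negative part of the quantum affine algebra. -/
abbrev Neg : Type _ := RingQuot (NegRel X)

/-- The negative Drinfeld generators. -/
def negX (i : ι) (l : ℤ) : Neg X := RingQuot.mkAlgHom R (NegRel X) (FreeAlgebra.ι R (i, l))

lemma isNegative_negX : IsNegative X (negX X) := by
  constructor
  · intro i j k l
    have := RingQuot.mkAlgHom_rel R (NegRel.quad (X := X) i j k l)
    simpa [negX] using this
  · intro i j hij k l
    have := RingQuot.mkAlgHom_rel R (NegRel.serre (X := X) i j hij k l)
    rwa [map_serreSum, map_zero] at this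

variable {X}

/-- The universal property of the negative part. -/
def negLift {B : Type*} [Ring B] [Algebra R B] (f : ι → ℤ → B) (hf : IsNegative X f) :
    Neg X →ₐ[R] B :=
  RingQuot.liftAlgHom R ⟨FreeAlgebra.lift R fun a : ι × ℤ => f a.1 a.2, by
    rintro _ _ (⟨i, j, k, l⟩ | ⟨i, j, hij, k, l⟩)
    · simpa using hf.1 i j k l
    · rw [map_serreSum, map_zero]
      simpa using hf.2 i j hij k l⟩

@[simp] lemma negLift_negX {B : Type*} [Ring B] [Algebra R B] (f : ι → ℤ → B)
    (hf : IsNegative X f) (i : ι) (l : ℤ) : negLift f hf (negX X i l) = f i l := by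
  simp [negLift, negX]

lemma neg_algHom_ext {B : Type*} [Ring B] [Algebra R B] {f g : Neg X →ₐ[R] B}
    (h : ∀ i l, f (negX X i l) = g (negX X i l)) : f = g := by
  apply RingQuot.ringQuot_ext'
  apply FreeAlgebra.hom_ext
  funext a
  exact h a.1 a.2

lemma neg_adjoin : Algebra.adjoin R (Set.range fun a : ι × ℤ => negX X a.1 a.2) = ⊤ := by
  have h := FreeAlgebra.adjoin_range_ι R (ι × ℤ)
  have h1 := congrArg (Subalgebra.map (RingQuot.mkAlgHom R (NegRel X))) h
  rw [AlgHom.map_adjoin, Algebra.map_top, (AlgHom.range_eq_top _).2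
    (RingQuot.mkAlgHom_surjective R (NegRel X)), ← Set.range_comp] at h1
  exact h1

lemma neg_induction {P : Neg X → Prop} (hx : ∀ i l, P (negX X i l))
    (h1 : ∀ r : R, P (algebraMap R _ r)) (ha : ∀ a b, P a → P b → P (a + b))
    (hm : ∀ a b, P a → P b → P (a * b)) (n : Neg X) : P n := by
  have hn : n ∈ Algebra.adjoin R (Set.range fun a : ι × ℤ => negX X a.1 a.2) := by
    rw [neg_adjoin]; trivial
  refine Algebra.adjoin_induction (p := fun n _ => P n) ?_ h1 (fun a b _ _ => ha a b)
    (fun a b _ _ => hm a b) hn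
  rintro _ ⟨a, rfl⟩
  exact hx _ _

/-- Rescaling is an automorphism of the relations. -/
lemma IsNegative.scale {B : Type*} [Ring B] [Algebra R B] {f : ι → ℤ → B} (hf : IsNegative X f)
    (u : ι → R) (v : Rˣ) : IsNegative X fun i l => (u i * ((v ^ l : Rˣ) : R)) • f i l := by
  refine ⟨fun i j => (hf.1 i j).smul_zpow _ _ v, fun i j hij k l => ?_⟩
  rw [serreSum_smul _ _ (fun l => u i * ((v ^ l : Rˣ) : R)), hf.2 i j hij, smul_zero]

open TrivSqZeroExt in
lemma IsNegative.shift {B : Type*} [Ring B] [Algebra R B] {f : ι → ℤ → B} (hf : IsNegative X f)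
    (a : ι → R) (s : ℤ) :
    IsNegative X fun i l => (inl (f i l) + inr (a i • f i (l + s)) : DualNumber B) :=
  ⟨fun i j => (hf.1 i j).shift_dual _ _ s,
    fun i j hij k l => serreSum_shift_dual (hf.2 i j hij) _ _ s k l⟩

/-- The scaling automorphism of the negative part. -/
def negScale (u : ι → R) (v : Rˣ) : Neg X →ₐ[R] Neg X :=
  negLift _ ((isNegative_negX X).scale u v)

lemma negScale_negX (u : ι → R) (v : Rˣ) (i : ι) (l : ℤ) :
    negScale u v (negX X i l) = (u i * ((v ^ l : Rˣ) : R)) • negX X i l := negLift_negX _ _ _ _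

/-- The first order part of a homomorphism to dual numbers. -/
def sndPart {A B : Type*} [Ring A] [Algebra R A] [Ring B] [Algebra R B]
    (φ : A →ₐ[R] DualNumber B) : A →ₗ[R] B where
  toFun a := (φ a).snd
  map_add' a b := by rw [map_add, TrivSqZeroExt.snd_add]
  map_smul' r a := by rw [map_smul, TrivSqZeroExt.snd_smul, RingHom.id_apply]

/-- The derivation of the negative part shifting the modes. -/
def negShift (a : ι → R) (s : ℤ) : Neg X →ₗ[R] Neg X :=
  sndPart (negLift _ ((isNegative_negX X).shift a s))

lemma negShift_negX (a : ι → R) (s : ℤ) (i : ι) (l : ℤ) :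
    negShift a s (negX X i l) = a i • negX X i (l + s) := by
  simp [negShift, sndPart]

lemma negShift_mul (a : ι → R) (s : ℤ) (x y : Neg X) :
    negShift a s (x * y) = x * negShift a s y + negShift a s x * y := by
  have h : (TrivSqZeroExt.fstHom R (Neg X) (Neg X)).comp
      (negLift _ ((isNegative_negX X).shift a s)) = AlgHom.id R _ := by
    apply neg_algHom_ext; intro i l; simp
  have h' : ∀ z, (negLift _ ((isNegative_negX X).shift a s) z).fst = z := fun z =>
    DFunLike.congr_fun h z
  simp only [negShift, sndPart, LinearMap.coe_mk, AddHom.coe_mk, map_mul, DualNumber.snd_mul, h']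

lemma negShift_algebraMap (a : ι → R) (s : ℤ) (r : R) :
    negShift a s (algebraMap R (Neg X) r) = 0 := by
  simp [negShift, sndPart, AlgHom.commutes, TrivSqZeroExt.algebraMap_eq_inl']

end QAff

namespace QAff

section RatInv

variable (R : Type*) [CommRing R] [Algebra ℚ R]

/-- The inverse of an integer in a `ℚ`-algebra. -/
def ratInv (k : ℤ) : R := algebraMap ℚ R (k : ℚ)⁻¹

variable {R}

lemma mul_ratInv {k : ℤ} (hk : k ≠ 0) : (k : R) * ratInv R k = 1 := by
  have : (k : R) = algebraMap ℚ R (k : ℚ) := by simp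
  rw [ratInv, this, ← map_mul, mul_inv_cancel₀ (by exact_mod_cast hk), map_one]

lemma ratInv_neg (k : ℤ) : ratInv R (-k) = -ratInv R k := by
  simp [ratInv, inv_neg]

lemma torsionFree_of_module (R : Type*) [CommRing R] [Algebra ℚ R] (M : Type*) [AddCommGroup M]
    [Module R M] : TorsionFree M := by
  intro n x hx
  have h1 : ratInv R (n + 1 : ℤ) • (((n + 1 : ℤ) : R) • x) = x := by
    rw [smul_smul, mul_comm, mul_ratInv (by omega), one_smul]
  rw [← h1]
  have : ((n + 1 : ℤ) : R) • x = (n + 1) • x := by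
    rw [← Nat.cast_smul_eq_nsmul R]; push_cast; rfl
  rw [this, hx, smul_zero]

/-- The coefficients of `exp (∑ y_l z^l)`. -/
def schur {E : Type*} [Ring E] [Algebra R E] (y : ℕ → E) : ℕ → E
  | 0 => 1
  | n + 1 => ratInv R (n + 1 : ℤ) •
      ∑ l ∈ Finset.range (n + 1), (l + 1) • (y (l + 1) * schur y (n - l))

lemma isSchur_schur {E : Type*} [Ring E] [Algebra R E] (y : ℕ → E) : IsSchur y (schur (R := R) y) := by
  refine ⟨by rw [schur], fun n => ?_⟩
  rw [schur, ← Nat.cast_smul_eq_nsmul R, smul_smul, show ((n + 1 : ℕ) : R) = ((n + 1 : ℤ) : R) by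
    push_cast; rfl, mul_ratInv (by omega), one_smul]

end RatInv

variable {ι R : Type*} [CommRing R] [Algebra ℚ R] (X : DrinfeldData ι R)
variable {E : Type*} [Ring E] [Algebra R E]

/-- The exchange coefficient of `h_{i,k}` with a current of weight `P` and level `θ`. -/
def hcoef (i : ι) (P θ : Rˣ) (k : ℤ) : R :=
  ↑(X.κ i)⁻¹ * ratInv R k * (((P ^ k : Rˣ) : R) - ((P ^ (-k) : Rˣ) : R)) * ((θ ^ |k| : Rˣ) : R)

/-- The Heisenberg cocycle. -/
def heis (i j : ι) (k : ℤ) : R :=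
  ↑(X.κ i)⁻¹ * ratInv R k * (((X.p i j ^ k : Rˣ) : R) - ((X.p i j ^ (-k) : Rˣ) : R)) * ↑(X.κ j)⁻¹ *
    (((X.g ^ (2 * k) : Rˣ) : R) - ((X.g ^ (-(2 * k)) : Rˣ) : R))

lemma heis_neg (i j : ι) (k : ℤ) : heis X i j (-k) = -heis X j i k := by
  simp only [heis, ratInv_neg, neg_neg, X.p_comm j i, mul_neg]
  ring

/-- The Cartan currents of a quantum affine algebra. -/
structure IsCartan (h : ι → ℤ → E) (K Kinv : ι → E) : Prop where
  K_Kinv : ∀ i, K i * Kinv i = 1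
  Kinv_K : ∀ i, Kinv i * K i = 1
  K_K : ∀ i j, K i * K j = K j * K i
  K_h : ∀ i j k, K i * h j k = h j k * K i
  h_h : ∀ i j k l, h i k * h j l - h j l * h i k = if l = -k then heis X i j k • 1 else 0

/-- The exchange relations between the Cartan currents and a family of currents. -/
structure Exchange (h : ι → ℤ → E) (K Kinv : ι → E) (P : ι → ι → Rˣ) (θ : Rˣ) (x : ι → ℤ → E) :
    Prop where
  K_x : ∀ i j l, K i * x j l = (P i j : R) • (x j l * K i)
  Kinv_x : ∀ i j l, Kinv i * x j l = (↑(P i j)⁻¹ : R) • (x j l * Kinv i)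
  h_x : ∀ i j k l, h i k * x j l - x j l * h i k = hcoef X i (P i j) θ k • x j (l + k)

/-- The current `ψ_i`. -/
def psi (h : ι → ℤ → E) (K : ι → E) (i : ι) : ℤ → E :=
  cartanModes (K i) (schur (R := R) fun l => (X.κ i : R) • h i l)

/-- The current `φ_i`. -/
def phi (h : ι → ℤ → E) (Kinv : ι → E) (i : ι) (m : ℤ) : E :=
  cartanModes (Kinv i) (schur (R := R) fun l => -(X.κ i : R) • h i (-l)) (-m)

lemma psi_neg (h : ι → ℤ → E) (K : ι → E) (i : ι) {m : ℤ} (hm : m < 0) : psi X h K i m = 0 :=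
  if_neg (by omega)

lemma phi_pos (h : ι → ℤ → E) (K : ι → E) (i : ι) {m : ℤ} (hm : 0 < m) : phi X h K i m = 0 :=
  if_neg (by omega)

variable {X} {h : ι → ℤ → E} {K Kinv : ι → E} {P : ι → ι → Rˣ} {θ : Rˣ} {x : ι → ℤ → E}

lemma val_zpow_natCast_add_one (u : Rˣ) (k : ℕ) : ((u ^ ((k : ℤ) + 1) : Rˣ) : R) = (u : R) ^ (k + 1) := by
  rw [← Nat.cast_succ, zpow_natCast, Units.val_pow_eq_pow_val]

lemma val_zpow_neg_natCast_add_one (u : Rˣ) (k : ℕ) :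
    ((u ^ (-((k : ℤ) + 1)) : Rˣ) : R) = (↑u⁻¹ : R) ^ (k + 1) := by
  rw [zpow_neg, ← inv_zpow, val_zpow_natCast_add_one]

lemma Exchange.smul_h_x (H : Exchange X h K Kinv P θ x) (i j : ι) (k : ℕ) (l : ℤ) :
    (k + 1) • (((X.κ i : R) • h i (k + 1 : ℕ)) * x j l - x j l * ((X.κ i : R) • h i (k + 1 : ℕ))) =
      (((P i j : R) ^ (k + 1) - ↑(P i j)⁻¹ ^ (k + 1)) * (θ : R) ^ (k + 1)) • x j (l + (k + 1)) := by
  have e0 := H.h_x i j ((k : ℤ) + 1) l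
  have e1 : (((k + 1 : ℕ) : ℤ) : R) * ratInv R ((k : ℤ) + 1) = 1 := mul_ratInv (by omega)
  have e2 : (X.κ i : R) * ↑(X.κ i)⁻¹ = 1 := Units.mul_inv _
  rw [smul_mul_assoc, mul_smul_comm, ← smul_sub, Nat.cast_succ, e0,
    ← Nat.cast_smul_eq_nsmul R, smul_smul, smul_smul]
  congr 1
  rw [hcoef, val_zpow_natCast_add_one, val_zpow_neg_natCast_add_one,
    abs_of_nonneg (by omega : (0 : ℤ) ≤ (k : ℤ) + 1), val_zpow_natCast_add_one]
  push_cast at e1 ⊢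
  grind

lemma Exchange.smul_h_neg_x (H : Exchange X h K Kinv P θ x) (i j : ι) (k : ℕ) (l : ℤ) :
    (k + 1) • ((-(X.κ i : R) • h i (-(k + 1 : ℕ))) * x j (-l) -
        x j (-l) * (-(X.κ i : R) • h i (-(k + 1 : ℕ)))) =
      (((↑(P i j)⁻¹ : R) ^ (k + 1) - ↑(P i j)⁻¹⁻¹ ^ (k + 1)) * (θ : R) ^ (k + 1)) •
        x j (-(l + (k + 1))) := by
  have e0 := H.h_x i j (-((k : ℤ) + 1)) (-l)
  have e1 : (((k + 1 : ℕ) : ℤ) : R) * ratInv R ((k : ℤ) + 1) = 1 := mul_ratInv (by omega)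
  have e2 : (X.κ i : R) * ↑(X.κ i)⁻¹ = 1 := Units.mul_inv _
  rw [smul_mul_assoc, mul_smul_comm, ← smul_sub, Nat.cast_succ, e0,
    ← Nat.cast_smul_eq_nsmul R, smul_smul, smul_smul,
    show -l + -((k : ℤ) + 1) = -(l + (k + 1)) by ring]
  congr 1
  rw [hcoef, neg_neg, val_zpow_natCast_add_one, val_zpow_neg_natCast_add_one, ratInv_neg, abs_neg,
    abs_of_nonneg (by omega : (0 : ℤ) ≤ (k : ℤ) + 1), val_zpow_natCast_add_one, inv_inv]
  push_cast at e1 ⊢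
  grind

lemma Exchange.psi_shiftRel (H : Exchange X h K Kinv P θ x) (i j : ι) :
    ShiftRel (P i j) θ (psi X h K i) (x j) :=
  (isSchur_schur _).shiftRel (torsionFree_of_module R E) _ _ _ (H.smul_h_x i j) _ (H.K_x i j)

lemma Exchange.phi_shiftRel (H : Exchange X h K Kinv P θ x) (i j : ι) :
    ShiftRel (P i j) θ⁻¹ (phi X h Kinv i) (x j) := by
  have := ((isSchur_schur (R := R) fun l : ℕ => -(X.κ i : R) • h i (-l)).shiftRel
    (torsionFree_of_module R E) (P i j)⁻¹ θ (fun l => x j (-l)) (H.smul_h_neg_x i j) _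
    (fun l => H.Kinv_x i j (-l))).reflect
  simp only [inv_inv, neg_neg] at this
  exact this

lemma Exchange.x_psi (H : Exchange X h K Kinv P θ x) (i j : ι) (l : ℤ) (n : ℕ) :
    x j l * psi X h K i n = ∑ r ∈ Finset.range (n + 1),
      (↑(P i j)⁻¹ * expCoeff (P i j) r * (θ : R) ^ r) •
        (psi X h K i ((n - r : ℕ) : ℤ) * x j (l + r)) := by
  have e0 : ∀ m : ℕ, psi X h K i m = K i * schur (R := R) (fun l => (X.κ i : R) • h i l) m :=
    fun m => by simp [psi, cartanModes]
  have e1 : x j l * K i = (↑(P i j)⁻¹ : R) • (K i * x j l) := by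
    rw [H.K_x, smul_smul, Units.inv_mul, one_smul]
  rw [e0, ← mul_assoc, e1, smul_mul_assoc, mul_assoc,
    (isSchur_schur _).mul_eq_sum (torsionFree_of_module R E) (P i j) θ (x j) (H.smul_h_x i j),
    Finset.mul_sum, Finset.smul_sum]
  refine Finset.sum_congr rfl fun r _ => ?_
  rw [e0, mul_smul_comm, smul_smul, mul_assoc, mul_assoc]

lemma Exchange.x_phi (H : Exchange X h K Kinv P θ x) (i j : ι) (l : ℤ) (n : ℕ) :
    x j l * phi X h Kinv i (-n) = ∑ r ∈ Finset.range (n + 1),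
      (↑(P i j) * expCoeff (P i j)⁻¹ r * (θ : R) ^ r) •
        (phi X h Kinv i (-((n - r : ℕ) : ℤ)) * x j (l - r)) := by
  have e0 : ∀ m : ℕ, phi X h Kinv i (-m) =
      Kinv i * schur (R := R) (fun l => -(X.κ i : R) • h i (-l)) m :=
    fun m => by simp [phi, cartanModes]
  have e1 : x j l * Kinv i = (↑(P i j) : R) • (Kinv i * x j l) := by
    rw [H.Kinv_x, smul_smul, Units.mul_inv, one_smul]
  have := (isSchur_schur (R := R) fun l : ℕ => -(X.κ i : R) • h i (-l)).mul_eq_sum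
    (torsionFree_of_module R E) (P i j)⁻¹ θ (fun l => x j (-l)) (H.smul_h_neg_x i j) n (-l)
  rw [neg_neg] at this
  rw [e0, ← mul_assoc, e1, smul_mul_assoc, mul_assoc, this, Finset.mul_sum, Finset.smul_sum]
  refine Finset.sum_congr rfl fun r _ => ?_
  rw [e0, mul_smul_comm, smul_smul, mul_assoc, mul_assoc, show -(-l + (r : ℤ)) = l - r by ring]

lemma IsCartan.h_psi (H : IsCartan X h K Kinv) (i j : ι) (k m : ℤ) :
    h i k * psi X h K j m - psi X h K j m * h i k =
      if k < 0 then ((X.κ j : R) * heis X i j k) • psi X h K j (m + k) else 0 := by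
  have htf : TorsionFree E := torsionFree_of_module R E
  by_cases hm : m < 0
  · rw [psi_neg _ _ _ _ hm, mul_zero, zero_mul, sub_zero]
    split_ifs with hk
    · rw [psi_neg _ _ _ _ (by omega), smul_zero]
    · rfl
  obtain ⟨m, rfl⟩ := Int.eq_ofNat_of_zero_le (not_lt.1 hm)
  have hS := isSchur_schur (R := R) fun l : ℕ => (X.κ j : R) • h j l
  set S := schur (R := R) fun l : ℕ => (X.κ j : R) • h j l
  have e0 : ∀ m : ℕ, psi X h K j m = K j * S m := fun m => by simp [psi, cartanModes, S]
  have e1 : h i k * (K j * S m) - K j * S m * h i k = K j * (h i k * S m - S m * h i k) := by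
    rw [mul_sub, ← mul_assoc, ← mul_assoc, H.K_h, mul_assoc (K j) (S m)]
  rw [e0, e1]
  split_ifs with hk
  · obtain ⟨k, rfl⟩ : ∃ a : ℕ, k = -(a + 1 : ℤ) := ⟨(-k - 1).toNat, by omega⟩
    rw [hS.commutator htf (h i (-(k + 1))) ((X.κ j : R) * heis X i j (-(k + 1))) k]
    · split_ifs with hm
      · rw [show (m : ℤ) + -(k + 1) = ((m - (k + 1) : ℕ) : ℤ) by omega, e0, mul_smul_comm]
      · rw [psi_neg _ _ _ _ (by omega), smul_zero, mul_zero]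
    · intro l
      rw [mul_smul_comm, smul_mul_assoc, ← smul_sub, H.h_h, smul_ite, smul_zero, smul_smul]
      refine if_congr ?_ rfl rfl
      push_cast; omega
  · rw [hS.commutator htf (h i k) (0 : R) 0]
    · simp
    · intro l
      rw [mul_smul_comm, smul_mul_assoc, ← smul_sub, H.h_h, if_neg (by push_cast; omega)]
      simp

lemma IsCartan.h_phi (H : IsCartan X h K Kinv) (i j : ι) (k m : ℤ) :
    h i k * phi X h Kinv j m - phi X h Kinv j m * h i k =
      if 0 < k then (-((X.κ j : R) * heis X i j k)) • phi X h Kinv j (m + k) else 0 := by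
  have htf : TorsionFree E := torsionFree_of_module R E
  by_cases hm : 0 < m
  · rw [phi_pos _ _ _ _ hm, mul_zero, zero_mul, sub_zero]
    split_ifs with hk
    · rw [phi_pos _ _ _ _ (by omega), smul_zero]
    · rfl
  obtain ⟨m, rfl⟩ : ∃ a : ℕ, m = -(a : ℤ) := ⟨(-m).toNat, by omega⟩
  have hS := isSchur_schur (R := R) fun l : ℕ => -(X.κ j : R) • h j (-l)
  set S := schur (R := R) fun l : ℕ => -(X.κ j : R) • h j (-l)
  have e0 : ∀ m : ℕ, phi X h Kinv j (-m) = Kinv j * S m := fun m => by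
    simp [phi, cartanModes, S]
  have e2 : Kinv j * h i k = h i k * Kinv j := by
    calc Kinv j * h i k = Kinv j * (h i k * K j) * Kinv j := by
          rw [mul_assoc, mul_assoc, H.K_Kinv, mul_one]
      _ = h i k * Kinv j := by rw [← H.K_h, ← mul_assoc, H.Kinv_K, one_mul]
  have e1 : h i k * (Kinv j * S m) - Kinv j * S m * h i k =
      Kinv j * (h i k * S m - S m * h i k) := by
    rw [mul_sub, ← mul_assoc, ← mul_assoc, e2, mul_assoc (Kinv j) (S m)]
  rw [e0, e1]
  split_ifs with hk
  · obtain ⟨k, rfl⟩ : ∃ a : ℕ, k = (a + 1 : ℤ) := ⟨(k - 1).toNat, by omega⟩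
    rw [hS.commutator htf (h i (k + 1)) (-((X.κ j : R) * heis X i j (k + 1))) k]
    · split_ifs with hm
      · rw [show -(m : ℤ) + (k + 1) = -((m - (k + 1) : ℕ) : ℤ) by omega, e0, mul_smul_comm]
      · rw [phi_pos _ _ _ _ (by omega), smul_zero, mul_zero]
    · intro l
      rw [mul_smul_comm, smul_mul_assoc, ← smul_sub, H.h_h, smul_ite, smul_zero, smul_smul, neg_mul]
      refine if_congr ?_ rfl rfl
      push_cast; omega
  · rw [hS.commutator htf (h i k) (0 : R) 0]
    · simp
    · intro l
      rw [mul_smul_comm, smul_mul_assoc, ← smul_sub, H.h_h, if_neg (by push_cast; omega)]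
      simp

lemma psi_comm {a : E} (ha : ∀ i, a * K i = K i * a) (hh : ∀ i k, a * h i k = h i k * a) (i : ι)
    (m : ℤ) : a * psi X h K i m = psi X h K i m * a := by
  unfold psi cartanModes
  split_ifs
  · have := (isSchur_schur (R := R) fun l : ℕ => (X.κ i : R) • h i l).graded
      (torsionFree_of_module R E) a (1 : R) (fun l => by simp [hh]) m.toNat
    rw [← mul_assoc, ha, mul_assoc, this, one_pow, one_smul, mul_assoc]
  · simp

lemma phi_comm {a : E} (ha : ∀ i, a * Kinv i = Kinv i * a) (hh : ∀ i k, a * h i k = h i k * a)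
    (i : ι) (m : ℤ) : a * phi X h Kinv i m = phi X h Kinv i m * a := by
  unfold phi cartanModes
  split_ifs
  · have := (isSchur_schur (R := R) fun l : ℕ => -(X.κ i : R) • h i (-l)).graded
      (torsionFree_of_module R E) a (1 : R) (fun l => by simp [hh]) (-m).toNat
    rw [← mul_assoc, ha, mul_assoc, this, one_pow, one_smul, mul_assoc]
  · simp

lemma psi_graded {a : E} {u : Rˣ} (ha : ∀ i, a * K i = K i * a)
    (hh : ∀ i k, a * h i k = ((u ^ k : Rˣ) : R) • (h i k * a)) (i : ι)
    (m : ℤ) : a * psi X h K i m = ((u ^ m : Rˣ) : R) • (psi X h K i m * a) := by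
  unfold psi cartanModes
  split_ifs with hm
  · have := (isSchur_schur (R := R) fun l : ℕ => (X.κ i : R) • h i l).graded
      (torsionFree_of_module R E) a (u : R) (fun l => by
        rw [mul_smul_comm, hh, smul_mul_assoc, smul_comm, Nat.cast_succ, val_zpow_natCast_add_one])
      m.toNat
    obtain ⟨m, rfl⟩ := Int.eq_ofNat_of_zero_le hm
    rw [Int.toNat_natCast] at *
    rw [← mul_assoc, ha, mul_assoc, this, mul_smul_comm, mul_assoc, zpow_natCast,
      Units.val_pow_eq_pow_val]
  · simp

lemma phi_graded {a : E} {u : Rˣ} (ha : ∀ i, a * Kinv i = Kinv i * a)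
    (hh : ∀ i k, a * h i k = ((u ^ k : Rˣ) : R) • (h i k * a)) (i : ι)
    (m : ℤ) : a * phi X h Kinv i m = ((u ^ m : Rˣ) : R) • (phi X h Kinv i m * a) := by
  unfold phi cartanModes
  split_ifs with hm
  · have := (isSchur_schur (R := R) fun l : ℕ => -(X.κ i : R) • h i (-l)).graded
      (torsionFree_of_module R E) a (↑u⁻¹ : R) (fun l => by
        rw [mul_smul_comm, hh, smul_mul_assoc, smul_comm, Nat.cast_succ,
          val_zpow_neg_natCast_add_one])
      (-m).toNat
    obtain ⟨m, rfl⟩ : ∃ a : ℕ, m = -(a : ℤ) := ⟨(-m).toNat, by omega⟩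
    rw [neg_neg, Int.toNat_natCast] at *
    rw [← mul_assoc, ha, mul_assoc, this, mul_smul_comm, mul_assoc, zpow_neg, ← inv_zpow,
      zpow_natCast, Units.val_pow_eq_pow_val]
  · simp

end QAff

namespace QAff

variable {ι R : Type*} [CommRing R] [Algebra ℚ R] (X : DrinfeldData ι R)
variable {E : Type*} [Ring E] [Algebra R E]

/-- The right hand side of the relation between positive and negative currents. -/
def bracket (h : ι → ℤ → E) (K Kinv : ι → E) (i : ι) (k l : ℤ) : E :=
  (↑(X.κ i)⁻¹ : R) • (((X.g ^ (k - l) : Rˣ) : R) • psi X h K i (k + l) -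
    ((X.g ^ (l - k) : Rˣ) : R) • phi X h Kinv i (k + l))

variable {X} {h : ι → ℤ → E} {K Kinv : ι → E} {P : ι → ι → Rˣ} {θ : Rˣ} {x : ι → ℤ → E}

lemma Exchange.oneSidedSum_right (H : Exchange X h K Kinv P X.g x) (i a b : ι) (k : ℤ) :
    OneSidedSum (P i a : R) (x a) (P i b : R) (x b) (fun l => bracket X h K Kinv i k l) := by
  have h1 := fun j => ((H.psi_shiftRel i j).smul (↑(X.κ i)⁻¹ : R)).quadRel k k
  have h2 := fun j => ((H.phi_shiftRel i j).smul (-(↑(X.κ i)⁻¹ : R))).quadRel k k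
  refine ⟨_, _, ?_, Or.inl ⟨-k, fun l hl => ?_⟩, Or.inr ⟨-k, fun l hl => ?_⟩,
    h1 a, h2 a, h1 b, h2 b⟩
  · funext l
    simp only [Pi.add_apply, bracket, smul_sub, neg_smul, smul_neg, inv_zpow', neg_sub]
    rw [sub_eq_add_neg, smul_comm, add_comm l k]
    congr 2
    rw [smul_comm]
  · beta_reduce
    rw [psi_neg _ _ _ _ (by omega), smul_zero, smul_zero]
  · beta_reduce
    rw [phi_pos _ _ _ _ (by omega), smul_zero, smul_zero]

lemma Exchange.oneSidedSum_left (H : Exchange X h K Kinv P X.g⁻¹ x) (i a b : ι) (l : ℤ) :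
    OneSidedSum (P i a : R) (x a) (P i b : R) (x b) (fun k => bracket X h K Kinv i k l) := by
  have h1 := fun j => ((H.psi_shiftRel i j).smul (↑(X.κ i)⁻¹ : R)).quadRel l l
  have h2 := fun j => ((H.phi_shiftRel i j).smul (-(↑(X.κ i)⁻¹ : R))).quadRel l l
  refine ⟨_, _, ?_, Or.inl ⟨-l, fun k hk => ?_⟩, Or.inr ⟨-l, fun k hk => ?_⟩,
    h1 a, h2 a, h1 b, h2 b⟩
  · funext k
    simp only [Pi.add_apply, bracket, smul_sub, neg_smul, smul_neg, inv_zpow', neg_sub, neg_neg]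
    rw [sub_eq_add_neg, smul_comm]
    congr 2
    rw [smul_comm]
  · beta_reduce
    rw [psi_neg _ _ _ _ (by omega), smul_zero, smul_zero]
  · beta_reduce
    rw [phi_pos _ _ _ _ (by omega), smul_zero, smul_zero]

lemma OneSidedSum.quadRel {c p : R} {x y Θ : ℤ → E} (h : OneSidedSum c x p y Θ) :
    QuadRel c Θ x := by
  obtain ⟨Θ₁, Θ₂, rfl, -, -, h1, h2, -, -⟩ := h
  exact h1.add_left h2

lemma two_torsionFree (R : Type*) [CommRing R] [Algebra ℚ R] (M : Type*) [AddCommGroup M]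
    [Module R M] (x : M) (hx : x + x = 0) : x = 0 :=
  torsionFree_of_module R M 1 x (by rw [add_smul, one_smul, hx])

open TrivSqZeroExt in
lemma IsNegative.dual {f Θ : ι → ℤ → E} (hf : IsNegative X f)
    (hΘ : ∀ a b c, OneSidedSum (↑(X.p a b)⁻¹ : R) (f b) (↑(X.p a c)⁻¹ : R) (f c) (Θ a)) :
    IsNegative X fun i l => (inl (f i l) + inr (Θ i l) : DualNumber E) := by
  constructor
  · intro i j
    apply QuadRel.dual
    · simpa using hf.1 i j
    · simpa using (hΘ i j j).quadRel
    · simpa [X.p_comm i j] using (hΘ j i i).quadRel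
  · intro i j hij k l
    have e1 : (↑(X.p i i)⁻¹ : R) = (↑(X.Q i)⁻¹ : R) ^ 2 := by
      rw [X.p_self, ← inv_pow, Units.val_pow_eq_pow_val]
    have e2 : (↑(X.p i j)⁻¹ : R) = (↑(X.Q i) : R) ^ X.m i j := by
      rw [X.p_ne i j hij, ← inv_pow, inv_inv, Units.val_pow_eq_pow_val]
    have e3 : (↑(X.p j i)⁻¹ : R) = (↑(X.Q i) : R) ^ X.m i j := by rw [X.p_comm, e2]
    refine serreSum_dual (two_torsionFree R E) (X.serre_neg i j hij) ?_ ?_ ?_ 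
      (c := (↑(X.p j i)⁻¹ : R)) (z := f i) ?_ k l ?_
    · simpa [e1] using hf.1 i i
    · simpa [e2] using hf.1 i j
    · simpa [e1, e2] using hΘ i i j
    · simpa [e3] using hΘ j i i
    · simpa using hf.2 i j hij k l

lemma IsCartan.h_bracket (H : IsCartan X h K Kinv) (i j : ι) (k a b : ℤ) :
    h i k * bracket X h K Kinv j a b - bracket X h K Kinv j a b * h i k =
      hcoef X i (X.p i j) X.g⁻¹ k • bracket X h K Kinv j (a + k) b +
      hcoef X i (X.p i j)⁻¹ X.g k • bracket X h K Kinv j a (b + k) := by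
  have e1 := H.h_psi i j k (a + b)
  have e2 := H.h_phi i j k (a + b)
  have eκ : (X.κ j : R) * ↑(X.κ j)⁻¹ = 1 := Units.mul_inv _
  set c : R := ↑(X.κ i)⁻¹ * ratInv R k * (((X.p i j ^ k : Rˣ) : R) - ((X.p i j ^ (-k) : Rˣ) : R))
  have h1 : hcoef X i (X.p i j) X.g⁻¹ k = c * ((X.g ^ (-|k|) : Rˣ) : R) := by
    rw [hcoef, inv_zpow']
  have h2 : hcoef X i (X.p i j)⁻¹ X.g k = -(c * ((X.g ^ |k| : Rˣ) : R)) := by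
    simp only [hcoef, inv_zpow', neg_neg, c]; ring
  have h3 : (X.κ j : R) * heis X i j k =
      c * (((X.g ^ (2 * k) : Rˣ) : R) - ((X.g ^ (-(2 * k)) : Rˣ) : R)) := by
    simp only [heis, c]; linear_combination (norm := ring_nf) (↑(X.κ i)⁻¹ * ratInv R k *
      (((X.p i j ^ k : Rˣ) : R) - ((X.p i j ^ (-k) : Rˣ) : R)) *
      (((X.g ^ (2 * k) : Rˣ) : R) - ((X.g ^ (-(2 * k)) : Rˣ) : R))) * eκ
  rw [h1, h2]
  rw [h3] at e1 e2
  have key : h i k * bracket X h K Kinv j a b - bracket X h K Kinv j a b * h i k =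
      (↑(X.κ j)⁻¹ : R) • (((X.g ^ (a - b) : Rˣ) : R) • (h i k * psi X h K j (a + b) -
        psi X h K j (a + b) * h i k) - ((X.g ^ (b - a) : Rˣ) : R) • (h i k * phi X h Kinv j (a + b) -
        phi X h Kinv j (a + b) * h i k)) := by
    simp only [bracket, mul_smul_comm, smul_mul_assoc, mul_sub, sub_mul, smul_sub]
    abel
  have eg : ∀ s t : ℤ, ((X.g ^ (s + t) : Rˣ) : R) = ((X.g ^ s : Rˣ) : R) * ((X.g ^ t : Rˣ) : R) := by
    intro s t; rw [zpow_add, Units.val_mul]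
  have e0 : ∀ s : ℤ, ((X.g ^ s : Rˣ) : R) * ((X.g ^ (-s) : Rˣ) : R) = 1 := by
    intro s; rw [← eg]; simp
  rw [key, e1, e2]
  simp only [bracket, show a + k + b = a + b + k by ring, show a + (b + k) = a + b + k by ring]
  generalize psi X h K j (a + b + k) = u
  generalize phi X h Kinv j (a + b + k) = v
  have g1 := eg (a - b) k
  have g2 := eg (a - b) (-k)
  have g3 := eg (b - a) k
  have g4 := eg (b - a) (-k)
  have g5 := eg k k
  have g6 := eg (-k) (-k)
  have g7 := e0 k
  rw [show a + k - b = a - b + k by ring, show a - (b + k) = a - b + -k by ring,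
    show b + k - a = b - a + k by ring, show b - (a + k) = b - a + -k by ring]
  rw [show -(2 * k) = -k + -k by ring, show 2 * k = k + k by ring]
  rcases lt_trichotomy k 0 with hk | rfl | hk
  · rw [if_pos hk, if_neg (by omega), abs_of_neg hk, neg_neg]
    match_scalars <;> grind
  · simp
    try (match_scalars <;> ring)
  · rw [if_neg (by omega), if_pos hk, abs_of_pos hk]
    match_scalars <;> grind

end QAff

namespace QAff
open TensorProduct

variable {ι R : Type*} [CommRing R] [Algebra ℚ R] (X : DrinfeldData ι R)

/-- The annihilation operators on polynomials. -/
def fockDer (i : ι) (k : ℤ) :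
    Derivation R (MvPolynomial (ι × ℕ) R) (MvPolynomial (ι × ℕ) R) :=
  MvPolynomial.mkDerivation R fun a : ι × ℕ =>
    if (a.2 : ℤ) + 1 = k then MvPolynomial.C (heis X i a.1 k) else 0

lemma fockDer_X (i j : ι) (k : ℤ) (s : ℕ) : fockDer X i k (MvPolynomial.X (j, s)) =
    if (s : ℤ) + 1 = k then MvPolynomial.C (heis X i j k) else 0 :=
  MvPolynomial.mkDerivation_X _ _ _

/-- The Heisenberg operators on polynomials. -/
def fock (i : ι) (k : ℤ) : Module.End R (MvPolynomial (ι × ℕ) R) :=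
  if k < 0 then LinearMap.mulLeft R (MvPolynomial.X (i, (-k - 1).toNat))
  else (fockDer X i k).toLinearMap

lemma fock_of_neg (i : ι) (s : ℕ) :
    fock X i (-(s + 1 : ℤ)) = LinearMap.mulLeft R (MvPolynomial.X (i, s)) := by
  rw [fock, if_pos (by omega)]
  congr 3
  omega

lemma fock_of_nonneg (i : ι) {k : ℤ} (hk : 0 ≤ k) :
    fock X i k = (fockDer X i k).toLinearMap := by
  rw [fock, if_neg (by omega)]

lemma heis_zero (i j : ι) : heis X i j 0 = 0 := by simp [heis]

lemma fock_zero (i : ι) : fock X i 0 = 0 := by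
  have : fockDer X i 0 = 0 := by
    apply MvPolynomial.derivation_ext
    rintro ⟨j, s⟩
    rw [fockDer_X, if_neg (by omega)]
    rfl
  rw [fock_of_nonneg X i le_rfl, this]
  rfl

lemma fock_comm_pos_neg (i j : ι) {k : ℤ} (hk : 0 ≤ k) (s : ℕ) :
    fock X i k * fock X j (-(s + 1 : ℤ)) - fock X j (-(s + 1 : ℤ)) * fock X i k =
      if (s : ℤ) + 1 = k then heis X i j k • 1 else 0 := by
  apply LinearMap.ext; intro c
  rw [fock_of_neg, fock_of_nonneg X i hk]
  change fockDer X i k (MvPolynomial.X (j, s) * c) - MvPolynomial.X (j, s) * fockDer X i k c = _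
  rw [Derivation.leibniz, smul_eq_mul, smul_eq_mul, add_sub_cancel_left, fockDer_X]
  split_ifs
  · simp only [LinearMap.smul_apply, Module.End.one_apply, MvPolynomial.smul_eq_C_mul, mul_comm]
  · simp

lemma fock_comm (i j : ι) (k l : ℤ) : fock X i k * fock X j l - fock X j l * fock X i k =
    if l = -k then heis X i j k • 1 else 0 := by
  rcases lt_or_ge k 0 with hk | hk <;> rcases lt_or_ge l 0 with hl | hl
  · obtain ⟨s, rfl⟩ : ∃ s : ℕ, k = -(s + 1 : ℤ) := ⟨(-k - 1).toNat, by omega⟩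
    obtain ⟨t, rfl⟩ : ∃ s : ℕ, l = -(s + 1 : ℤ) := ⟨(-l - 1).toNat, by omega⟩
    rw [fock_of_neg, fock_of_neg, if_neg (by omega), sub_eq_zero]
    apply LinearMap.ext; intro c
    simp [mul_left_comm]
  · obtain ⟨s, rfl⟩ : ∃ s : ℕ, k = -(s + 1 : ℤ) := ⟨(-k - 1).toNat, by omega⟩
    rw [← neg_sub, fock_comm_pos_neg X j i hl]
    split_ifs with h1 h2 h2
    · rw [h1, heis_neg]
      exact (neg_smul _ _).symm
    · omega
    · omega
    · simp
  · obtain ⟨t, rfl⟩ : ∃ s : ℕ, l = -(s + 1 : ℤ) := ⟨(-l - 1).toNat, by omega⟩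
    rw [fock_comm_pos_neg X i j hk]
    exact if_congr (by omega) rfl rfl
  · have h0 : (if l = -k then heis X i j k • 1 else 0 : Module.End R (MvPolynomial (ι × ℕ) R)) = 0 := by
      split_ifs with h
      · rw [show k = 0 by omega, heis_zero, zero_smul]
      · rfl
    rw [h0, fock_of_nonneg X i hk, fock_of_nonneg X j hl, sub_eq_zero]
    have : ⁅fockDer X i k, fockDer X j l⁆ = 0 := by
      apply MvPolynomial.derivation_ext
      rintro ⟨a, s⟩
      rw [Derivation.commutator_apply, fockDer_X, fockDer_X]
      split_ifs <;> simp
    apply LinearMap.ext; intro c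
    have h2 := DFunLike.congr_fun this c
    rw [Derivation.commutator_apply] at h2
    exact sub_eq_zero.1 h2

/-- The degree operator on polynomials. -/
def fockScale (u : Rˣ) : MvPolynomial (ι × ℕ) R →ₐ[R] MvPolynomial (ι × ℕ) R :=
  MvPolynomial.aeval fun a => ((u ^ (-(a.2 + 1 : ℤ)) : Rˣ) : R) • MvPolynomial.X a

lemma fockScale_X (u : Rˣ) (i : ι) (s : ℕ) : fockScale u (MvPolynomial.X (R := R) (i, s)) =
    ((u ^ (-(s + 1 : ℤ)) : Rˣ) : R) • MvPolynomial.X (i, s) := by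
  rw [fockScale, MvPolynomial.aeval_X]

lemma fockScale_inv (u v : Rˣ) (h : u * v = 1) (c : MvPolynomial (ι × ℕ) R) :
    fockScale u (fockScale v c) = c := by
  have : (fockScale u).comp (fockScale v) = AlgHom.id R (MvPolynomial (ι × ℕ) R) := by
    apply MvPolynomial.algHom_ext
    rintro ⟨i, s⟩
    rw [AlgHom.comp_apply, fockScale_X, map_smul, fockScale_X, smul_smul, ← Units.val_mul,
      ← mul_zpow, mul_comm v, h, one_zpow, Units.val_one, one_smul, AlgHom.id_apply]
  exact DFunLike.congr_fun this c

lemma fockScale_fock (u : Rˣ) (i : ι) (k : ℤ) (c : MvPolynomial (ι × ℕ) R) :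
    fockScale u (fock X i k c) = ((u ^ k : Rˣ) : R) • fock X i k (fockScale u c) := by
  rcases lt_or_ge k 0 with hk | hk
  · obtain ⟨s, rfl⟩ : ∃ s : ℕ, k = -(s + 1 : ℤ) := ⟨(-k - 1).toNat, by omega⟩
    rw [fock_of_neg, LinearMap.mulLeft_apply, map_mul, fockScale_X, LinearMap.mulLeft_apply,
      smul_mul_assoc]
  · rw [fock_of_nonneg X i hk]
    change fockScale u (fockDer X i k c) = ((u ^ k : Rˣ) : R) • fockDer X i k (fockScale u c)
    induction c using MvPolynomial.induction_on with
    | C a => 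
      have : fockScale u (MvPolynomial.C (σ := ι × ℕ) a) = MvPolynomial.C a := by
        rw [← MvPolynomial.algebraMap_eq, AlgHom.commutes]
      simp [this]
    | add p q hp hq => rw [map_add, map_add, hp, hq, map_add, map_add, smul_add]
    | mul_X p a hp =>
      obtain ⟨j, s⟩ := a
      have h1 : fockScale u (fockDer X i k (MvPolynomial.X (j, s))) =
          ((u ^ k : Rˣ) : R) • fockDer X i k (fockScale u (MvPolynomial.X (j, s))) := by
        rw [fockScale_X, Derivation.map_smul, smul_smul, fockDer_X]
        split_ifs with hs
        · rw [← Units.val_mul, ← zpow_add, hs, add_neg_cancel, zpow_zero, Units.val_one, one_smul,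
            ← MvPolynomial.algebraMap_eq, AlgHom.commutes]
        · simp
      rw [Derivation.leibniz, map_add, smul_eq_mul, smul_eq_mul, map_mul, map_mul, h1, hp,
        map_mul, Derivation.leibniz, smul_add, smul_eq_mul, smul_eq_mul, mul_smul_comm,
        mul_smul_comm]

end QAff

namespace QAff
open TensorProduct

section
variable {R : Type*} [CommRing R] (A B : Type*) [AddCommGroup A] [Module R A] [AddCommGroup B]
  [Module R B]

/-- Operators acting on the left tensor factor. -/
def actL : Module.End R A →ₐ[R] Module.End R (A ⊗[R] B) := Module.End.rTensorAlgHom R A B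

/-- Operators acting on the right tensor factor. -/
def actR : Module.End R B →ₐ[R] Module.End R (A ⊗[R] B) := Module.End.lTensorAlgHom R B A

variable {A B}

end

variable {ι R : Type*} [CommRing R] {X : DrinfeldData ι R}

lemma negShift_comm (a b : ι → R) (s t : ℤ) (n : Neg X) :
    negShift a s (negShift b t n) = negShift b t (negShift a s n) := by
  induction n using neg_induction with
  | hx i l =>
    rw [negShift_negX, map_smul, negShift_negX, negShift_negX, map_smul, negShift_negX, smul_smul,
      smul_smul, mul_comm, add_right_comm]
  | h1 r => simp only [negShift_algebraMap, map_zero]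
  | ha x y hx hy => simp only [map_add, hx, hy]
  | hm x y hx hy => simp only [negShift_mul, map_add, hx, hy]; abel

lemma negScale_negShift (u a : ι → R) (v : Rˣ) (s : ℤ) (n : Neg X) :
    negScale u v (negShift a s n) = ((v ^ s : Rˣ) : R) • negShift a s (negScale u v n) := by
  induction n using neg_induction with
  | hx i l =>
    simp only [negShift_negX, negScale_negX, map_smul, smul_smul]
    rw [zpow_add, Units.val_mul]
    congr 1
    ring
  | h1 r => simp only [negShift_algebraMap, map_zero, AlgHom.commutes, smul_zero]
  | ha x y hx hy => simp only [map_add, hx, hy, smul_add]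
  | hm x y hx hy =>
    simp only [negShift_mul, map_add, map_mul, hx, hy, smul_add, mul_smul_comm, smul_mul_assoc]

lemma negScale_comp (u u' : ι → R) (v v' : Rˣ) (n : Neg X) :
    negScale u v (negScale u' v' n) = negScale (fun i => u i * u' i) (v * v') n := by
  have : (negScale u v).comp (negScale u' v') =
      negScale (X := X) (fun i => u i * u' i) (v * v') := by
    apply neg_algHom_ext
    intro i l
    rw [AlgHom.comp_apply, negScale_negX, map_smul, negScale_negX, negScale_negX, smul_smul,
      mul_zpow, Units.val_mul]
    congr 1
    ring
  exact DFunLike.congr_fun this n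

lemma negScale_one (n : Neg X) : negScale (fun _ => 1) 1 n = n := by
  have : negScale (X := X) (fun _ => (1 : R)) 1 = AlgHom.id R _ := by
    apply neg_algHom_ext
    intro i l
    simp [negScale_negX]
  exact DFunLike.congr_fun this n

variable [Algebra ℚ R] (X)

/-- The underlying module of the vacuum representation. -/
abbrev Vac : Type _ := Neg X ⊗[R] MvPolynomial (ι × ℕ) R

instance : AddCommGroup (Vac X) := TensorProduct.addCommGroup

/-- The action of the negative part. -/
def vacL : Neg X →ₐ[R] Module.End R (Vac X) := (actL _ _).comp (Algebra.lmul R (Neg X))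

/-- The action of `x⁻_{i,l}`. -/
def vacXm (i : ι) (l : ℤ) : Module.End R (Vac X) := vacL X (negX X i l)

/-- The action of `h_{i,k}`. -/
def vacH (i : ι) (k : ℤ) : Module.End R (Vac X) :=
  actL _ _ (negShift (fun j => hcoef X i (X.p i j)⁻¹ X.g k) k) + actR _ _ (fock X i k)

/-- The action of `K_i`. -/
def vacK (i : ι) : Module.End R (Vac X) :=
  actL _ _ (negScale (X := X) (fun j => (↑(X.p i j)⁻¹ : R)) 1).toLinearMap

/-- The action of `K_i⁻¹`. -/
def vacKinv (i : ι) : Module.End R (Vac X) :=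
  actL _ _ (negScale (X := X) (fun j => (↑(X.p i j) : R)) 1).toLinearMap

/-- The action of the degree operator. -/
def vacD (u : Rˣ) : Module.End R (Vac X) :=
  actL _ _ (negScale (X := X) (fun _ => 1) u).toLinearMap * actR _ _ (fockScale u).toLinearMap

lemma vacL_tmul (m n : Neg X) (c : MvPolynomial (ι × ℕ) R) :
    vacL X m (n ⊗ₜ c) = (m * n) ⊗ₜ c := rfl

lemma vacXm_tmul (i : ι) (l : ℤ) (n : Neg X) (c : MvPolynomial (ι × ℕ) R) :
    vacXm X i l (n ⊗ₜ c) = (negX X i l * n) ⊗ₜ c := rfl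

lemma vacH_tmul (i : ι) (k : ℤ) (n : Neg X) (c : MvPolynomial (ι × ℕ) R) :
    vacH X i k (n ⊗ₜ c) =
      negShift (fun j => hcoef X i (X.p i j)⁻¹ X.g k) k n ⊗ₜ c + n ⊗ₜ fock X i k c := rfl

lemma vacK_tmul (i : ι) (n : Neg X) (c : MvPolynomial (ι × ℕ) R) :
    vacK X i (n ⊗ₜ c) = negScale (fun j => (↑(X.p i j)⁻¹ : R)) 1 n ⊗ₜ c := rfl

lemma vacKinv_tmul (i : ι) (n : Neg X) (c : MvPolynomial (ι × ℕ) R) :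
    vacKinv X i (n ⊗ₜ c) = negScale (fun j => (↑(X.p i j) : R)) 1 n ⊗ₜ c := rfl

lemma vacD_tmul (u : Rˣ) (n : Neg X) (c : MvPolynomial (ι × ℕ) R) :
    vacD X u (n ⊗ₜ c) = negScale (fun _ => 1) u n ⊗ₜ fockScale u c := rfl

lemma negShift_one (a : ι → R) (s : ℤ) : negShift (X := X) a s 1 = 0 := by
  simpa using negShift_algebraMap (X := X) a s 1

lemma isNegative_vacXm : IsNegative X (vacXm X) := by
  constructor
  · intro i j
    exact ((isNegative_negX X).1 i j).map (vacL X)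
  · intro i j hij k l
    have := congrArg (vacL X) ((isNegative_negX X).2 i j hij k l)
    rwa [map_serreSum, map_zero] at this

lemma isCartan_vac : IsCartan X (vacH X) (vacK X) (vacKinv X) where
  K_Kinv i := TensorProduct.ext' fun n c => by
    change vacK X i (vacKinv X i (n ⊗ₜ c)) = n ⊗ₜ c
    simp only [vacK_tmul, vacKinv_tmul, negScale_comp, Units.inv_mul, mul_one, negScale_one]
  Kinv_K i := TensorProduct.ext' fun n c => by
    change vacKinv X i (vacK X i (n ⊗ₜ c)) = n ⊗ₜ c
    simp only [vacK_tmul, vacKinv_tmul, negScale_comp, Units.mul_inv, mul_one, negScale_one]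
  K_K i j := TensorProduct.ext' fun n c => by
    change vacK X i (vacK X j (n ⊗ₜ c)) = vacK X j (vacK X i (n ⊗ₜ c))
    simp only [vacK_tmul, negScale_comp, mul_comm]
  K_h i j k := TensorProduct.ext' fun n c => by
    change vacK X i (vacH X j k (n ⊗ₜ c)) = vacH X j k (vacK X i (n ⊗ₜ c))
    rw [vacH_tmul, map_add, vacK_tmul, vacK_tmul, vacK_tmul, vacH_tmul, negScale_negShift,
      one_zpow, Units.val_one, one_smul]
  h_h i j k l := TensorProduct.ext' fun n c => by
    have e1 := LinearMap.congr_fun (fock_comm X i j k l) c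
    have e2 : vacH X i k (vacH X j l (n ⊗ₜ c)) - vacH X j l (vacH X i k (n ⊗ₜ c)) =
        n ⊗ₜ ((fock X i k * fock X j l - fock X j l * fock X i k) c) := by
      rw [vacH_tmul, vacH_tmul, map_add, map_add, vacH_tmul, vacH_tmul, vacH_tmul, vacH_tmul,
        negShift_comm, LinearMap.sub_apply, TensorProduct.tmul_sub]
      change _ = n ⊗ₜ[R] (fock X i k (fock X j l c)) - n ⊗ₜ[R] (fock X j l (fock X i k c))
      abel
    change vacH X i k (vacH X j l (n ⊗ₜ c)) - vacH X j l (vacH X i k (n ⊗ₜ c)) = _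
    rw [e2, fock_comm]
    split_ifs
    · rw [LinearMap.smul_apply, LinearMap.smul_apply, TensorProduct.tmul_smul]; rfl
    · simp

lemma exchange_vacXm :
    Exchange X (vacH X) (vacK X) (vacKinv X) (fun i j => (X.p i j)⁻¹) X.g (vacXm X) where
  K_x i j l := TensorProduct.ext' fun n c => by
    change vacK X i (vacXm X j l (n ⊗ₜ c)) = (_ : R) • (vacXm X j l (vacK X i (n ⊗ₜ c)))
    rw [vacXm_tmul, vacK_tmul, vacK_tmul, vacXm_tmul, map_mul, negScale_negX, one_zpow,
      Units.val_one, mul_one, smul_mul_assoc, TensorProduct.smul_tmul']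
  Kinv_x i j l := TensorProduct.ext' fun n c => by
    change vacKinv X i (vacXm X j l (n ⊗ₜ c)) = (_ : R) • (vacXm X j l (vacKinv X i (n ⊗ₜ c)))
    rw [vacXm_tmul, vacKinv_tmul, vacKinv_tmul, vacXm_tmul, map_mul, negScale_negX, one_zpow,
      Units.val_one, mul_one, smul_mul_assoc, TensorProduct.smul_tmul', inv_inv]
  h_x i j k l := TensorProduct.ext' fun n c => by
    change vacH X i k (vacXm X j l (n ⊗ₜ c)) - vacXm X j l (vacH X i k (n ⊗ₜ c)) =
      (_ : R) • (vacXm X j (l + k) (n ⊗ₜ c))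
    rw [vacXm_tmul, vacH_tmul, vacH_tmul, map_add, vacXm_tmul, vacXm_tmul, vacXm_tmul, negShift_mul,
      negShift_negX, TensorProduct.add_tmul, smul_mul_assoc, TensorProduct.smul_tmul']
    abel

lemma vacH_zero (i : ι) : vacH X i 0 = 0 := TensorProduct.ext' fun n c => by
  have h0 : ∀ n : Neg X, negShift (fun j => hcoef X i (X.p i j)⁻¹ X.g 0) 0 n = 0 := by
    intro n
    induction n using neg_induction with
    | hx i l => simp [negShift_negX, hcoef]
    | h1 r => rw [negShift_algebraMap]
    | ha x y hx hy => rw [map_add, hx, hy, add_zero]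
    | hm x y hx hy => rw [negShift_mul, hx, hy, mul_zero, zero_mul, add_zero]
  rw [vacH_tmul, fock_zero, h0]
  simp

lemma vacD_vacD {u v : Rˣ} (h : u * v = 1) : vacD X u * vacD X v = 1 :=
  TensorProduct.ext' fun n c => by
    change vacD X u (vacD X v (n ⊗ₜ c)) = n ⊗ₜ c
    rw [vacD_tmul, vacD_tmul, negScale_comp, fockScale_inv u v h, h]
    simp only [mul_one, negScale_one]

lemma vacD_vacK (u : Rˣ) (i : ι) : vacD X u * vacK X i = vacK X i * vacD X u :=
  TensorProduct.ext' fun n c => by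
    change vacD X u (vacK X i (n ⊗ₜ c)) = vacK X i (vacD X u (n ⊗ₜ c))
    rw [vacD_tmul, vacK_tmul, vacD_tmul, vacK_tmul, negScale_comp, negScale_comp]
    simp only [mul_one, one_mul]

lemma vacD_vacKinv (u : Rˣ) (i : ι) : vacD X u * vacKinv X i = vacKinv X i * vacD X u :=
  TensorProduct.ext' fun n c => by
    change vacD X u (vacKinv X i (n ⊗ₜ c)) = vacKinv X i (vacD X u (n ⊗ₜ c))
    rw [vacD_tmul, vacKinv_tmul, vacD_tmul, vacKinv_tmul, negScale_comp, negScale_comp]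
    simp only [mul_one, one_mul]

lemma vacD_vacH (u : Rˣ) (i : ι) (k : ℤ) :
    vacD X u * vacH X i k = ((u ^ k : Rˣ) : R) • (vacH X i k * vacD X u) :=
  TensorProduct.ext' fun n c => by
    change vacD X u (vacH X i k (n ⊗ₜ c)) = (_ : R) • (vacH X i k (vacD X u (n ⊗ₜ c)))
    rw [vacD_tmul, vacH_tmul, vacH_tmul, map_add, vacD_tmul, vacD_tmul, negScale_negShift,
      fockScale_fock, smul_add, TensorProduct.smul_tmul', TensorProduct.tmul_smul]

lemma vacD_vacXm (u : Rˣ) (i : ι) (l : ℤ) :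
    vacD X u * vacXm X i l = ((u ^ l : Rˣ) : R) • (vacXm X i l * vacD X u) :=
  TensorProduct.ext' fun n c => by
    change vacD X u (vacXm X i l (n ⊗ₜ c)) = (_ : R) • (vacXm X i l (vacD X u (n ⊗ₜ c)))
    rw [vacD_tmul, vacXm_tmul, vacXm_tmul, vacD_tmul, map_mul, negScale_negX, one_mul,
      smul_mul_assoc, TensorProduct.smul_tmul']

end QAff

namespace QAff
open TensorProduct TrivSqZeroExt

section Derivation
variable {R E : Type*} [CommRing R] [Ring E] [Algebra R E]

/-- The commutator with `T`, as a homomorphism to the dual numbers. -/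
def adDual (T : E) : E →ₐ[R] DualNumber E :=
  AlgHom.ofLinearMap
    { toFun := fun u => inl u + inr (u * T - T * u)
      map_add' := fun u v => by ext <;> simp [add_mul, mul_add]; abel
      map_smul' := fun r u => by ext <;> simp [smul_sub] }
    (by ext <;> simp)
    (fun u v => by
      ext
      · simp
      · simp only [LinearMap.coe_mk, AddHom.coe_mk, DualNumber.snd_mul, fst_add, fst_inl, fst_inr,
          snd_add, snd_inl, snd_inr, add_zero, zero_add]
        noncomm_ring)

lemma adDual_apply (T u : E) : adDual (R := R) T u = inl u + inr (u * T - T * u) := rfl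

end Derivation

variable {ι R : Type*} [CommRing R] [Algebra ℚ R] (X : DrinfeldData ι R)

lemma isNegative_dual [DecidableEq ι] (i : ι) (k : ℤ) :
    IsNegative X fun j l => (inl (vacXm X j l) +
      inr (if i = j then bracket X (vacH X) (vacK X) (vacKinv X) i k l else 0) :
      DualNumber (Module.End R (Vac X))) := by
  apply (isNegative_vacXm X).dual
  intro a b c
  by_cases h : i = a
  · subst h
    simpa using (exchange_vacXm X).oneSidedSum_right i b c k
  · simp only [h, if_false]
    exact OneSidedSum.zero _ _ _ _

variable [DecidableEq ι]

/-- The action of `x⁺_{i,k}`. -/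
def vacXp (i : ι) (k : ℤ) : Module.End R (Vac X) :=
  TensorProduct.lift ((LinearMap.lcomp R (Vac X) (TensorProduct.mk R (Neg X) _ 1)).comp
    (sndPart (negLift _ (isNegative_dual X i k))))

lemma vacXp_tmul (i : ι) (k : ℤ) (n : Neg X) (c : MvPolynomial (ι × ℕ) R) :
    vacXp X i k (n ⊗ₜ c) = (negLift _ (isNegative_dual X i k) n).snd (1 ⊗ₜ c) := rfl

lemma vacXp_vacXm (i j : ι) (k l : ℤ) : vacXp X i k * vacXm X j l - vacXm X j l * vacXp X i k =
    if i = j then bracket X (vacH X) (vacK X) (vacKinv X) i k l else 0 := by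
  have h : (TrivSqZeroExt.fstHom R _ _).comp (negLift _ (isNegative_dual X i k)) = vacL X := by
    apply neg_algHom_ext
    intro a b
    rw [AlgHom.comp_apply, negLift_negX, TrivSqZeroExt.fstHom_apply, fst_add, fst_inl, fst_inr,
      add_zero]
    rfl
  rw [sub_eq_iff_eq_add]
  refine TensorProduct.ext' fun n c => ?_
  have h' : (negLift _ (isNegative_dual X i k) n).fst (1 ⊗ₜ c) = n ⊗ₜ c := by
    have := LinearMap.congr_fun (DFunLike.congr_fun h n) (1 ⊗ₜ c)
    rw [vacL_tmul, mul_one] at this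
    exact this
  change vacXp X i k (vacXm X j l (n ⊗ₜ c)) = _ + vacXm X j l (vacXp X i k (n ⊗ₜ c))
  rw [vacXm_tmul, vacXp_tmul, vacXp_tmul, map_mul, DualNumber.snd_mul, negLift_negX]
  simp only [fst_add, fst_inl, fst_inr, snd_add, snd_inl, snd_inr, add_zero, zero_add]
  rw [LinearMap.add_apply, Module.End.mul_apply, Module.End.mul_apply, h', add_comm]

lemma vacXp_one_tmul (i : ι) (k : ℤ) (c : MvPolynomial (ι × ℕ) R) : vacXp X i k (1 ⊗ₜ c) = 0 := by
  rw [vacXp_tmul, map_one, snd_one, LinearMap.zero_apply]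

variable {X}

omit [DecidableEq ι] in
lemma vac_eq_zero {W : Module.End R (Vac X)}
    (h1 : ∀ c, W (1 ⊗ₜ c) = 0) (h : ∀ j l, ∃ r : R, W * vacXm X j l = r • (vacXm X j l * W)) :
    W = 0 := by
  have key : ∀ n : Neg X, ∀ v, W v = 0 → W (vacL X n v) = 0 := by
    intro n
    induction n using neg_induction with
    | hx i l =>
      intro v hv
      obtain ⟨r, hr⟩ := h i l
      have := LinearMap.congr_fun hr v
      change W (vacXm X i l v) = r • vacXm X i l (W v) at this
      rw [hv, map_zero, smul_zero] at this
      exact this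
    | h1 r =>
      intro v hv
      rw [AlgHom.commutes, Module.algebraMap_end_apply, map_smul, hv, smul_zero]
    | ha x y hx hy => intro v hv; rw [map_add, LinearMap.add_apply, map_add, hx v hv, hy v hv, add_zero]
    | hm x y hx hy => intro v hv; rw [map_mul, Module.End.mul_apply]; exact hx _ (hy v hv)
  refine TensorProduct.ext' fun n c => ?_
  have := key n _ (h1 c)
  rwa [vacL_tmul, mul_one] at this

omit [DecidableEq ι] in
lemma vac_eq_zero_of_comm {W : Module.End R (Vac X)}
    (h1 : ∀ c, W (1 ⊗ₜ c) = 0) (h : ∀ j l, W * vacXm X j l - vacXm X j l * W = 0) : W = 0 :=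
  vac_eq_zero h1 fun j l => ⟨1, by rw [one_smul]; exact sub_eq_zero.1 (h j l)⟩

omit [DecidableEq ι] in
lemma vacH_one_tmul (i : ι) (k : ℤ) (c : MvPolynomial (ι × ℕ) R) :
    vacH X i k (1 ⊗ₜ c) = 1 ⊗ₜ fock X i k c := by
  rw [vacH_tmul, negShift_one, TensorProduct.zero_tmul, zero_add]

omit [DecidableEq ι] in
lemma vacK_one_tmul (i : ι) (c : MvPolynomial (ι × ℕ) R) : vacK X i (1 ⊗ₜ c) = 1 ⊗ₜ c := by
  rw [vacK_tmul, map_one]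

omit [DecidableEq ι] in
lemma vacKinv_one_tmul (i : ι) (c : MvPolynomial (ι × ℕ) R) : vacKinv X i (1 ⊗ₜ c) = 1 ⊗ₜ c := by
  rw [vacKinv_tmul, map_one]

omit [DecidableEq ι] in
lemma vacD_one_tmul (u : Rˣ) (c : MvPolynomial (ι × ℕ) R) :
    vacD X u (1 ⊗ₜ c) = 1 ⊗ₜ fockScale u c := by
  rw [vacD_tmul, map_one]

variable (X)

section
variable {ι R : Type*} [CommRing R] [Algebra ℚ R] {X : DrinfeldData ι R}
variable {E : Type*} [Ring E] [Algebra R E] {h : ι → ℤ → E} {K Kinv : ι → E}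

lemma IsCartan.K_Kinv_comm (H : IsCartan X h K Kinv) (i j : ι) : K i * Kinv j = Kinv j * K i := by
  calc K i * Kinv j = Kinv j * (K j * K i) * Kinv j := by
        rw [← mul_assoc, H.Kinv_K, one_mul]
    _ = Kinv j * K i := by rw [← H.K_K, mul_assoc, mul_assoc, H.K_Kinv, mul_one]

lemma IsCartan.Kinv_h (H : IsCartan X h K Kinv) (i j : ι) (k : ℤ) :
    Kinv i * h j k = h j k * Kinv i := by
  calc Kinv i * h j k = Kinv i * (h j k * K i) * Kinv i := by
        rw [mul_assoc, mul_assoc, H.K_Kinv, mul_one]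
    _ = h j k * Kinv i := by rw [← H.K_h, ← mul_assoc, H.Kinv_K, one_mul]

lemma IsCartan.Kinv_Kinv (H : IsCartan X h K Kinv) (i j : ι) :
    Kinv i * Kinv j = Kinv j * Kinv i := by
  calc Kinv i * Kinv j = Kinv i * (Kinv j * K i) * Kinv i := by
        rw [mul_assoc, mul_assoc, H.K_Kinv, mul_one]
    _ = Kinv j * Kinv i := by rw [← H.K_Kinv_comm, ← mul_assoc, H.Kinv_K, one_mul]

lemma bracket_comm {a : E} (h1 : ∀ i, a * K i = K i * a) (h2 : ∀ i, a * Kinv i = Kinv i * a)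
    (h3 : ∀ i k, a * h i k = h i k * a) (i : ι) (k l : ℤ) :
    a * bracket X h K Kinv i k l = bracket X h K Kinv i k l * a := by
  simp only [bracket, mul_smul_comm, smul_mul_assoc, mul_sub, sub_mul, psi_comm h1 h3,
    phi_comm h2 h3]

lemma bracket_graded {a : E} {u : Rˣ} (h1 : ∀ i, a * K i = K i * a)
    (h2 : ∀ i, a * Kinv i = Kinv i * a)
    (h3 : ∀ i k, a * h i k = ((u ^ k : Rˣ) : R) • (h i k * a)) (i : ι) (k l : ℤ) :
    a * bracket X h K Kinv i k l = ((u ^ (k + l) : Rˣ) : R) • (bracket X h K Kinv i k l * a) := by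
  simp only [bracket, mul_smul_comm, smul_mul_assoc, mul_sub, sub_mul, psi_graded h1 h3,
    phi_graded h2 h3, smul_sub, smul_comm ((u ^ (k + l) : Rˣ) : R)]

end

lemma exchange_vacXp :
    Exchange X (vacH X) (vacK X) (vacKinv X) X.p X.g⁻¹ (vacXp X) where
  K_x i j l := by
    rw [← sub_eq_zero]
    refine vac_eq_zero (fun c => ?_) fun a m => ⟨(↑(X.p i a)⁻¹ : R), ?_⟩
    · change vacK X i (vacXp X j l (1 ⊗ₜ c)) - (_ : R) • vacXp X j l (vacK X i (1 ⊗ₜ c)) = 0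
      rw [vacK_one_tmul, vacXp_one_tmul, map_zero, smul_zero, sub_zero]
    · have e1 := vacXp_vacXm X j a l m
      have e2 := (exchange_vacXm X).K_x i a m
      have e3 := bracket_comm (X := X) (a := vacK X i) ((isCartan_vac X).K_K i)
        (fun b => (isCartan_vac X).K_Kinv_comm i b) ((isCartan_vac X).K_h i) j l m
      rw [sub_eq_iff_eq_add] at e1
      rw [sub_mul, mul_assoc, e1, smul_mul_assoc, mul_assoc, e2, mul_add, ← mul_assoc, e2,
        mul_smul_comm, ← mul_assoc, e1]
      split_ifs with hj
      · subst hj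
        rw [e3, smul_smul, Units.mul_inv, one_smul, add_mul, mul_sub, smul_sub, mul_smul_comm,
          smul_smul, Units.inv_mul, one_smul, smul_mul_assoc]
        simp only [mul_assoc]
        abel
      · simp only [mul_zero, zero_add, mul_sub, smul_sub, mul_smul_comm, smul_mul_assoc, mul_assoc]
        rw [smul_comm]
  Kinv_x i j l := by
    rw [← sub_eq_zero]
    refine vac_eq_zero (fun c => ?_) fun a m => ⟨(↑(X.p i a) : R), ?_⟩
    · change vacKinv X i (vacXp X j l (1 ⊗ₜ c)) - (_ : R) • vacXp X j l (vacKinv X i (1 ⊗ₜ c)) = 0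
      rw [vacKinv_one_tmul, vacXp_one_tmul, map_zero, smul_zero, sub_zero]
    · have e1 := vacXp_vacXm X j a l m
      have e2 := (exchange_vacXm X).Kinv_x i a m
      have e3 := bracket_comm (X := X) (a := vacKinv X i) 
        (fun b => ((isCartan_vac X).K_Kinv_comm b i).symm) 
        (fun b => (isCartan_vac X).Kinv_Kinv i b) ((isCartan_vac X).Kinv_h i) j l m
      rw [inv_inv] at e2
      rw [sub_eq_iff_eq_add] at e1
      rw [sub_mul, mul_assoc, e1, smul_mul_assoc, mul_assoc, e2, mul_add, ← mul_assoc, e2,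
        mul_smul_comm, ← mul_assoc, e1]
      split_ifs with hj
      · subst hj
        rw [e3, smul_smul, Units.inv_mul, one_smul, add_mul, mul_sub, smul_sub, mul_smul_comm,
          smul_smul, Units.mul_inv, one_smul, smul_mul_assoc]
        simp only [mul_assoc]
        abel
      · simp only [mul_zero, zero_add, mul_sub, smul_sub, mul_smul_comm, smul_mul_assoc, mul_assoc]
        rw [smul_comm]
  h_x i j k l := by
    rw [← sub_eq_zero]
    refine vac_eq_zero_of_comm (fun c => ?_) fun a m => ?_
    · change vacH X i k (vacXp X j l (1 ⊗ₜ c)) - vacXp X j l (vacH X i k (1 ⊗ₜ c)) -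
        (_ : R) • vacXp X j (l + k) (1 ⊗ₜ c) = 0
      rw [vacH_one_tmul, vacXp_one_tmul, vacXp_one_tmul, vacXp_one_tmul, map_zero, smul_zero,
        sub_zero, sub_zero]
    · have e1 := vacXp_vacXm X j a l m
      have e2 := vacXp_vacXm X j a l (m + k)
      have e3 := vacXp_vacXm X j a (l + k) m
      have e4 := (exchange_vacXm X).h_x i a k m
      have e5 := (isCartan_vac X).h_bracket i j k l m
      set c1 := hcoef X i (X.p i j) X.g⁻¹ k
      set c2 := hcoef X i (X.p i a)⁻¹ X.g k
      set H := vacH X i k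
      set T := vacXp X j l
      set Y := vacXm X a m
      have e0 : (H * T - T * H - c1 • vacXp X j (l + k)) * Y -
          Y * (H * T - T * H - c1 • vacXp X j (l + k)) =
          (H * (T * Y - Y * T) - (T * Y - Y * T) * H) - (T * (H * Y - Y * H) - (H * Y - Y * H) * T)
          - c1 • (vacXp X j (l + k) * Y - Y * vacXp X j (l + k)) := by
        simp only [mul_sub, sub_mul, smul_sub, mul_smul_comm, smul_mul_assoc, mul_assoc]
        abel
      rw [e0, e3, e1, e4, mul_smul_comm, smul_mul_assoc, ← smul_sub, e2]
      split_ifs with hj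
      · subst hj
        rw [e5]
        abel
      · simp

lemma vacD_vacXp (u : Rˣ) (i : ι) (k : ℤ) :
    vacD X u * vacXp X i k = ((u ^ k : Rˣ) : R) • (vacXp X i k * vacD X u) := by
  rw [← sub_eq_zero]
  refine vac_eq_zero (fun c => ?_) fun a m => ⟨((u ^ m : Rˣ) : R), ?_⟩
  · change vacD X u (vacXp X i k (1 ⊗ₜ c)) - (_ : R) • vacXp X i k (vacD X u (1 ⊗ₜ c)) = 0
    rw [vacD_one_tmul, vacXp_one_tmul, vacXp_one_tmul, map_zero, smul_zero, sub_zero]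
  · have e1 := vacXp_vacXm X i a k m
    have e2 := vacD_vacXm X u a m
    have e3 := bracket_graded (X := X) (a := vacD X u) (u := u) (vacD_vacK X u) (vacD_vacKinv X u)
      (vacD_vacH X u) i k m
    rw [sub_eq_iff_eq_add] at e1
    rw [sub_mul, mul_assoc, e1, smul_mul_assoc, mul_assoc, e2, mul_add, ← mul_assoc, e2,
      mul_smul_comm, ← mul_assoc, e1]
    split_ifs with hj
    · subst hj
      rw [e3, smul_smul, ← Units.val_mul, ← zpow_add, add_mul, mul_sub, smul_sub, smul_add,
        smul_mul_assoc, mul_smul_comm, smul_smul, ← Units.val_mul, ← zpow_add, add_comm m k]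
      simp only [mul_assoc]
      abel
    · simp only [mul_zero, zero_add, mul_sub, smul_sub, mul_smul_comm, smul_mul_assoc, mul_assoc]
      rw [smul_comm]

lemma quadRel_vacXp (i j : ι) : QuadRel (X.p i j : R) (vacXp X i) (vacXp X j) := by
  intro k l
  rw [← sub_eq_zero]
  refine vac_eq_zero_of_comm (fun c => ?_) fun a m => ?_
  · have h0 : ∀ i j k l, vacXp X i k (vacXp X j l (1 ⊗ₜ c)) = 0 := fun i j k l => by
      rw [vacXp_one_tmul, map_zero]
    change vacXp X i (k + 1) (vacXp X j l (1 ⊗ₜ c)) -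
      (_ : R) • vacXp X j l (vacXp X i (k + 1) (1 ⊗ₜ c)) -
      ((_ : R) • vacXp X i k (vacXp X j (l + 1) (1 ⊗ₜ c)) -
      vacXp X j (l + 1) (vacXp X i k (1 ⊗ₜ c))) = 0
    simp only [h0, smul_zero, sub_zero]
  · have e0 : ∀ (T T' U U' Y : Module.End R (Vac X)) (p : R),
        (T * U - p • (U * T) - (p • (T' * U') - U' * T')) * Y -
        Y * (T * U - p • (U * T) - (p • (T' * U') - U' * T')) =
        ((T * Y - Y * T) * U - p • (U * (T * Y - Y * T)) -
          (p • ((T' * Y - Y * T') * U') - U' * (T' * Y - Y * T'))) +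
        (T * (U * Y - Y * U) - p • ((U * Y - Y * U) * T) -
          (p • (T' * (U' * Y - Y * U')) - (U' * Y - Y * U') * T')) := by
      intro T T' U U' Y p
      simp only [mul_sub, sub_mul, smul_sub, mul_smul_comm, smul_mul_assoc, mul_assoc]
      abel
    rw [e0]
    simp only [vacXp_vacXm]
    have h1 := ((exchange_vacXp X).oneSidedSum_left i j j m).quadRel k l
    have h2 := ((exchange_vacXp X).oneSidedSum_left j i i m).quadRel.symm k l
    rw [X.p_comm j i] at h2
    split_ifs with hi hj hj
    · rw [h1, h2, sub_self, sub_self, add_zero]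
    · rw [h1]; simp
    · rw [h2]; simp
    · simp

lemma serreSum_vacXp (i j : ι) (hij : i ≠ j) (k : Fin (X.m i j + 1) → ℤ) (l : ℤ) :
    serreSum (X.β i j) (X.m i j + 1) (vacXp X i) (vacXp X j) k l = 0 := by
  refine vac_eq_zero_of_comm (fun c => ?_) fun a m => ?_
  · have h0 : ∀ (L : List (Fin (X.m i j + 1))) (f : Fin (X.m i j + 1) → ℤ)
        (y : Module.End R (Vac X)), y (1 ⊗ₜ c) = 0 →
        (y * (L.map fun t => vacXp X i (f t)).prod) (1 ⊗ₜ c) = 0 := by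
      intro L f
      induction L with
      | nil => intro y hy; simpa using hy
      | cons b L ih =>
        intro y hy
        rw [List.map_cons, List.prod_cons, Module.End.mul_apply, ih _ (vacXp_one_tmul X _ _ c),
          map_zero]
    simp only [serreSum, LinearMap.sum_apply, LinearMap.smul_apply]
    refine Finset.sum_eq_zero fun σ _ => Finset.sum_eq_zero fun r _ => ?_
    rw [h0 _ (fun t => k (σ t)), smul_zero]
    rw [Module.End.mul_apply, vacXp_one_tmul, map_zero]
  · set Y := vacXm X a m
    have e1 := map_serreSum (X.β i j) (X.m i j + 1) (vacXp X i) (vacXp X j) k l (adDual (R := R) Y)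
    have e2 := congrArg TrivSqZeroExt.snd e1
    rw [adDual_apply] at e2
    simp only [snd_add, snd_inl, snd_inr, zero_add] at e2
    rw [e2]
    have q1 : (X.p i i : R) = (X.Q i : R) ^ 2 := by
      rw [X.p_self, Units.val_pow_eq_pow_val]
    have q2 : (X.p i j : R) = (↑(X.Q i)⁻¹ : R) ^ X.m i j := by
      rw [X.p_ne i j hij, Units.val_pow_eq_pow_val]
    have q3 : (X.p j i : R) = (↑(X.Q i)⁻¹ : R) ^ X.m i j := by rw [X.p_comm, q2]
    have hB : ∀ b s t, OneSidedSum (X.p b s : R) (vacXp X s) (X.p b t : R) (vacXp X t)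
        (fun k => vacXp X b k * Y - Y * vacXp X b k) := by
      intro b s t
      by_cases hb : b = a
      · subst hb
        simpa only [Y, vacXp_vacXm, if_true] using (exchange_vacXp X).oneSidedSum_left b s t m
      · simp only [Y, vacXp_vacXm, hb, if_false]
        exact OneSidedSum.zero _ _ _ _
    refine snd_serreSum_eq_zero (two_torsionFree R _) (X.serre_pos i j hij) ?_ ?_ ?_
      (c := (X.p j i : R)) (z := vacXp X i) ?_ k l
    · simpa [adDual_apply, q1] using quadRel_vacXp X i i
    · simpa [adDual_apply, q2] using quadRel_vacXp X i j
    · simpa [adDual_apply, q1, q2] using hB i i j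
    · simpa [adDual_apply, q3] using hB j i i

end QAff

namespace QAff

section QuantumInteger

variable {F : Type*} [Field F]

lemma serreCoeffs_of_field {Q W : F} (hQ : ∀ n : ℕ, Q ^ (n + 1) - W ^ (n + 1) ≠ 0) (hQW : Q * W = 1)
    (m : ℕ) {f : ℕ → F} (h0 : f 0 = 1)
    (hf : ∀ n, f (n + 1) * (Q - W) = (Q ^ (n + 1) - W ^ (n + 1)) * f n) :
    SerreCoeffs Q W m (fun r => f (m + 1) / (f r * f (m + 1 - r))) := by
  have h1 : Q - W ≠ 0 := by simpa using hQ 0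
  have hQWn : ∀ n, Q ^ n * W ^ n = 1 := fun n => by rw [← mul_pow, hQW, one_pow]
  obtain ⟨u, hu⟩ : ∃ u : ℕ → F, ∀ n, u n * (Q - W) = Q ^ n - W ^ n :=
    ⟨fun n => (Q ^ n - W ^ n) / (Q - W), fun n => div_mul_cancel₀ _ h1⟩
  have hu0 : ∀ n, u (n + 1) ≠ 0 := fun n h => hQ n (by rw [← hu, h, zero_mul])
  have hfu : ∀ n, f (n + 1) = u (n + 1) * f n := fun n =>
    mul_right_cancel₀ h1 (by rw [hf, ← hu]; ring)
  have hf0 : ∀ n, f n ≠ 0 := by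
    intro n
    induction n with
    | zero => rw [h0]; exact one_ne_zero
    | succ n ih => rw [hfu]; exact mul_ne_zero (hu0 n) ih
  have hgeom : ∀ n : ℕ, ∑ k ∈ Finset.range (n + 1), (Q ^ 2) ^ k = Q ^ n * u (n + 1) := by
    intro n
    apply mul_right_cancel₀ h1
    induction n with
    | zero => simpa using (hu 1).symm
    | succ n ih =>
      rw [Finset.sum_range_succ, add_mul, ih, mul_assoc, mul_assoc, hu, hu]
      linear_combination (-(Q ^ n * Q ^ n * Q) + Q ^ n * W ^ n * W) * hQW
  have hu1 : ∀ r s : ℕ, u (r + s) = Q ^ r * u s + W ^ s * u r := fun r s => by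
    apply mul_right_cancel₀ h1
    rw [hu, add_mul, mul_assoc, mul_assoc, hu, hu]
    ring
  have hu2 : ∀ r s : ℕ, u (r + s) = W ^ r * u s + Q ^ s * u r := fun r s => by
    apply mul_right_cancel₀ h1
    rw [hu, add_mul, mul_assoc, mul_assoc, hu, hu]
    ring
  refine ⟨hQW, ⟨fun r => if r < m + 1 then Q ^ r * (f m / (f r * f (m - r))) else 0, ?_, ?_, ?_, ?_⟩,
    fun r => f (m + 1) / (f r * f (m - r)), ?_, ?_, ?_⟩
  · simp [h0, div_self (hf0 _)]
  · intro r hr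
    simp only [if_pos hr]
    rcases Nat.lt_succ_iff_lt_or_eq.1 hr with h | rfl
    · obtain ⟨s, rfl⟩ := Nat.exists_eq_add_of_lt h
      rw [if_pos (by omega), show r + s + 1 + 1 - (r + 1) = s + 1 by omega,
        show r + s + 1 - (r + 1) = s by omega, show r + s + 1 - r = s + 1 by omega, hfu (r + s + 1),
        hfu r, hfu s, show r + s + 1 + 1 = (r + 1) + (s + 1) by omega, hu1 (r + 1) (s + 1),
        show r + s + 1 = r + (s + 1) by omega, pow_add W]
      have := hu0 r
      have := hu0 s
      have := hf0 r
      have := hf0 s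
      have := hQWn r
      field_simp
      grind
    · have := hQWn r
      simp [h0, div_self (hf0 _)]
      grind
  · intro r hr
    simp only [if_pos hr]
    rcases Nat.lt_succ_iff_lt_or_eq.1 hr with h | rfl
    · obtain ⟨s, rfl⟩ := Nat.exists_eq_add_of_lt h
      rw [if_pos (by omega), show r + s + 1 + 1 - (r + 1) = s + 1 by omega,
        show r + s + 1 - (r + 1) = s by omega, show r + s + 1 - r = s + 1 by omega, hfu (r + s + 1),
        hfu r, hfu s, show r + s + 1 + 1 = (r + 1) + (s + 1) by omega, hu2 (r + 1) (s + 1),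
        show r + s + 1 + 2 = (r + 1) + 1 + (s + 1) by omega, pow_add W (r + 1 + 1),
        pow_add W (r + 1)]
      have := hu0 r
      have := hu0 s
      have := hf0 r
      have := hf0 s
      have := hQWn (r + 1)
      have := hQWn (s + 1)
      have e1 : (Q ^ 2) ^ (r + 1) = (Q ^ r * Q) ^ 2 := by ring
      field_simp
      rw [e1]
      clear hu1 hu2 hfu hgeom hu hf hQWn hf0 hu0 hQ
      generalize Q ^ (s + 1) = b at *
      generalize W ^ (s + 1) = c at *
      rw [pow_succ Q r] at *
      generalize W ^ (r + 1) = y at *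
      generalize Q ^ r = a at *
      generalize u (s + 1) = t at *
      generalize u (r + 1) = v at *
      generalize f (r + s + 1) = z at *
      grind
    · have := hQWn (r + 2)
      simp [h0, div_self (hf0 _)]
      linear_combination (-Q ^ r) * this
  · simp
  · intro r hr
    rw [hgeom, show m + 1 - r = m - r + 1 by omega, hfu (m - r)]
    have := hu0 (m - r)
    have := hf0 r
    have := hf0 (m - r)
    field_simp
  · intro r hr
    rw [hgeom, show m + 1 - (r + 1) = m - r by omega, hfu r]
    have := hu0 r
    have := hf0 r
    have := hf0 (m - r)
    field_simp
  · intro r hr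
    obtain ⟨s, rfl⟩ := Nat.exists_eq_add_of_lt hr
    beta_reduce
    rw [show r + s + 1 - (r + 1) = s by omega, show r + s + 1 - r = s + 1 by omega, ← hu, ← hu,
      hfu r, hfu s]
    have := hu0 r
    have := hu0 s
    have := hf0 r
    have := hf0 s
    field_simp

lemma SerreCoeffs.map {R S : Type*} [CommRing R] [CommRing S] (φ : R →+* S) {Q W : R} {m : ℕ}
    {β : ℕ → R} (H : SerreCoeffs Q W m β) : SerreCoeffs (φ Q) (φ W) m (fun r => φ (β r)) := by
  obtain ⟨h0, ⟨T, h1, h2, h3, h4⟩, κ, h5, h6, h7⟩ := H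
  refine ⟨by rw [← map_mul, h0, map_one], ⟨fun r => φ (T r), congr_arg φ h1, fun r hr => ?_, fun r hr => ?_,
    (congr_arg φ h4).trans (map_zero φ)⟩, fun r => φ (κ r), fun r hr => ?_, fun r hr => ?_, fun r hr => ?_⟩
  · simp [h2 r hr]
  · simpa using congr_arg φ (h3 r hr)
  · simpa using congr_arg φ (h5 r hr)
  · simpa using congr_arg φ (h6 r hr)
  · simpa using congr_arg φ (h7 r hr)

end QuantumInteger

lemma qq_ne_zero : qq ≠ 0 := pow_ne_zero _ RatFunc.X_ne_zero

lemma qq_pow_ne_one {n : ℕ} (hn : n ≠ 0) : qq ^ n ≠ 1 := by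
  intro h
  rw [qq, sqq, ← pow_mul, ← RatFunc.algebraMap_X, ← map_pow, ← map_one (algebraMap (Polynomial ℚ) (RatFunc ℚ))] at h
  have h1 := RatFunc.algebraMap_injective ℚ h
  have := congr_arg Polynomial.natDegree h1
  rw [Polynomial.natDegree_X_pow, Polynomial.natDegree_one] at this
  omega

lemma qq_zpow_ne_one {n : ℤ} (hn : n ≠ 0) : qq ^ n ≠ 1 := by
  obtain ⟨k, rfl | rfl⟩ := n.eq_nat_or_neg
  · simpa using qq_pow_ne_one (by simpa using hn)
  · simpa using qq_pow_ne_one (by simpa using hn)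

lemma qi_ne_zero {N : ℕ} (d : Fin N → ℤ) (i : Fin N) : qi d i ≠ 0 := zpow_ne_zero _ qq_ne_zero

lemma qp_ne_zero {N : ℕ} (d : Fin N → ℤ) (A : Fin N → Fin N → ℤ) (i j : Fin N) : qp d A i j ≠ 0 :=
  zpow_ne_zero _ qq_ne_zero

lemma qi_pow_sub_ne_zero {N : ℕ} {d : Fin N → ℤ} {i : Fin N} (hd : 0 < d i) (n : ℕ) :
    qi d i ^ (n + 1) - (qi d i)⁻¹ ^ (n + 1) ≠ 0 := by
  intro h
  have h0 := qi_ne_zero d i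
  rw [sub_eq_zero, inv_pow, ← mul_eq_one_iff_eq_inv₀ (pow_ne_zero _ h0), ← pow_add, qi, ← zpow_natCast,
    ← zpow_mul] at h
  exact qq_zpow_ne_one (mul_ne_zero hd.ne' (by omega)) h

lemma qi_sub_inv_ne_zero {N : ℕ} {d : Fin N → ℤ} {i : Fin N} (hd : 0 < d i) :
    qi d i - (qi d i)⁻¹ ≠ 0 := by
  simpa using qi_pow_sub_ne_zero hd 0

lemma qfact_succ_mul {N : ℕ} {d : Fin N → ℤ} {i : Fin N} (hd : 0 < d i) (n : ℕ) :
    qfact d i (n + 1) * (qi d i - (qi d i)⁻¹) =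
      (qi d i ^ (n + 1) - (qi d i)⁻¹ ^ (n + 1)) * qfact d i n := by
  rw [qfact, qint, mul_right_comm, div_mul_cancel₀ _ (qi_sub_inv_ne_zero hd), zpow_neg, inv_pow,
    ← Nat.cast_succ, zpow_natCast]

lemma serreCoeffs_qbinom {N : ℕ} {d : Fin N → ℤ} {i : Fin N} (hd : 0 < d i) (m : ℕ) :
    SerreCoeffs (qi d i) (qi d i)⁻¹ m (qbinom d i (m + 1)) :=
  serreCoeffs_of_field (qi_pow_sub_ne_zero hd) (mul_inv_cancel₀ (qi_ne_zero d i)) m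
    (by rw [qfact]) (qfact_succ_mul hd)

lemma serreCoeffs_qbinom_inv {N : ℕ} {d : Fin N → ℤ} {i : Fin N} (hd : 0 < d i) (m : ℕ) :
    SerreCoeffs (qi d i)⁻¹ (qi d i) m (qbinom d i (m + 1)) := by
  refine serreCoeffs_of_field (fun n h => qi_pow_sub_ne_zero hd n ?_)
    (inv_mul_cancel₀ (qi_ne_zero d i)) m (by rw [qfact]) fun n => ?_
  · rw [← neg_sub, h, neg_zero]
  · linear_combination -qfact_succ_mul hd n

/-- The hypotheses on the Cartan matrix. -/
structure CartanHyp {N : ℕ} (d : Fin N → ℤ) (A : Fin N → Fin N → ℤ) : Prop where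
  pos : ∀ i, 0 < d i
  diag : ∀ i, A i i = 2
  off : ∀ i j, i ≠ j → A i j ≤ 0
  symm : ∀ i j, d i * A i j = d j * A j i

variable {N : ℕ} {d : Fin N → ℤ} {A : Fin N → Fin N → ℤ} {R : Type*} [CommRing R] [Algebra Fq R]

variable (R) in
/-- The unit of an algebra given by a nonzero scalar. -/
def scalarUnit (a : Fq) (ha : a ≠ 0) : Rˣ := Units.map (algebraMap Fq R) (Units.mk0 a ha)

lemma coe_scalarUnit (a : Fq) (ha : a ≠ 0) : (scalarUnit R a ha : R) = algebraMap Fq R a := rfl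

lemma coe_scalarUnit_inv (a : Fq) (ha : a ≠ 0) : (↑(scalarUnit R a ha)⁻¹ : R) = algebraMap Fq R a⁻¹ := by
  rw [scalarUnit, ← map_inv]
  simp

/-- The structure constants of the quantum affine algebra. -/
def uqData (H : CartanHyp d A) (g : Rˣ) : DrinfeldData (Fin N) R where
  p i j := scalarUnit R (qp d A i j) (qp_ne_zero d A i j)
  g := g
  q := scalarUnit R qq qq_ne_zero
  κ i := scalarUnit R (qi d i - (qi d i)⁻¹) (qi_sub_inv_ne_zero (H.pos i))
  Q i := scalarUnit R (qi d i) (qi_ne_zero d i)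
  m i j := (-A i j).toNat
  β i j r := algebraMap Fq R (qbinom d i ((-A i j).toNat + 1) r)
  p_comm i j := by simp only [qp, H.symm i j]
  p_self i := by
    ext
    rw [Units.val_pow_eq_pow_val, coe_scalarUnit, coe_scalarUnit, ← map_pow, qp, qi, H.diag, ← zpow_natCast,
      ← zpow_mul]
    rfl
  p_ne i j hij := by
    ext
    rw [Units.val_pow_eq_pow_val, coe_scalarUnit, coe_scalarUnit_inv, ← map_pow, qp, qi, ← zpow_natCast,
      ← zpow_neg, ← zpow_mul]
    congr 2
    have := Int.toNat_of_nonneg (neg_nonneg.2 (H.off i j hij))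
    rw [this]
    ring
  serre_pos i j hij := by
    rw [coe_scalarUnit, coe_scalarUnit_inv]
    exact (serreCoeffs_qbinom (H.pos i) _).map _
  serre_neg i j hij := by
    rw [coe_scalarUnit, coe_scalarUnit_inv]
    exact (serreCoeffs_qbinom_inv (H.pos i) _).map _

end QAff

namespace QAff

variable {N : ℕ} {d : Fin N → ℤ} {A : Fin N → Fin N → ℤ} {R : Type*} [CommRing R] [Algebra Fq R]
  (H : CartanHyp d A) (g : Rˣ)

lemma coe_uqData_p (i j : Fin N) : ((uqData H g).p i j : R) = algebraMap Fq R (qp d A i j) := rfl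

lemma coe_uqData_p_inv (i j : Fin N) :
    (↑((uqData H g).p i j)⁻¹ : R) = algebraMap Fq R (qp d A i j)⁻¹ :=
  coe_scalarUnit_inv _ _

lemma coe_uqData_κ (i : Fin N) :
    ((uqData H g).κ i : R) = algebraMap Fq R (qi d i - (qi d i)⁻¹) := rfl

lemma coe_uqData_κ_inv (i : Fin N) :
    (↑((uqData H g).κ i)⁻¹ : R) = algebraMap Fq R (qi d i - (qi d i)⁻¹)⁻¹ :=
  coe_scalarUnit_inv _ _

lemma coe_scalarUnit_zpow (a : Fq) (ha : a ≠ 0) (k : ℤ) :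
    ((scalarUnit R a ha ^ k : Rˣ) : R) = algebraMap Fq R (a ^ k) := by
  rw [scalarUnit, ← map_zpow, Units.coe_map, Units.val_zpow_eq_zpow_val]
  rfl

lemma coe_uqData_p_zpow (i j : Fin N) (k : ℤ) :
    (((uqData H g).p i j ^ k : Rˣ) : R) = algebraMap Fq R (qi d i ^ (k * A i j)) := by
  refine (coe_scalarUnit_zpow _ _ k).trans ?_
  rw [qp, qi, ← zpow_mul, ← zpow_mul, mul_right_comm, mul_assoc]

lemma coe_uqData_q_zpow (k : ℤ) : (((uqData H g).q ^ k : Rˣ) : R) = algebraMap Fq R (qq ^ k) :=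
  coe_scalarUnit_zpow _ _ k

variable [Algebra ℚ R]

variable (R) in
lemma ratInv_eq (k : ℤ) : ratInv R k = algebraMap Fq R (k : Fq)⁻¹ := by
  rcases eq_or_ne k 0 with rfl | hk
  · simp [ratInv]
  have h1 : (k : R) * ratInv R k = 1 := mul_ratInv hk
  have h2 : (k : R) * algebraMap Fq R (k : Fq)⁻¹ = 1 := by
    rw [← map_intCast (algebraMap Fq R), ← map_mul, mul_inv_cancel₀ (by exact_mod_cast hk), map_one]
  calc ratInv R k = ratInv R k * ((k : R) * algebraMap Fq R (k : Fq)⁻¹) := by rw [h2, mul_one]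
    _ = _ := by rw [← mul_assoc, mul_comm (ratInv R k), h1, one_mul]

lemma hcoef_uqData (i j : Fin N) (θ : Rˣ) (k : ℤ) :
    hcoef (uqData H g) i ((uqData H g).p i j) θ k =
      algebraMap Fq R ((k : Fq)⁻¹ * qint d i (k * A i j)) * ((θ ^ |k| : Rˣ) : R) := by
  rw [hcoef, coe_uqData_p_zpow, coe_uqData_p_zpow, coe_uqData_κ_inv, ratInv_eq, ← map_sub, ← map_mul,
    ← map_mul]
  congr 2
  rw [qint, neg_mul]
  ring

omit [Algebra Fq R] in
lemma hcoef_inv (X : DrinfeldData (Fin N) R) (i : Fin N) (P θ : Rˣ) (k : ℤ) :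
    hcoef X i P⁻¹ θ k = -hcoef X i P θ k := by
  rw [hcoef, hcoef, inv_zpow', inv_zpow', neg_neg]
  ring

lemma heis_uqData (i j : Fin N) (k : ℤ) :
    heis (uqData H g) i j k =
      algebraMap Fq R ((k : Fq)⁻¹ * qint d i (k * A i j) * (qi d j - (qi d j)⁻¹)⁻¹) *
        (((g ^ (2 * k) : Rˣ) : R) - ((g ^ (2 * (-k)) : Rˣ) : R)) := by
  rw [heis, coe_uqData_p_zpow, coe_uqData_p_zpow, coe_uqData_κ_inv, coe_uqData_κ_inv, ratInv_eq,
    ← map_sub, ← map_mul, ← map_mul, ← map_mul, mul_neg]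
  congr 2
  rw [qint, neg_mul]
  ring

variable {E : Type*} [Ring E] [Algebra R E] [Algebra Fq E] [IsScalarTower Fq R E]
  (φ : FA N →ₐ[Fq] E)

section

variable {g φ}

omit [Algebra Fq R] [Algebra ℚ R] [IsScalarTower Fq R E] in
lemma map_gammaHalf (hg : φ (e Gen.g2) = algebraMap R E g)
    (hg' : φ (e Gen.g2inv) = algebraMap R E ↑g⁻¹) (m : ℤ) :
    φ (gammaHalf m) = algebraMap R E ↑(g ^ m) := by
  rw [gammaHalf]
  split_ifs with h
  · obtain ⟨n, rfl⟩ := Int.eq_ofNat_of_zero_le h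
    simp [hg]
  · obtain ⟨n, hn⟩ := Int.eq_ofNat_of_zero_le (by omega : 0 ≤ -m)
    obtain rfl : m = -n := by omega
    simp [hg']

variable (φ)

lemma map_Ppos (i : Fin N) (k : ℕ) : φ (Ppos d i k) =
    schur (R := R) (fun l => ((uqData H g).κ i : R) • φ (e (Gen.h i l))) k := by
  induction k using Nat.strong_induction_on with
  | _ k ih =>
  rcases k with _ | k
  · rw [Ppos, schur, map_one]
  · rw [Ppos, schur, ratInv_eq, algebraMap_smul, map_smul, map_sum]
    congr 1
    · refine Finset.sum_congr rfl fun l hl => ?_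
      rw [map_smul, map_mul, ih _ (by omega), coe_uqData_κ, algebraMap_smul, mul_smul,
        Nat.cast_smul_eq_nsmul, smul_mul_assoc]
      push_cast
      rfl

lemma map_Pneg (i : Fin N) (k : ℕ) : φ (Pneg d i k) =
    schur (R := R) (fun l => -((uqData H g).κ i : R) • φ (e (Gen.h i (-l)))) k := by
  induction k using Nat.strong_induction_on with
  | _ k ih =>
  rcases k with _ | k
  · rw [Pneg, schur, map_one]
  · rw [Pneg, schur, ratInv_eq, algebraMap_smul, map_smul, map_sum]
    congr 1
    · refine Finset.sum_congr rfl fun l hl => ?_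
      rw [map_smul, map_mul, ih _ (by omega), coe_uqData_κ, ← map_neg, algebraMap_smul, mul_smul,
        Nat.cast_smul_eq_nsmul, smul_mul_assoc]
      push_cast
      rfl

lemma map_psiEl (i : Fin N) (m : ℤ) : φ (psiEl d i m) =
    psi (uqData H g) (fun i k => φ (e (Gen.h i k))) (fun i => φ (e (Gen.K i))) i m := by
  rw [psiEl, psi, cartanModes]
  split_ifs with h
  · rw [map_mul, map_Ppos H (g := g) φ]
  · rw [map_zero]

lemma map_phiEl (i : Fin N) (m : ℤ) : φ (phiEl d i m) =
    phi (uqData H g) (fun i k => φ (e (Gen.h i k))) (fun i => φ (e (Gen.Kinv i))) i m := by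
  rw [phiEl, phi, cartanModes]
  simp only [neg_nonneg]
  split_ifs with h
  · rw [map_mul, map_Pneg H (g := g) φ]
  · rw [map_zero]

end

end QAff

namespace QAff

variable {N : ℕ} {d : Fin N → ℤ} {A : Fin N → Fin N → ℤ} {R : Type*} [CommRing R] [Algebra Fq R]
  (H : CartanHyp d A) {g : Rˣ} [Algebra ℚ R]
variable {E : Type*} [Ring E] [Algebra R E] [Algebra Fq E] [IsScalarTower Fq R E]

/-- A representation of the relations of the quantum affine algebra. -/
structure IsDrinfeldRep (X : DrinfeldData (Fin N) R) (xp xm h : Fin N → ℤ → E) (K Kinv : Fin N → E)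
    (D Dinv : E) : Prop where
  cartan : IsCartan X h K Kinv
  exchange_p : Exchange X h K Kinv X.p X.g⁻¹ xp
  exchange_m : Exchange X h K Kinv (fun i j => (X.p i j)⁻¹) X.g xm
  h_zero : ∀ i, h i 0 = 0
  quad_p : ∀ i j, QuadRel (X.p i j : R) (xp i) (xp j)
  serre_p : ∀ i j, i ≠ j → ∀ k l, serreSum (X.β i j) (X.m i j + 1) (xp i) (xp j) k l = 0
  neg : IsNegative X xm
  xp_xm : ∀ i j k l, xp i k * xm j l - xm j l * xp i k =
    if i = j then bracket X h K Kinv i k l else 0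
  D_Dinv : D * Dinv = 1
  Dinv_D : Dinv * D = 1
  K_D : ∀ i, K i * D = D * K i
  D_h : ∀ i s, D * h i s * Dinv = ((X.q ^ s : Rˣ) : R) • h i s
  D_xp : ∀ i s, D * xp i s * Dinv = ((X.q ^ s : Rˣ) : R) • xp i s
  D_xm : ∀ i s, D * xm i s * Dinv = ((X.q ^ s : Rˣ) : R) • xm i s

omit [Algebra ℚ R] in
lemma map_dserre (φ : FA N →ₐ[Fq] E) (pm : Bool) (i j : Fin N) (n : ℕ) (ks : Fin n → ℤ) (l : ℤ) :
    φ (∑ σ : Equiv.Perm (Fin n), ∑ r ∈ Finset.range (n + 1),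
      ((-1 : Fq) ^ r * qbinom d i n r) • dsTerm pm i j n ks l σ r) =
    serreSum (fun r => algebraMap Fq R (qbinom d i n r)) n
      (fun t => φ (e (if pm then Gen.xp i t else Gen.xm i t)))
      (fun t => φ (e (if pm then Gen.xp j t else Gen.xm j t))) ks l := by
  rw [map_sum, serreSum]
  refine Finset.sum_congr rfl fun σ _ => ?_
  rw [map_sum]
  refine Finset.sum_congr rfl fun r _ => ?_
  rw [map_smul, dsTerm, map_mul, map_mul, map_list_prod, map_list_prod, List.map_map, List.map_map,
    ← algebraMap_smul R ((-1 : Fq) ^ r * qbinom d i n r), map_mul, map_pow, map_neg, map_one]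
  rfl

/-- The values of a homomorphism on the generators. -/
def genMap (g : Rˣ) (xp xm h : Fin N → ℤ → E) (K Kinv : Fin N → E) (D Dinv : E) : Gen N → E
  | .xp i r => xp i r
  | .xm i r => xm i r
  | .h i r => h i r
  | .K i => K i
  | .Kinv i => Kinv i
  | .g2 => algebraMap R E g
  | .g2inv => algebraMap R E ↑g⁻¹
  | .D => D
  | .Dinv => Dinv

variable {xp xm h : Fin N → ℤ → E} {K Kinv : Fin N → E} {D Dinv : E}

variable (xp xm h K Kinv D Dinv g) in
/-- The homomorphism from the free algebra. -/
def freeRep : FA N →ₐ[Fq] E := FreeAlgebra.lift Fq (genMap g xp xm h K Kinv D Dinv)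

omit [Algebra Fq R] [Algebra ℚ R] [IsScalarTower Fq R E] in
lemma freeRep_e (x : Gen N) : freeRep g xp xm h K Kinv D Dinv (e x) =
    genMap g xp xm h K Kinv D Dinv x := FreeAlgebra.lift_ι_apply _ _

omit [Algebra Fq R] [Algebra ℚ R] [IsScalarTower Fq R E] in
lemma freeRep_gammaHalf (m : ℤ) :
    freeRep g xp xm h K Kinv D Dinv (gammaHalf m) = algebraMap R E ↑(g ^ m) :=
  map_gammaHalf (freeRep_e _) (freeRep_e _) m

variable {H}

lemma freeRep_rel (Y : IsDrinfeldRep (uqData H g) xp xm h K Kinv D Dinv) {a b : FA N}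
    (hab : QRel N d A a b) :
    freeRep g xp xm h K Kinv D Dinv a = freeRep g xp xm h K Kinv D Dinv b := by
  cases hab with
  | K_Kinv i => simpa [freeRep_e, genMap] using Y.cartan.K_Kinv i
  | Kinv_K i => simpa [freeRep_e, genMap] using Y.cartan.Kinv_K i
  | D_Dinv => simpa [freeRep_e, genMap] using Y.D_Dinv
  | Dinv_D => simpa [freeRep_e, genMap] using Y.Dinv_D
  | g_ginv =>
    rw [map_mul, freeRep_e, freeRep_e, genMap, genMap, ← map_mul, Units.mul_inv, map_one, map_one]
  | ginv_g =>
    rw [map_mul, freeRep_e, freeRep_e, genMap, genMap, ← map_mul, Units.inv_mul, map_one, map_one]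
  | g2_comm x => rw [map_mul, map_mul, freeRep_e Gen.g2]; exact Algebra.commutes _ _
  | g2inv_comm x => rw [map_mul, map_mul, freeRep_e Gen.g2inv]; exact Algebra.commutes _ _
  | K_comm_K i j => simpa [freeRep_e, genMap] using Y.cartan.K_K i j
  | K_comm_D i => simpa [freeRep_e, genMap] using Y.K_D i
  | K_comm_h i j s => simpa [freeRep_e, genMap] using Y.cartan.K_h i j s
  | h_zero i => simpa [freeRep_e, genMap] using Y.h_zero i
  | D_h i s =>
    have := Y.D_h i s
    rw [coe_uqData_q_zpow, algebraMap_smul] at this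
    simpa [freeRep_e, genMap] using this
  | D_xp i s =>
    have := Y.D_xp i s
    rw [coe_uqData_q_zpow, algebraMap_smul] at this
    simpa [freeRep_e, genMap] using this
  | D_xm i s =>
    have := Y.D_xm i s
    rw [coe_uqData_q_zpow, algebraMap_smul] at this
    simpa [freeRep_e, genMap] using this
  | K_xp i j r =>
    have := Y.exchange_p.K_x i j r
    rw [coe_uqData_p, algebraMap_smul] at this
    rw [map_mul, map_mul, map_smul, freeRep_e, freeRep_e, freeRep_e, genMap, genMap, genMap, this,
      smul_mul_assoc, mul_assoc, Y.cartan.K_Kinv, mul_one]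
  | K_xm i j r =>
    have := Y.exchange_m.K_x i j r
    rw [coe_uqData_p_inv, algebraMap_smul] at this
    rw [map_mul, map_mul, map_smul, freeRep_e, freeRep_e, freeRep_e, genMap, genMap, genMap, this,
      smul_mul_assoc, mul_assoc, Y.cartan.K_Kinv, mul_one]
  | h_h i j k l hk hl =>
    have := Y.cartan.h_h i j k l
    rw [heis_uqData] at this
    rw [map_sub, map_mul, map_mul, freeRep_e, freeRep_e]
    refine this.trans ?_
    split_ifs with hkl
    · rw [map_smul, map_sub, gammaPow, gammaPow, freeRep_gammaHalf, freeRep_gammaHalf, mul_smul,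
        algebraMap_smul, ← map_sub, Algebra.algebraMap_eq_smul_one]
    · rw [map_zero]
  | h_xp i j k l hk =>
    have := Y.exchange_p.h_x i j k l
    rw [hcoef_uqData, mul_smul, algebraMap_smul] at this
    rw [map_sub, map_mul, map_mul, map_smul, map_mul, freeRep_gammaHalf, freeRep_e, freeRep_e,
      freeRep_e, ← Algebra.smul_def]
    refine this.trans ?_
    rw [add_comm l k, inv_zpow']
    rfl
  | h_xm i j k l hk =>
    have := Y.exchange_m.h_x i j k l
    rw [hcoef_inv, hcoef_uqData, neg_smul, mul_smul, algebraMap_smul] at this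
    rw [map_sub, map_mul, map_mul, map_smul, map_mul, freeRep_gammaHalf, freeRep_e, freeRep_e,
      freeRep_e, ← Algebra.smul_def, neg_smul]
    refine this.trans ?_
    rw [add_comm l k]
    rfl
  | serre_p i j k l =>
    have := Y.quad_p i j k l
    rw [coe_uqData_p, algebraMap_smul, algebraMap_smul] at this
    simpa [freeRep_e, genMap] using this
  | serre_m i j k l =>
    have := Y.neg.1 i j k l
    rw [coe_uqData_p_inv, algebraMap_smul, algebraMap_smul] at this
    simpa [freeRep_e, genMap] using this
  | xp_xm i j k l =>
    have := Y.xp_xm i j k l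
    rw [map_sub, map_mul, map_mul, freeRep_e, freeRep_e]
    refine this.trans ?_
    split_ifs with hij
    · rw [map_smul, map_sub, map_mul, map_mul, freeRep_gammaHalf, freeRep_gammaHalf,
        map_psiEl H (g := g), map_phiEl H (g := g), bracket, coe_uqData_κ_inv, algebraMap_smul,
        ← Algebra.smul_def, ← Algebra.smul_def]
      simp only [freeRep_e]
      rfl
    · rw [map_zero]
  | dserre pm i j hij ks l =>
    rw [map_dserre (R := R), map_zero]
    simp only [freeRep_e]
    have hn : (1 - A i j).toNat = (-A i j).toNat + 1 := by
      have := H.off i j hij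
      omega
    generalize (1 - A i j).toNat = n at *
    subst hn
    cases pm
    · exact Y.neg.2 i j hij ks l
    · exact Y.serre_p i j hij ks l

/-- The homomorphism from the quantum affine algebra given by a representation. -/
def uqRep (Y : IsDrinfeldRep (uqData H g) xp xm h K Kinv D Dinv) : Uq N d A →ₐ[Fq] E :=
  RingQuot.liftAlgHom Fq ⟨freeRep g xp xm h K Kinv D Dinv, fun _ _ hab => freeRep_rel Y hab⟩

lemma uqRep_mk (Y : IsDrinfeldRep (uqData H g) xp xm h K Kinv D Dinv) (a : FA N) :
    uqRep Y (RingQuot.mkAlgHom Fq (QRel N d A) a) = freeRep g xp xm h K Kinv D Dinv a :=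
  RingQuot.liftAlgHom_mkAlgHom_apply _ _ _ _

end QAff

namespace QAff

variable {N : ℕ} {d : Fin N → ℤ} {A : Fin N → Fin N → ℤ} {R : Type*} [CommRing R] [Algebra Fq R]
  [Algebra ℚ R]

omit [Algebra Fq R] [Algebra ℚ R] in
lemma conj_eq {E : Type*} [Ring E] [Algebra R E] {D Dinv y : E} {c : R} (hD : D * Dinv = 1)
    (h : D * y = c • (y * D)) : D * y * Dinv = c • y := by
  rw [h, smul_mul_assoc, mul_assoc, hD, mul_one]

omit [Algebra Fq R] in
lemma isDrinfeldRep_vac (X : DrinfeldData (Fin N) R) :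
    IsDrinfeldRep X (vacXp X) (vacXm X) (vacH X) (vacK X) (vacKinv X) (vacD X X.q)
      (vacD X X.q⁻¹) where
  cartan := isCartan_vac X
  exchange_p := exchange_vacXp X
  exchange_m := exchange_vacXm X
  h_zero := vacH_zero X
  quad_p := quadRel_vacXp X
  serre_p := serreSum_vacXp X
  neg := isNegative_vacXm X
  xp_xm := vacXp_vacXm X
  D_Dinv := vacD_vacD X (mul_inv_cancel _)
  Dinv_D := vacD_vacD X (inv_mul_cancel _)
  K_D i := (vacD_vacK X _ i).symm
  D_h i s := conj_eq (vacD_vacD X (mul_inv_cancel _)) (vacD_vacH X _ i s)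
  D_xp i s := conj_eq (vacD_vacD X (mul_inv_cancel _)) (vacD_vacXp X _ i s)
  D_xm i s := conj_eq (vacD_vacD X (mul_inv_cancel _)) (vacD_vacXm X _ i s)

section Algebra

variable (H : CartanHyp d A) {g : Rˣ} [Algebra R (Uq N d A)] [IsScalarTower Fq R (Uq N d A)]

variable (d A) in
/-- The projection from the free algebra. -/
def uqMk : FA N →ₐ[Fq] Uq N d A := RingQuot.mkAlgHom Fq (QRel N d A)

variable {H}

lemma uqMk_e (x : Gen N) : uqMk d A (e x) = G d A x := rfl

lemma uqMk_rel {a b : FA N} (hab : QRel N d A a b) : uqMk d A a = uqMk d A b :=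
  RingQuot.mkAlgHom_rel Fq hab

omit [Algebra Fq R] [Algebra ℚ R] in
lemma mul_eq_smul_of_conj {E : Type*} [Ring E] [Algebra R E] {D Dinv y : E} {c : R} (hD : Dinv * D = 1)
    (h : D * y * Dinv = c • y) : D * y = c • (y * D) := by
  rw [← smul_mul_assoc, ← h, mul_assoc, hD, mul_one]

lemma G_K_Kinv (i : Fin N) : G d A (Gen.K i) * G d A (Gen.Kinv i) = 1 := by
  simpa [uqMk_e] using uqMk_rel (QRel.K_Kinv (d := d) (A := A) i)

lemma G_Kinv_K (i : Fin N) : G d A (Gen.Kinv i) * G d A (Gen.K i) = 1 := by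
  simpa [uqMk_e] using uqMk_rel (QRel.Kinv_K (d := d) (A := A) i)

lemma G_g2_comm (y : Uq N d A) : G d A Gen.g2 * y = y * G d A Gen.g2 := by
  obtain ⟨y, rfl⟩ := RingQuot.mkAlgHom_surjective Fq (QRel N d A) y
  induction y using FreeAlgebra.induction with
  | grade0 r => rw [AlgHom.commutes]; exact (Algebra.commutes _ _).symm
  | grade1 x =>
    have := uqMk_rel (QRel.g2_comm (d := d) (A := A) x)
    rwa [map_mul, map_mul] at this
  | mul a b ha hb => rw [map_mul, ← mul_assoc, ha, mul_assoc, hb, mul_assoc]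
  | add a b ha hb => rw [map_add, mul_add, add_mul, ha, hb]

lemma G_g2_g2inv : G d A Gen.g2 * G d A Gen.g2inv = 1 := by
  simpa [uqMk_e] using uqMk_rel (QRel.g_ginv (d := d) (A := A))

lemma G_g2inv_g2 : G d A Gen.g2inv * G d A Gen.g2 = 1 := by
  simpa [uqMk_e] using uqMk_rel (QRel.ginv_g (d := d) (A := A))

variable (hg : algebraMap R (Uq N d A) g = G d A Gen.g2)
include hg

omit [Algebra Fq R] [Algebra ℚ R] [IsScalarTower Fq R (Uq N d A)] in
lemma algebraMap_g_inv : algebraMap R (Uq N d A) ↑g⁻¹ = G d A Gen.g2inv := by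
  have h1 : algebraMap R (Uq N d A) ↑g⁻¹ * G d A Gen.g2 = 1 := by
    rw [← hg, ← map_mul, Units.inv_mul, map_one]
  calc algebraMap R (Uq N d A) ↑g⁻¹ = algebraMap R (Uq N d A) ↑g⁻¹ * (G d A Gen.g2 * G d A Gen.g2inv) := by
        rw [G_g2_g2inv, mul_one]
    _ = _ := by rw [← mul_assoc, h1, one_mul]

omit [Algebra Fq R] [Algebra ℚ R] [IsScalarTower Fq R (Uq N d A)] in
lemma uqMk_gammaHalf (m : ℤ) : uqMk d A (gammaHalf m) = algebraMap R _ ↑(g ^ m) :=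
  map_gammaHalf hg.symm (algebraMap_g_inv hg).symm m

variable (H)

lemma exchange_uq : Exchange (uqData H g) (fun i k => G d A (Gen.h i k)) (fun i => G d A (Gen.K i))
    (fun i => G d A (Gen.Kinv i)) (fun i j => ((uqData H g).p i j)⁻¹) (uqData H g).g
    (fun i k => G d A (Gen.xm i k)) := by
  have hK : ∀ i j l, G d A (Gen.K i) * G d A (Gen.xm j l) =
      (↑((uqData H g).p i j)⁻¹ : R) • (G d A (Gen.xm j l) * G d A (Gen.K i)) := fun i j l => by
    refine mul_eq_smul_of_conj (G_Kinv_K i) ?_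
    have := uqMk_rel (QRel.K_xm (d := d) (A := A) i j l)
    rwa [map_mul, map_mul, map_smul, ← algebraMap_smul R] at this
  refine ⟨hK, fun i j l => ?_, fun i j k l => ?_⟩
  · have h1 := congr_arg (fun y => G d A (Gen.Kinv i) * y * G d A (Gen.Kinv i)) (hK i j l)
    simp only [mul_smul_comm, smul_mul_assoc, mul_assoc, G_K_Kinv, mul_one] at h1
    rw [← mul_assoc, G_Kinv_K, one_mul] at h1
    rw [h1, smul_smul, Units.inv_mul, one_smul]
  · rcases eq_or_ne k 0 with rfl | hk
    · have : G d A (Gen.h i 0) = 0 := by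
        simpa [uqMk_e] using uqMk_rel (QRel.h_zero (d := d) (A := A) i)
      rw [this, mul_zero, zero_mul, sub_zero]
      simp [hcoef]
    have := uqMk_rel (QRel.h_xm (d := d) (A := A) i j k l hk)
    rw [map_sub, map_mul, map_mul, map_smul, map_mul, uqMk_gammaHalf hg, uqMk_e, uqMk_e,
      uqMk_e, ← Algebra.smul_def, ← algebraMap_smul R, smul_smul] at this
    rw [hcoef_inv, hcoef_uqData, add_comm l k, this, map_neg, neg_mul]
    rfl

omit hg [Algebra ℚ R] in
lemma isNegative_uq : IsNegative (uqData H g) (fun i k => G d A (Gen.xm i k)) := by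
  constructor
  · intro i j k l
    have := uqMk_rel (QRel.serre_m (d := d) (A := A) i j k l)
    rw [coe_uqData_p_inv, algebraMap_smul, algebraMap_smul]
    simpa [uqMk_e] using this
  · intro i j hij
    have := fun ks l => uqMk_rel (QRel.dserre (d := d) (A := A) false i j hij ks l)
    simp only [map_dserre (R := R), map_zero] at this
    have hn : (1 - A i j).toNat = (-A i j).toNat + 1 := by
      have := H.off i j hij
      omega
    generalize (1 - A i j).toNat = n at *
    subst hn
    exact this

lemma xp_xm_uq (i j : Fin N) (k l : ℤ) :
    G d A (Gen.xp i k) * G d A (Gen.xm j l) - G d A (Gen.xm j l) * G d A (Gen.xp i k) =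
      if i = j then bracket (uqData H g) (fun i k => G d A (Gen.h i k)) (fun i => G d A (Gen.K i))
        (fun i => G d A (Gen.Kinv i)) i k l else 0 := by
  have := uqMk_rel (QRel.xp_xm (d := d) (A := A) i j k l)
  rw [map_sub, map_mul, map_mul, uqMk_e, uqMk_e] at this
  rw [this]
  split_ifs with hij
  · rw [map_smul, map_sub, map_mul, map_mul, uqMk_gammaHalf hg, uqMk_gammaHalf hg,
      map_psiEl H (g := g), map_phiEl H (g := g), bracket, coe_uqData_κ_inv, algebraMap_smul,
      ← Algebra.smul_def, ← Algebra.smul_def]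
    rfl
  · rw [map_zero]

end Algebra

end QAff

namespace QAff
open TensorProduct

section Modes

variable {ι R : Type*} [CommRing R] [Algebra ℚ R] (X : DrinfeldData ι R)

/-- The embedding of the negative part in the vacuum representation. -/
def vacIn : Neg X →ₗ[R] Vac X := (TensorProduct.mk R (Neg X) (MvPolynomial (ι × ℕ) R)).flip 1

/-- The coefficient of a degree one monomial. -/
def vacCoeff (i : ι) : Vac X →ₗ[R] Neg X :=
  (TensorProduct.rid R (Neg X)).toLinearMap ∘ₗ
    LinearMap.lTensor (Neg X) (MvPolynomial.lcoeff R (Finsupp.single (i, 0) 1))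

omit [Algebra ℚ R] in
lemma vacIn_apply (n : Neg X) : vacIn X n = n ⊗ₜ 1 := rfl

omit [Algebra ℚ R] in
lemma vacCoeff_tmul (i : ι) (n : Neg X) (c : MvPolynomial (ι × ℕ) R) :
    vacCoeff X i (n ⊗ₜ c) = MvPolynomial.coeff (Finsupp.single (i, 0) 1) c • n := by
  simp [vacCoeff, MvPolynomial.lcoeff]

omit [Algebra ℚ R] in
lemma vacCoeff_vacIn (i : ι) (n : Neg X) : vacCoeff X i (vacIn X n) = 0 := by
  classical
  rw [vacIn_apply, vacCoeff_tmul, MvPolynomial.coeff_one, if_neg, zero_smul]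
  intro h
  simpa using DFunLike.congr_fun h (i, 0)

omit [Algebra ℚ R] in
lemma vacK_vacIn (i : ι) (n : Neg X) : vacK X i (vacIn X n) =
    vacIn X (negScale (fun j => (↑(X.p i j)⁻¹ : R)) 1 n) := rfl

omit [Algebra ℚ R] in
lemma vacKinv_vacIn (i : ι) (n : Neg X) : vacKinv X i (vacIn X n) =
    vacIn X (negScale (fun j => (↑(X.p i j) : R)) 1 n) := rfl

lemma vacH_vacIn (i : ι) {k : ℤ} (hk : 0 ≤ k) (n : Neg X) : vacH X i k (vacIn X n) =
    vacIn X (negShift (fun j => hcoef X i (X.p i j)⁻¹ X.g k) k n) := by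
  rw [vacIn_apply, vacH_tmul, fock_of_nonneg X i hk]
  simp [vacIn_apply]

lemma schur_mem {E : Type*} [AddCommGroup E] [Module R E] {W : Submodule R E} {y : ℕ → Module.End R E}
    (hy : ∀ l, ∀ v ∈ W, y (l + 1) v ∈ W) (m : ℕ) : ∀ v ∈ W, schur (R := R) y m v ∈ W := by
  induction m using Nat.strong_induction_on with
  | _ m ih =>
    intro v hv
    rcases m with _ | m
    · rwa [schur]
    · rw [schur, LinearMap.smul_apply, LinearMap.sum_apply]
      refine W.smul_mem _ (W.sum_mem fun l _ => ?_)
      rw [LinearMap.smul_apply]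
      exact nsmul_mem (hy l _ (ih (m - l) (by omega) v hv)) _

lemma psi_vac_mem (i : ι) (m : ℤ) (n : Neg X) :
    psi X (vacH X) (vacK X) i m (vacIn X n) ∈ LinearMap.range (vacIn X) := by
  rw [psi, cartanModes]
  split_ifs
  · obtain ⟨n', hn'⟩ := schur_mem (W := LinearMap.range (vacIn X))
      (y := fun l => (X.κ i : R) • vacH X i l) (fun l v hv => by
        obtain ⟨v, rfl⟩ := hv
        exact Submodule.smul_mem (LinearMap.range (vacIn X)) _
          (LinearMap.mem_range.2 ⟨_, (vacH_vacIn X i (by omega) v).symm⟩)) m.toNat (vacIn X n)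
      ⟨n, rfl⟩
    rw [Module.End.mul_apply, ← hn']
    exact ⟨_, (vacK_vacIn X i n').symm⟩
  · exact Submodule.zero_mem _

lemma vacCoeff_vacKinv (i a : ι) (v : Vac X) : vacCoeff X i (vacKinv X a v) =
    negScale (fun j => (↑(X.p a j) : R)) 1 (vacCoeff X i v) := by
  induction v using TensorProduct.induction_on with
  | zero => simp only [map_zero]
  | tmul n c => rw [vacKinv_tmul, vacCoeff_tmul, vacCoeff_tmul, map_smul]
  | add x y hx hy => simp only [map_add, hx, hy]

lemma schur_one {E : Type*} [Ring E] [Algebra R E] (y : ℕ → E) : schur (R := R) y 1 = y 1 := by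
  have h1 : ratInv R 1 = 1 := by simpa using mul_ratInv (R := R) (k := 1) one_ne_zero
  rw [schur]
  simp [schur, h1]

lemma vacCoeff_phi_neg_one (i : ι) (n : Neg X) :
    vacCoeff X i (phi X (vacH X) (vacKinv X) i (-1) (vacIn X n)) =
      -(X.κ i : R) • negScale (fun j => (↑(X.p i j) : R)) 1 n := by
  classical
  have h2 : fock X i (-1) 1 = MvPolynomial.X (i, 0) := by
    simpa using LinearMap.congr_fun (fock_of_neg X i 0) 1
  have : phi X (vacH X) (vacKinv X) i (-1) = vacKinv X i * (-(X.κ i : R) • vacH X i (-1)) := by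
    rw [phi, cartanModes, if_pos (by omega), show (- -1 : ℤ).toNat = 1 by rfl, schur_one]
    rfl
  rw [this, Module.End.mul_apply, vacCoeff_vacKinv, LinearMap.smul_apply, map_smul, map_smul,
    vacIn_apply, vacH_tmul, h2, map_add, ← vacIn_apply, vacCoeff_vacIn, vacCoeff_tmul,
    MvPolynomial.coeff_X, if_pos rfl, one_smul]
  rw [zero_add]

lemma phi_zero {E : Type*} [Ring E] [Algebra R E] (h : ι → ℤ → E) (Kinv : ι → E) (i : ι) :
    phi X h Kinv i 0 = Kinv i := by
  simp [phi, cartanModes, schur]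

omit [Algebra ℚ R] in
lemma negScale_injective (i : ι) {n : Neg X} (hn : negScale (fun j => (↑(X.p i j) : R)) 1 n = 0) :
    n = 0 := by
  have := congr_arg (negScale (fun j => (↑(X.p i j)⁻¹ : R)) 1) hn
  rw [negScale_comp, map_zero] at this
  simpa [negScale_one] using this

end Modes

variable {N : ℕ} {d : Fin N → ℤ} {A : Fin N → Fin N → ℤ} {R : Type*} [CommRing R] [Algebra Fq R]
  [Algebra ℚ R] (H : CartanHyp d A) (g : Rˣ)

end QAff

namespace QAff
open TensorProduct Filter

variable {N : ℕ} {d : Fin N → ℤ} {A : Fin N → Fin N → ℤ} {R : Type*} [CommRing R] [Algebra Fq R]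
  [Algebra ℚ R] (H : CartanHyp d A) (g : Rˣ)

/-- The vacuum representation of `U_q`. -/
def vacRep : Uq N d A →ₐ[Fq] Module.End R (Vac (uqData H g)) := uqRep (isDrinfeldRep_vac (uqData H g))

lemma vacRep_psiU (i : Fin N) (m : ℤ) :
    vacRep H g (psiU d A i m) = psi (uqData H g) (vacH _) (vacK _) i m := by
  rw [vacRep, psiU, uqRep_mk, map_psiEl H (g := g)]
  simp only [freeRep_e]
  rfl

lemma vacRep_phiU (i : Fin N) (m : ℤ) :
    vacRep H g (phiU d A i m) = phi (uqData H g) (vacH _) (vacKinv _) i m := by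
  rw [vacRep, phiU, uqRep_mk, map_phiEl H (g := g)]
  simp only [freeRep_e]
  rfl

lemma vacRep_gU (m : ℤ) : vacRep H g (gU d A m) = algebraMap R _ ↑(g ^ m) := by
  rw [vacRep, gU, uqRep_mk, freeRep_gammaHalf]

lemma vacRep_xm (i : Fin N) (m : ℤ) : vacRep H g (G d A (Gen.xm i m)) = vacXm _ i m := by
  rw [vacRep, G, uqRep_mk, freeRep_e]
  rfl

lemma vacRep_g2 : vacRep H g (G d A Gen.g2) = algebraMap R _ g := by
  rw [vacRep, G, uqRep_mk, freeRep_e]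
  rfl

lemma vacRep_g2inv : vacRep H g (G d A Gen.g2inv) = algebraMap R _ ↑g⁻¹ := by
  rw [vacRep, G, uqRep_mk, freeRep_e]
  rfl

section Lift

variable {g} [Algebra R (Uq N d A)] [IsScalarTower Fq R (Uq N d A)]

/-- The homomorphism from the abstract negative part to `U_q`. -/
def negToUq : Neg (uqData H g) →ₐ[R] Uq N d A := negLift _ (isNegative_uq H)

variable (hg : algebraMap R (Uq N d A) g = G d A Gen.g2)
include hg

lemma exists_vacRep_eq (n : Nq d A) :
    ∃ ν : Neg (uqData H g), vacRep H g (n : Uq N d A) = vacL _ ν ∧ negToUq H ν = (n : Uq N d A) := by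
  obtain ⟨n, hn⟩ := n
  dsimp only
  rw [Nq] at hn
  induction hn using Algebra.adjoin_induction with
  | mem x hx =>
    rcases hx with (rfl | rfl) | ⟨⟨i, m⟩, rfl⟩
    · exact ⟨algebraMap R _ g, by rw [vacRep_g2, AlgHom.commutes], by rw [AlgHom.commutes, hg]⟩
    · exact ⟨algebraMap R _ ↑g⁻¹, by rw [vacRep_g2inv, AlgHom.commutes],
        by rw [AlgHom.commutes, algebraMap_g_inv hg]⟩
    · exact ⟨negX _ i m, vacRep_xm H g i m, negLift_negX _ _ _ _⟩
  | algebraMap r =>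
    refine ⟨algebraMap R _ (algebraMap Fq R r), ?_, ?_⟩
    · rw [AlgHom.commutes, AlgHom.commutes, ← IsScalarTower.algebraMap_apply]
    · rw [AlgHom.commutes, ← IsScalarTower.algebraMap_apply]
  | add x y _ _ hx hy =>
    obtain ⟨a, ha, ha'⟩ := hx
    obtain ⟨b, hb, hb'⟩ := hy
    exact ⟨a + b, by rw [map_add, map_add, ha, hb], by rw [map_add, ha', hb']⟩
  | mul x y _ _ hx hy =>
    obtain ⟨a, ha, ha'⟩ := hx
    obtain ⟨b, hb, hb'⟩ := hy
    exact ⟨a * b, by rw [map_mul, map_mul, ha, hb], by rw [map_mul, ha', hb']⟩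

omit hg in
lemma psiU_zero (i : Fin N) : psiU d A i 0 = G d A (Gen.K i) := by
  simp [psiU, psiEl, Ppos, G]

omit hg in
lemma gU_zero : gU d A 0 = 1 := by
  simp [gU, gammaHalf]

include H in
lemma rep_eq_zero_right (i : Fin N) {a b : ℤ → Nq d A} (hb : ∃ m₁, ∀ m, m₁ ≤ m → b m = 0)
    (hs : ∀ k : ℤ, ∀ᶠ M : ℕ in atTop,
      ∑ p ∈ Finset.range M, psiU d A i p * gU d A p * (a (k - p) : Uq N d A) -
        ∑ p ∈ Finset.range M, phiU d A i (-p) * gU d A p * (b (k + p) : Uq N d A) = 0) (m : ℤ) :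
    b m = 0 := by
  obtain ⟨m₁, hm₁⟩ := hb
  suffices ∀ n : ℕ, ∀ m, m₁ ≤ m + n → b m = 0 from this (m₁ - m).toNat m (by omega)
  intro n
  induction n with
  | zero => intro m hm; exact hm₁ m (by omega)
  | succ n ih =>
    intro m hm
    obtain ⟨M, hM, hM2⟩ := ((hs (m - 1)).and (eventually_ge_atTop 2)).exists
    obtain ⟨M, rfl⟩ := Nat.exists_eq_add_of_le' hM2
    have hvac : ∀ x : Nq d A, ∃ ν, vacRep H g (x : Uq N d A) (vacIn _ 1) = vacIn _ ν ∧
        negToUq H ν = (x : Uq N d A) := fun x => by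
      obtain ⟨ν, h1, h2⟩ := exists_vacRep_eq H hg x
      refine ⟨ν, ?_, h2⟩
      rw [h1, vacIn_apply, vacL_tmul, mul_one, vacIn_apply]
    have hψ : ∀ (p : ℕ) (x : Nq d A), vacCoeff _ i (vacRep H g
        (psiU d A i p * gU d A p * (x : Uq N d A)) (vacIn _ 1)) = 0 := fun p x => by
      obtain ⟨ν, h1, -⟩ := hvac x
      rw [map_mul, map_mul, vacRep_psiU, vacRep_gU, Module.End.mul_apply, Module.End.mul_apply, h1,
        Module.algebraMap_end_apply, map_smul, map_smul]
      obtain ⟨w, hw⟩ := psi_vac_mem (uqData H g) i p ν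
      rw [← hw, vacCoeff_vacIn, smul_zero]
    have hφ0 : ∀ x : Nq d A, vacCoeff _ i (vacRep H g
        (phiU d A i (-(0 : ℕ)) * gU d A (0 : ℕ) * (x : Uq N d A)) (vacIn _ 1)) = 0 := fun x => by
      obtain ⟨ν, h1, -⟩ := hvac x
      rw [map_mul, map_mul, vacRep_phiU, vacRep_gU, Module.End.mul_apply, Module.End.mul_apply, h1,
        Module.algebraMap_end_apply, map_smul, map_smul, Nat.cast_zero, neg_zero, phi_zero,
        vacKinv_vacIn, vacCoeff_vacIn, smul_zero]
    have h := congr_arg (fun y => vacCoeff _ i (vacRep H g y (vacIn _ 1))) hM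
    obtain ⟨ν, h1, h2⟩ := hvac (b m)
    have hz : ∀ p ∈ Finset.range M, phiU d A i (-((p + 1 + 1 : ℕ) : ℤ)) * gU d A ((p + 1 + 1 : ℕ) : ℤ) *
        ((b (m - 1 + ((p + 1 + 1 : ℕ) : ℤ)) : Nq d A) : Uq N d A) = 0 := fun p _ => by
      rw [ih _ (by push_cast; omega), ZeroMemClass.coe_zero, mul_zero]
    rw [Finset.sum_range_succ' _ (M + 1), Finset.sum_range_succ' _ (M + 1),
      Finset.sum_range_succ' _ M, Finset.sum_range_succ' _ M] at h
    rw [Finset.sum_eq_zero hz, zero_add] at h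
    simp only [map_sub, map_add, map_sum, LinearMap.sub_apply, LinearMap.add_apply,
      LinearMap.sum_apply, hψ, hφ0, map_zero, LinearMap.zero_apply, Finset.sum_const_zero, add_zero,
      zero_sub, neg_eq_zero] at h
    rw [map_mul, map_mul, vacRep_phiU, vacRep_gU, Module.End.mul_apply, Module.End.mul_apply,
      show m - 1 + ((0 + 1 : ℕ) : ℤ) = m by push_cast; omega, h1, Module.algebraMap_end_apply,
      map_smul, map_smul, show (-((0 + 1 : ℕ) : ℤ)) = -1 by rfl, vacCoeff_phi_neg_one] at h
    have h3 : negScale (fun j => (↑((uqData H g).p i j) : R)) 1 ν = 0 := by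
      rw [zero_add, ← Units.val_neg, ← Units.smul_def, ← Units.smul_def, smul_eq_zero_iff_eq, smul_eq_zero_iff_eq] at h
      exact h
    have h4 := negScale_injective _ i h3
    rw [h4, map_zero] at h2
    exact Subtype.ext h2.symm

omit hg [Algebra ℚ R] [Algebra R (Uq N d A)] [IsScalarTower Fq R (Uq N d A)] [Algebra Fq R] in
lemma rep_eq_zero_left (i : Fin N) {a : ℤ → Nq d A} (ha : ∃ m₀, ∀ m, m ≤ m₀ → a m = 0)
    (hs : ∀ k : ℤ, ∀ᶠ M : ℕ in atTop,
      ∑ p ∈ Finset.range M, psiU d A i p * gU d A p * (a (k - p) : Uq N d A) = 0) (m : ℤ) :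
    a m = 0 := by
  obtain ⟨m₀, hm₀⟩ := ha
  suffices ∀ n : ℕ, ∀ m, m ≤ m₀ + n → a m = 0 from this (m - m₀).toNat m (by omega)
  intro n
  induction n with
  | zero => intro m hm; exact hm₀ m (by omega)
  | succ n ih =>
    intro m hm
    obtain ⟨M, hM, hM2⟩ := ((hs m).and (eventually_ge_atTop 1)).exists
    obtain ⟨M, rfl⟩ := Nat.exists_eq_add_of_le' hM2
    have hz : ∀ p ∈ Finset.range M, psiU d A i ((p + 1 : ℕ) : ℤ) * gU d A ((p + 1 : ℕ) : ℤ) *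
        ((a (m - ((p + 1 : ℕ) : ℤ)) : Nq d A) : Uq N d A) = 0 := fun p _ => by
      rw [ih _ (by push_cast; omega), ZeroMemClass.coe_zero, mul_zero]
    rw [Finset.sum_range_succ', Finset.sum_eq_zero hz, zero_add, Nat.cast_zero, psiU_zero, gU_zero,
      mul_one, sub_zero] at hM
    have := congr_arg (G d A (Gen.Kinv i) * ·) hM
    simp only [← mul_assoc, G_Kinv_K, one_mul, mul_zero] at this
    exact Subtype.ext this

end Lift

end QAff

namespace QAff
open Filter

variable {N : ℕ} {d : Fin N → ℤ} {A : Fin N → Fin N → ℤ}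

variable (d A) in
/-- The center of `U_q`. -/
def UqCenter : Type := Subalgebra.center Fq (Uq N d A)

instance : CommRing (UqCenter d A) :=
  inferInstanceAs (CommRing (Subalgebra.center Fq (Uq N d A)))

instance : Algebra Fq (UqCenter d A) :=
  inferInstanceAs (Algebra Fq (Subalgebra.center Fq (Uq N d A)))

instance : Algebra (UqCenter d A) (Uq N d A) where
  smul c y := c.1 * y
  algebraMap := (Subalgebra.center Fq (Uq N d A)).val.toRingHom
  commutes' c y := (Subalgebra.mem_center_iff.1 c.2 y).symm
  smul_def' _ _ := rfl

instance : Algebra ℚ (UqCenter d A) := Algebra.compHom _ (algebraMap ℚ Fq)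

instance : IsScalarTower Fq (UqCenter d A) (Uq N d A) where
  smul_assoc c z y := smul_mul_assoc c z.1 y

lemma G_g2inv_comm (y : Uq N d A) : G d A Gen.g2inv * y = y * G d A Gen.g2inv := by
  calc G d A Gen.g2inv * y = G d A Gen.g2inv * (y * G d A Gen.g2) * G d A Gen.g2inv := by
        rw [mul_assoc, mul_assoc, G_g2_g2inv, mul_one]
    _ = _ := by rw [← G_g2_comm, ← mul_assoc, G_g2inv_g2, one_mul]

variable (d A) in
/-- The central unit `γ^{1/2}`. -/
def centralG : (UqCenter d A)ˣ where
  val := ⟨G d A Gen.g2, Subalgebra.mem_center_iff.2 fun y => (G_g2_comm y).symm⟩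
  inv := ⟨G d A Gen.g2inv, Subalgebra.mem_center_iff.2 fun y => (G_g2inv_comm y).symm⟩
  val_inv := Subtype.ext G_g2_g2inv
  inv_val := Subtype.ext G_g2inv_g2

lemma algebraMap_centralG :
    algebraMap (UqCenter d A) (Uq N d A) (centralG d A) = G d A Gen.g2 := rfl

lemma gU_eq (m : ℤ) : gU d A m = algebraMap (UqCenter d A) _ ↑(centralG d A ^ m) :=
  uqMk_gammaHalf algebraMap_centralG m

lemma gU_comm (m : ℤ) (y : Uq N d A) : gU d A m * y = y * gU d A m := by
  rw [gU_eq, Algebra.commutes]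

lemma gU_add (m n : ℤ) : gU d A (m + n) = gU d A m * gU d A n := by
  rw [gU_eq, gU_eq, gU_eq, zpow_add, Units.val_mul, map_mul]

lemma coe_gN (m : ℤ) : (gN d A m : Uq N d A) = gU d A m := by
  rw [gN, gU, gammaHalf]
  split_ifs <;> rw [map_pow] <;> rfl

lemma rep_eq_zero (H : CartanHyp d A) (i : Fin N) {a b : ℤ → Nq d A}
    (ha : ∃ m₀, ∀ m, m ≤ m₀ → a m = 0) (hb : ∃ m₁, ∀ m, m₁ ≤ m → b m = 0)
    (hs : ∀ k : ℤ, ∀ᶠ M : ℕ in atTop,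
      ∑ p ∈ Finset.range M, psiU d A i p * gU d A p * (a (k - p) : Uq N d A) -
        ∑ p ∈ Finset.range M, phiU d A i (-p) * gU d A p * (b (k + p) : Uq N d A) = 0) :
    (∀ m, a m = 0) ∧ ∀ m, b m = 0 := by
  have hb0 : ∀ m, b m = 0 := rep_eq_zero_right H algebraMap_centralG i hb hs
  refine ⟨rep_eq_zero_left i ha fun k => (hs k).mono fun M hM => ?_, hb0⟩
  simpa [hb0] using hM

/-- The coefficients of the structure functions. -/
def structCoeff {F : Type*} [Field F] (a : F) : ℕ → F
  | 0 => a
  | r + 1 => a ^ (r + 2) - a ^ r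

/-- The Taylor coefficients in the expansion of the Drinfeld currents are `structCoeff`. -/
lemma algebraMap_structCoeff {R : Type*} [CommRing R] [Algebra Fq R] {a : Fq} {P : Rˣ}
    (hP : (↑P⁻¹ : R) = algebraMap Fq R a) (r : ℕ) :
    ↑P⁻¹ * expCoeff P r = algebraMap Fq R (structCoeff a r) := by
  rcases r with _ | r
  · simp [expCoeff, structCoeff, hP]
  · have : (↑P : R) * ↑P⁻¹ = 1 := P.mul_inv
    simp only [expCoeff, structCoeff, ← hP, map_sub, map_pow]
    linear_combination (-(↑P⁻¹ : R) ^ r) * this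

variable (d A) in
/-- The normalized modes `γ^{p/2} ψ_{i,p}`. -/
def psiMode (i : Fin N) (p : ℕ) : Uq N d A := psiU d A i p * gU d A p

variable (d A) in
/-- The normalized modes `γ^{p/2} φ_{i,-p}`. -/
def phiMode (i : Fin N) (p : ℕ) : Uq N d A := phiU d A i (-p) * gU d A p

variable (d A) in
/-- The normalized modes `γ^s x⁻_{a,s}`. -/
def xUp (a : Fin N) (s : ℤ) : Nq d A := gN d A (2 * s) * xmN d A a s

variable (d A) in
/-- The normalized modes `γ^s x⁻_{a,-s}`. -/
def xDown (a : Fin N) (s : ℤ) : Nq d A := gN d A (2 * s) * xmN d A a (-s)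

lemma psiU_eq (H : CartanHyp d A) (i : Fin N) (m : ℤ) :
    psiU d A i m = psi (uqData H (centralG d A)) (fun i k => G d A (Gen.h i k))
      (fun i => G d A (Gen.K i)) i m :=
  map_psiEl H (uqMk d A) i m

lemma phiU_eq (H : CartanHyp d A) (i : Fin N) (m : ℤ) :
    phiU d A i m = phi (uqData H (centralG d A)) (fun i k => G d A (Gen.h i k))
      (fun i => G d A (Gen.Kinv i)) i m :=
  map_phiEl H (uqMk d A) i m

lemma centralG_pow_smul (r : ℕ) (y : Uq N d A) :
    (centralG d A : UqCenter d A) ^ r • y = gU d A r * y := by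
  rw [gU_eq, zpow_natCast, Units.val_pow_eq_pow_val, Algebra.smul_def]

lemma xm_psiU (H : CartanHyp d A) (i a : Fin N) (s : ℤ) (n : ℕ) :
    G d A (Gen.xm a s) * psiU d A i n = ∑ r ∈ Finset.range (n + 1),
      structCoeff (qp d A i a) r •
        (gU d A r * (psiU d A i ((n - r : ℕ) : ℤ) * G d A (Gen.xm a (s + r)))) := by
  have h := (exchange_uq H algebraMap_centralG).x_psi i a s n
  simp only [← psiU_eq H] at h
  rw [h]
  refine Finset.sum_congr rfl fun r _ => ?_
  rw [algebraMap_structCoeff (a := qp d A i a) (by rw [inv_inv, coe_uqData_p]), mul_smul,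
    algebraMap_smul]
  congr 1
  exact centralG_pow_smul _ _

lemma xm_phiU (H : CartanHyp d A) (i a : Fin N) (s : ℤ) (n : ℕ) :
    G d A (Gen.xm a s) * phiU d A i (-n) = ∑ r ∈ Finset.range (n + 1),
      structCoeff (qp d A i a)⁻¹ r •
        (gU d A r * (phiU d A i (-((n - r : ℕ) : ℤ)) * G d A (Gen.xm a (s - r)))) := by
  have h := (exchange_uq H algebraMap_centralG).x_phi i a s n
  simp only [← phiU_eq H] at h
  rw [h]
  refine Finset.sum_congr rfl fun r _ => ?_
  have := algebraMap_structCoeff (P := (uqData H (centralG d A)).p i a) (a := (qp d A i a)⁻¹)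
    (coe_uqData_p_inv H _ i a) r
  simp only [inv_inv]
  rw [this, mul_smul, algebraMap_smul]
  congr 1
  exact centralG_pow_smul _ _

lemma xp_xm (H : CartanHyp d A) (i a : Fin N) (k s : ℤ) :
    G d A (Gen.xp i k) * G d A (Gen.xm a s) - G d A (Gen.xm a s) * G d A (Gen.xp i k) =
      if i = a then (qi d i - (qi d i)⁻¹)⁻¹ • (gU d A (k - s) * psiU d A i (k + s) -
        gU d A (s - k) * phiU d A i (k + s)) else 0 := by
  rw [xp_xm_uq H algebraMap_centralG]
  split_ifs
  · rw [bracket, ← psiU_eq, ← phiU_eq, coe_uqData_κ_inv, algebraMap_smul, gU_eq, gU_eq,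
      ← Algebra.smul_def, ← Algebra.smul_def]
    rfl
  · rfl

lemma coe_xUp (a : Fin N) (s : ℤ) :
    (xUp d A a s : Uq N d A) = gU d A (2 * s) * G d A (Gen.xm a s) := by
  rw [xUp, MulMemClass.coe_mul, coe_gN]; rfl

lemma coe_xDown (a : Fin N) (s : ℤ) :
    (xDown d A a s : Uq N d A) = gU d A (2 * s) * G d A (Gen.xm a (-s)) := by
  rw [xDown, MulMemClass.coe_mul, coe_gN]; rfl

lemma xUp_psiMode (H : CartanHyp d A) (i a : Fin N) (s : ℤ) (n : ℕ) :
    (xUp d A a s : Uq N d A) * psiMode d A i n = ∑ r ∈ Finset.range (n + 1),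
      structCoeff (qp d A i a) r • (psiMode d A i (n - r) * xUp d A a (s + r)) := by
  rw [coe_xUp, psiMode, ← gU_comm, mul_assoc, ← mul_assoc _ (gU d A n), ← gU_comm, mul_assoc,
    xm_psiU H, ← mul_assoc, Finset.mul_sum]
  refine Finset.sum_congr rfl fun r hr => ?_
  have hr' : r ≤ n := by simpa [Nat.lt_succ_iff] using hr
  rw [coe_xUp, psiMode, mul_smul_comm, ← gU_add, ← mul_assoc, ← gU_add, mul_assoc, ← mul_assoc (gU d A _) (gU d A _), ← gU_add, gU_comm, gU_comm _ (G _ _ _), mul_assoc]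
  congr 4
  push_cast [hr']
  ring

lemma xDown_phiMode (H : CartanHyp d A) (i a : Fin N) (s : ℤ) (n : ℕ) :
    (xDown d A a s : Uq N d A) * phiMode d A i n = ∑ r ∈ Finset.range (n + 1),
      structCoeff (qp d A i a)⁻¹ r • (phiMode d A i (n - r) * xDown d A a (s + r)) := by
  rw [coe_xDown, phiMode, ← gU_comm, mul_assoc, ← mul_assoc _ (gU d A n), ← gU_comm, mul_assoc,
    xm_phiU H, ← mul_assoc, Finset.mul_sum]
  refine Finset.sum_congr rfl fun r hr => ?_
  have hr' : r ≤ n := by simpa [Nat.lt_succ_iff] using hr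
  rw [coe_xDown, phiMode, mul_smul_comm, ← gU_add, ← mul_assoc, ← gU_add, mul_assoc, ← mul_assoc (gU d A _) (gU d A _), ← gU_add, gU_comm, gU_comm _ (G _ _ _), mul_assoc,
    neg_add, ← sub_eq_add_neg]
  congr 4
  push_cast [hr']
  ring

end QAff

namespace QAff
open Filter

section Quadratic

variable {F V ι : Type*} [Field F] [AddCommGroup V] [Module F V]

/-- The coefficients `structCoeff` extended by zero to negative indices. -/
def structCoeffInt (a : F) (u : ℤ) : F := if 0 ≤ u then structCoeff a u.toNat else 0

lemma structCoeffInt_recurrence (a : F) (u : ℤ) :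
    a * structCoeffInt a u - (if u = 0 then 1 else 0) - structCoeffInt a (u + 1) +
      (if u = -1 then a else 0) = 0 := by
  obtain hu | rfl | rfl | hu : u < -1 ∨ u = -1 ∨ u = 0 ∨ 0 < u := by omega
  · simp [structCoeffInt, show ¬ 0 ≤ u by omega, show u ≠ 0 by omega, show ¬ 0 ≤ u + 1 by omega,
      show u ≠ -1 by omega]
  · simp [structCoeffInt, structCoeff]
  · simp [structCoeffInt, structCoeff]
    ring
  · obtain ⟨n, rfl⟩ : ∃ n : ℕ, u = n + 1 := ⟨(u - 1).toNat, by omega⟩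
    rw [structCoeffInt, structCoeffInt, if_pos hu.le, if_pos (hu.le.trans (by omega)),
      if_neg hu.ne', if_neg (show ¬ (n : ℤ) + 1 = -1 by omega),
      show ((n : ℤ) + 1).toNat = n + 1 by omega,
      show ((n : ℤ) + 1 + 1).toNat = n + 1 + 1 by omega, structCoeff, structCoeff]
    ring

lemma structCoeffInt_recurrence_smul (a : F) (u : ℤ) (w : V) :
    (a * structCoeffInt a u) • w - (if u = 0 then w else 0) - structCoeffInt a (u + 1) • w +
      (if u = -1 then a • w else 0) = 0 := by
  have := congr_arg (· • w) (structCoeffInt_recurrence a u)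
  simpa only [add_smul, sub_smul, ite_smul, one_smul, zero_smul] using this

lemma structCoeffInt_boundary (a : F) (f : ℤ → V) (s k l : ℤ) :
    a • structCoeffInt a (-s - (k + 1)) • f (l + s + (k + 1)) - (if k + 1 = -s then f l else 0) -
      structCoeffInt a (-s - k) • f (l + 1 + s + k) + a • (if k = -s then f (l + 1) else 0) = 0 := by
  have h := structCoeffInt_recurrence_smul a (-s - (k + 1)) (f (l + s + (k + 1)))
  rw [show l + 1 + s + k = l + s + (k + 1) by ring, smul_smul, smul_ite, smul_zero]
  rw [show -s - (k + 1) + 1 = -s - k by ring] at h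
  have h1 : (if k + 1 = -s then f l else 0) = if -s - (k + 1) = 0 then f (l + s + (k + 1)) else 0 := by
    split_ifs <;> first | omega | (congr 1; omega) | rfl
  have h2 : (if k = -s then a • f (l + 1) else 0) =
      if -s - (k + 1) = -1 then a • f (l + s + (k + 1)) else 0 := by
    split_ifs <;> first | omega | (congr 2; omega) | rfl
  rw [h1, h2, h]

variable [DecidableEq ι]

/-- The commutation rule between operators `Ω_i(m)` and `X_a(s)`. -/
structure ModeRule (P : ι → ι → F) (X Ω : ι → ℤ → Module.End F V) : Prop where
  low : ∀ i v, ∃ m₀, ∀ m ≤ m₀, Ω i m v = 0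
  rule : ∀ i a m s v (M : ℕ), (∀ r, M ≤ r → Ω i (m - r) v = 0) →
    Ω i m (X a s v) = (if i = a ∧ m = -s then v else 0) +
      ∑ r ∈ Finset.range M, structCoeff (P i a) r • X a (s + r) (Ω i (m - r) v)

/-- The defect of the quadratic relation. -/
def quadDefect (p : F) (Ωi Ωj : ℤ → Module.End F V) (k l : ℤ) : Module.End F V :=
  p • (Ωi (k + 1) * Ωj l) - Ωj l * Ωi (k + 1) - Ωi k * Ωj (l + 1) + p • (Ωj (l + 1) * Ωi k)

lemma quadDefect_apply (p : F) (Ωi Ωj : ℤ → Module.End F V) (k l : ℤ) (v : V) :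
    quadDefect p Ωi Ωj k l v = p • Ωi (k + 1) (Ωj l v) - Ωj l (Ωi (k + 1) v) -
      Ωi k (Ωj (l + 1) v) + p • Ωj (l + 1) (Ωi k v) := rfl

lemma quadDefect_map (p : F) {Ωi Ωj : ℤ → Module.End F V} {L : Module.End F V}
    (hi : ∀ m v, Ωi m (L v) = L (Ωi m v)) (hj : ∀ m v, Ωj m (L v) = L (Ωj m v)) (k l : ℤ) (v : V) :
    quadDefect p Ωi Ωj k l (L v) = L (quadDefect p Ωi Ωj k l v) := by
  simp only [quadDefect_apply, hi, hj, map_add, map_sub, map_smul]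

namespace ModeRule

variable {P : ι → ι → F} {X Ω : ι → ℤ → Module.End F V} (h : ModeRule P X Ω)
include h

lemma eventually_zero (i : ι) (m : ℤ) (v : V) :
    ∀ᶠ M : ℕ in atTop, ∀ r, M ≤ r → Ω i (m - r) v = 0 := by
  obtain ⟨m₀, h0⟩ := h.low i v
  filter_upwards [eventually_ge_atTop (m - m₀).toNat] with M hM r hr
  exact h0 _ (by omega)

lemma eventually_zero_range (i : ι) (m : ℤ) (v : ℕ → V) (n : ℕ) :
    ∀ᶠ M : ℕ in atTop, ∀ r < n, ∀ t, M ≤ t → Ω i (m - t) (v r) = 0 := by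
  induction n with
  | zero => simp
  | succ n ih =>
    filter_upwards [ih, h.eventually_zero i m (v n)] with M h1 h2 r hr
    obtain hr | rfl := Nat.lt_succ_iff_lt_or_eq.1 hr
    · exact h1 r hr
    · exact h2

lemma mul_rule (i j a : ι) (m n s : ℤ) (v : V) :
    ∀ᶠ M : ℕ in atTop, Ω i m (Ω j n (X a s v)) =
      (if j = a ∧ n = -s then Ω i m v else 0) +
      (if i = a then structCoeffInt (P j a) (-s - m) • Ω j (n + s + m) v else 0) +
      ∑ r ∈ Finset.range M, ∑ t ∈ Finset.range M, (structCoeff (P j a) r * structCoeff (P i a) t) •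
        X a (s + r + t) (Ω i (m - t) (Ω j (n - r) v)) := by
  obtain ⟨M₀, h0⟩ := (h.eventually_zero j n v).exists
  filter_upwards [h.eventually_zero_range i m (fun r => Ω j (n - r) v) M₀,
    eventually_ge_atTop M₀, eventually_gt_atTop (-s - m).toNat] with M h1 h2 h3
  rw [h.rule j a n s v M fun r hr => h0 r (h2.trans hr), map_add, map_sum, add_assoc]
  congr 1
  · split_ifs <;> simp
  have : ∀ r ∈ Finset.range M, Ω i m (structCoeff (P j a) r • X a (s + r) (Ω j (n - r) v)) =
      (if i = a ∧ m = -(s + r) then structCoeff (P j a) r • Ω j (n - r) v else 0) +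
      ∑ t ∈ Finset.range M, (structCoeff (P j a) r * structCoeff (P i a) t) •
        X a (s + r + t) (Ω i (m - t) (Ω j (n - r) v)) := fun r _ => by
    rw [map_smul, h.rule i a m (s + r) _ M, smul_add, Finset.smul_sum]
    · simp only [smul_smul, smul_ite, smul_zero]
    · intro t ht
      rcases lt_or_ge r M₀ with hr | hr
      · exact h1 r hr t ht
      · rw [h0 r hr, map_zero]
  rw [Finset.sum_congr rfl this, Finset.sum_add_distrib]
  congr 1
  by_cases hia : i = a
  · simp only [hia, true_and, if_true, structCoeffInt]
    split_ifs with hu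
    · rw [Finset.sum_eq_single (-s - m).toNat, if_pos (by omega)]
      · congr 3; omega
      · intro r _ hr; exact if_neg (by omega)
      · intro hr; exact absurd (Finset.mem_range.2 h3) hr
    · rw [zero_smul]
      exact Finset.sum_eq_zero fun r _ => if_neg (by omega)
  · simp [hia]

lemma quadDefect_X (hP : ∀ i j, P i j = P j i) {i j : ι} {v : V}
    (hv : ∀ k l, quadDefect (P i j) (Ω i) (Ω j) k l v = 0) (a : ι) (s k l : ℤ) :
    quadDefect (P i j) (Ω i) (Ω j) k l (X a s v) = 0 := by
  obtain ⟨M, h1, h2, h3, h4⟩ := ((h.mul_rule i j a (k + 1) l s v).and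
    ((h.mul_rule j i a l (k + 1) s v).and ((h.mul_rule i j a k (l + 1) s v).and
      (h.mul_rule j i a (l + 1) k s v)))).exists
  have hD : P i j • (∑ r ∈ Finset.range M, ∑ t ∈ Finset.range M,
        (structCoeff (P j a) r * structCoeff (P i a) t) •
          X a (s + r + t) (Ω i (k + 1 - t) (Ω j (l - r) v))) -
      (∑ r ∈ Finset.range M, ∑ t ∈ Finset.range M,
        (structCoeff (P i a) r * structCoeff (P j a) t) •
          X a (s + r + t) (Ω j (l - t) (Ω i (k + 1 - r) v))) -
      (∑ r ∈ Finset.range M, ∑ t ∈ Finset.range M,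
        (structCoeff (P j a) r * structCoeff (P i a) t) •
          X a (s + r + t) (Ω i (k - t) (Ω j (l + 1 - r) v))) +
      P i j • (∑ r ∈ Finset.range M, ∑ t ∈ Finset.range M,
        (structCoeff (P i a) r * structCoeff (P j a) t) •
          X a (s + r + t) (Ω j (l + 1 - t) (Ω i (k - r) v))) = 0 := by
    rw [Finset.sum_comm (f := fun r t => (structCoeff (P i a) r * structCoeff (P j a) t) •
          X a (s + r + t) (Ω j (l - t) (Ω i (k + 1 - r) v))),
      Finset.sum_comm (f := fun r t => (structCoeff (P i a) r * structCoeff (P j a) t) •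
          X a (s + r + t) (Ω j (l + 1 - t) (Ω i (k - r) v)))]
    simp only [Finset.smul_sum, ← Finset.sum_sub_distrib, ← Finset.sum_add_distrib]
    refine Finset.sum_eq_zero fun r _ => Finset.sum_eq_zero fun t _ => ?_
    have := congr_arg (fun w => (structCoeff (P j a) r * structCoeff (P i a) t) •
      X a (s + r + t) w) (hv (k - t) (l - r))
    simp only [quadDefect_apply, map_add, map_sub, map_smul, map_zero, smul_zero] at this
    rw [← this, add_right_comm s (t : ℤ), show k - (t : ℤ) + 1 = k + 1 - t by ring,
      show l - (r : ℤ) + 1 = l + 1 - r by ring]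
    module
  simp only [quadDefect_apply]
  rw [h1, h2, h3, h4]
  have hA := structCoeffInt_boundary (P i j) (fun n => Ω j n v) s k l
  have hB := structCoeffInt_boundary (P i j) (fun n => Ω i n v) s l k
  generalize (∑ r ∈ Finset.range M, ∑ t ∈ Finset.range M,
        (structCoeff (P j a) r * structCoeff (P i a) t) •
          X a (s + r + t) (Ω i (k + 1 - t) (Ω j (l - r) v))) = S₁ at hD ⊢
  generalize (∑ r ∈ Finset.range M, ∑ t ∈ Finset.range M,
        (structCoeff (P i a) r * structCoeff (P j a) t) •
          X a (s + r + t) (Ω j (l - t) (Ω i (k + 1 - r) v))) = S₂ at hD ⊢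
  generalize (∑ r ∈ Finset.range M, ∑ t ∈ Finset.range M,
        (structCoeff (P j a) r * structCoeff (P i a) t) •
          X a (s + r + t) (Ω i (k - t) (Ω j (l + 1 - r) v))) = S₃ at hD ⊢
  generalize (∑ r ∈ Finset.range M, ∑ t ∈ Finset.range M,
        (structCoeff (P i a) r * structCoeff (P j a) t) •
          X a (s + r + t) (Ω j (l + 1 - t) (Ω i (k - r) v))) = S₄ at hD ⊢
  clear h1 h2 h3 h4
  by_cases hia : i = a <;> by_cases hja : j = a <;>
    simp only [hia, hja, true_and, false_and, if_true, if_false, add_zero, zero_add, hP j a]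
      at hA hB hD ⊢
  · linear_combination (norm := module) hA + hB + hD
  · linear_combination (norm := module) hA + hD
  · linear_combination (norm := module) hB + hD
  · exact hD

end ModeRule

end Quadratic

end QAff

namespace QAff
open Filter

lemma sum_range_eq_sum_range {V : Type*} [AddCommMonoid V] {f : ℕ → V} {m n : ℕ}
    (hm : ∀ r, m ≤ r → f r = 0) (hn : ∀ r, n ≤ r → f r = 0) :
    ∑ r ∈ Finset.range m, f r = ∑ r ∈ Finset.range n, f r := by
  rcases le_total m n with h | h
  · exact (Finset.eventually_constant_sum hm h).symm
  · exact Finset.eventually_constant_sum hn h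

section ModeSum

variable {F U : Type*} [Field F] [Ring U] [Algebra F U] {Ψ : ℕ → U} {a b : ℤ → U} {k : ℤ}
  {c c' : U}

/-- The partial sums of `∑_p Ψ_p a_{k-p}` are eventually equal to `c`. -/
def HasModeSum (Ψ : ℕ → U) (a : ℤ → U) (k : ℤ) (c : U) : Prop :=
  ∀ᶠ M : ℕ in atTop, ∑ p ∈ Finset.range M, Ψ p * a (k - p) = c

lemma hasModeSum_of_le (M₀ : ℕ) (h : ∀ p : ℕ, M₀ ≤ p → a (k - p) = 0) :
    HasModeSum Ψ a k (∑ p ∈ Finset.range M₀, Ψ p * a (k - p)) := by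
  filter_upwards [eventually_ge_atTop M₀] with M hM
  exact Finset.eventually_constant_sum (fun p hp => by rw [h p hp, mul_zero]) hM

lemma HasModeSum.congr (ha : HasModeSum Ψ a k c) (h : ∀ m, b m = a m) : HasModeSum Ψ b k c := by
  rwa [funext h]

lemma HasModeSum.add (ha : HasModeSum Ψ a k c) (hb : HasModeSum Ψ b k c') :
    HasModeSum Ψ (fun m => a m + b m) k (c + c') := by
  filter_upwards [ha, hb] with M h1 h2
  simp only [mul_add, Finset.sum_add_distrib, h1, h2]

lemma HasModeSum.central_mul (ha : HasModeSum Ψ a k c) {z : U} (hz : ∀ y, z * y = y * z) :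
    HasModeSum Ψ (fun m => z * a m) k (z * c) := by
  filter_upwards [ha] with M h1
  rw [← h1, Finset.mul_sum]
  exact Finset.sum_congr rfl fun p _ => by rw [← mul_assoc, ← mul_assoc, hz]

lemma hasModeSum_single (Ψ : ℕ → U) (t : ℤ) (Q : U) (k : ℤ) :
    HasModeSum Ψ (fun m => if m = t then Q else 0) k
      (if t ≤ k then Ψ (k - t).toNat * Q else 0) := by
  filter_upwards [eventually_gt_atTop (k - t).toNat] with M hM
  split_ifs with h
  · rw [Finset.sum_eq_single (k - t).toNat, if_pos (by omega)]
    · intro p _ hp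
      rw [if_neg (by omega), mul_zero]
    · exact fun hp => absurd (Finset.mem_range.2 hM) hp
  · exact Finset.sum_eq_zero fun p _ => by rw [if_neg (by omega), mul_zero]

lemma HasModeSum.exchange {X : ℤ → U} {C : ℕ → F}
    (hX : ∀ s n, X s * Ψ n = ∑ r ∈ Finset.range (n + 1), C r • (Ψ (n - r) * X (s + r)))
    (ha : HasModeSum Ψ a k c) {B : ℤ} (hB : ∀ m ≤ B, a m = 0) (s : ℤ) :
    HasModeSum Ψ (fun m => ∑ r ∈ Finset.range (m - B).toNat, C r • (X (s + r) * a (m - r))) k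
      (X s * c) := by
  filter_upwards [ha, eventually_ge_atTop (k - B).toNat] with M h1 hM
  have h2 : ∀ p ∈ Finset.range M, X s * (Ψ p * a (k - p)) = ∑ r ∈ Finset.range (p + 1),
      C r • (Ψ (p - r) * (X (s + r) * a (k - (p - r : ℕ) - r))) := fun p _ => by
    rw [← mul_assoc, hX, Finset.sum_mul]
    refine Finset.sum_congr rfl fun r hr => ?_
    have hr' : r ≤ p := Nat.lt_succ_iff.1 (Finset.mem_range.1 hr)
    rw [smul_mul_assoc, mul_assoc, show k - ((p - r : ℕ) : ℤ) - r = k - p by omega]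
  rw [← h1, Finset.mul_sum, Finset.sum_congr rfl h2, Finset.sum_range_diag_flip M fun r n =>
    C r • (Ψ n * (X (s + r) * a (k - n - r)))]
  have h3 : ∀ r ∈ Finset.range M, ∑ n ∈ Finset.range (M - r),
      C r • (Ψ n * (X (s + r) * a (k - n - r))) =
      ∑ n ∈ Finset.range M, C r • (Ψ n * (X (s + r) * a (k - n - r))) := fun r _ =>
    (Finset.eventually_constant_sum (fun n hn => by
      rw [hB _ (by omega), mul_zero, mul_zero, smul_zero]) (Nat.sub_le M r)).symm
  rw [Finset.sum_congr rfl h3, Finset.sum_comm]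
  refine Finset.sum_congr rfl fun n _ => ?_
  simp only [← mul_smul_comm _ (Ψ n), ← Finset.mul_sum]
  congr 1
  refine (Finset.eventually_constant_sum (fun r hr => ?_) (by omega)).symm
  simp only [hB (k - n - r) (by omega), mul_zero, smul_zero]

lemma commutator_mul (x y z : U) :
    x * (y * z) - y * z * x = (x * y - y * x) * z + y * (x * z - z * x) := by
  noncomm_ring

end ModeSum

variable {N : ℕ} {d : Fin N → ℤ} {A : Fin N → Fin N → ℤ}

lemma psiU_of_neg {i : Fin N} {m : ℤ} (hm : m < 0) : psiU d A i m = 0 := by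
  rw [psiU, psiEl, if_neg hm.not_ge, map_zero]

lemma phiU_of_pos {i : Fin N} {m : ℤ} (hm : 0 < m) : phiU d A i m = 0 := by
  rw [phiU, phiEl, if_neg hm.not_ge, map_zero]

lemma gU_mul_psiMode (i : Fin N) (k s : ℤ) (Q : Uq N d A) :
    gU d A (-2 * s) * (if -s ≤ k then psiMode d A i (k - -s).toNat * Q else 0) =
      gU d A (k - s) * psiU d A i (k + s) * Q := by
  split_ifs with h
  · rw [psiMode, ← gU_comm, mul_assoc, ← mul_assoc, ← gU_add, ← mul_assoc,
      show (((k - -s).toNat : ℕ) : ℤ) = k + s by omega, show -2 * s + (k + s) = k - s by ring]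
  · rw [psiU_of_neg (by omega), mul_zero, mul_zero, zero_mul]

lemma gU_mul_phiMode (i : Fin N) (k s : ℤ) (Q : Uq N d A) :
    gU d A (2 * s) * (if s ≤ -k then phiMode d A i (-k - s).toNat * Q else 0) =
      gU d A (s - k) * phiU d A i (k + s) * Q := by
  split_ifs with h
  · rw [phiMode, ← gU_comm, mul_assoc, ← mul_assoc, ← gU_add, ← mul_assoc,
      show (((-k - s).toNat : ℕ) : ℤ) = -k - s by omega, show 2 * s + (-k - s) = s - k by ring,
      show -(-k - s) = k + s by ring]
  · rw [phiU_of_pos (by omega), mul_zero, mul_zero, zero_mul]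

lemma gU_mul_xUp (j : Fin N) (s : ℤ) :
    gU d A (-2 * s) * xUp d A j s = G d A (Gen.xm j s) := by
  rw [coe_xUp, ← mul_assoc, ← gU_add, show -2 * s + 2 * s = 0 by ring, gU_zero, one_mul]

lemma gU_mul_xDown (j : Fin N) (s : ℤ) :
    gU d A (2 * s) * xDown d A j (-s) = G d A (Gen.xm j s) := by
  rw [coe_xDown, ← mul_assoc, ← gU_add, show 2 * s + 2 * -s = 0 by ring, gU_zero, one_mul, neg_neg]

lemma coe_xmN (j : Fin N) (s : ℤ) : (xmN d A j s : Uq N d A) = G d A (Gen.xm j s) := rfl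

/-- The sequences `a` and `b` expand the commutators `[x⁺_{i,k}, P]` in the normalized modes. -/
structure IsExpansion (i : Fin N) (P : Nq d A) (a b : ℤ → Nq d A) : Prop where
  low_left : ∃ m₀, ∀ m ≤ m₀, a m = 0
  low_right : ∃ m₀, ∀ m ≤ m₀, b m = 0
  expand : ∀ k, ∃ c c', HasModeSum (psiMode d A i) (fun m => (a m : Uq N d A)) k c ∧
    HasModeSum (phiMode d A i) (fun m => (b m : Uq N d A)) (-k) c' ∧
    (qi d i - (qi d i)⁻¹) • (G d A (Gen.xp i k) * P - P * G d A (Gen.xp i k)) = c - c'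

namespace IsExpansion

variable {i : Fin N} {P : Nq d A} {a b a' b' : ℤ → Nq d A}

lemma ext (H : CartanHyp d A) (h : IsExpansion i P a b) (h' : IsExpansion i P a' b') :
    (∀ m, a m = a' m) ∧ ∀ m, b m = b' m := by
  obtain ⟨m₁, h1⟩ := h.low_left
  obtain ⟨m₂, h2⟩ := h.low_right
  obtain ⟨m₁', h1'⟩ := h'.low_left
  obtain ⟨m₂', h2'⟩ := h'.low_right
  have := rep_eq_zero H i (a := fun m => a m - a' m) (b := fun m => b (-m) - b' (-m))
    ⟨min m₁ m₁', fun m hm => sub_eq_zero.2 ((h1 m (by omega)).trans (h1' m (by omega)).symm)⟩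
    ⟨max (-m₂) (-m₂'), fun m hm => sub_eq_zero.2 ((h2 (-m) (by omega)).trans (h2' (-m) (by omega)).symm)⟩
    fun k => ?_
  · refine ⟨fun m => sub_eq_zero.1 (this.1 m), fun m => sub_eq_zero.1 ?_⟩
    simpa only [neg_neg] using this.2 (-m)
  · obtain ⟨c, c', hc, hc', hk⟩ := h.expand k
    obtain ⟨e, e', he, he', hk'⟩ := h'.expand k
    filter_upwards [hc, hc', he, he'] with M h1 h2 h3 h4
    simp only [psiMode, phiMode] at h1 h2 h3 h4
    simp only [AddSubgroupClass.coe_sub, mul_sub, Finset.sum_sub_distrib, neg_add']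
    rw [h1, h2, h3, h4, sub_sub_sub_comm, ← hk, ← hk', sub_self]

lemma gN_mul (h : IsExpansion i P a b) (z : ℤ) :
    IsExpansion i (gN d A z * P) (fun m => gN d A z * a m) (fun m => gN d A z * b m) where
  low_left := h.low_left.imp fun _ h m hm => by rw [h m hm, mul_zero]
  low_right := h.low_right.imp fun _ h m hm => by rw [h m hm, mul_zero]
  expand k := by
    obtain ⟨c, c', hc, hc', hk⟩ := h.expand k
    refine ⟨gU d A z * c, gU d A z * c', ?_, ?_, ?_⟩
    · simpa only [MulMemClass.coe_mul, coe_gN] using hc.central_mul (gU_comm z)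
    · simpa only [MulMemClass.coe_mul, coe_gN] using hc'.central_mul (gU_comm z)
    · rw [← mul_sub, ← hk, MulMemClass.coe_mul, coe_gN, mul_smul_comm, mul_sub, ← mul_assoc,
        ← gU_comm, mul_assoc, mul_assoc]

variable (d A) in
lemma one (i : Fin N) : IsExpansion i (1 : Nq d A) (fun _ => 0) (fun _ => 0) where
  low_left := ⟨0, fun _ _ => rfl⟩
  low_right := ⟨0, fun _ _ => rfl⟩
  expand k := ⟨0, 0, Eventually.of_forall fun M => Finset.sum_eq_zero fun p _ => by
      rw [ZeroMemClass.coe_zero, mul_zero], Eventually.of_forall fun M =>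
        Finset.sum_eq_zero fun p _ => by rw [ZeroMemClass.coe_zero, mul_zero], by
      rw [OneMemClass.coe_one, mul_one, one_mul, sub_self, sub_self, smul_zero]⟩

lemma xmN_mul (H : CartanHyp d A) (h : IsExpansion i P a b) {B B' : ℤ}
    (hB : ∀ m ≤ B, a m = 0) (hB' : ∀ m ≤ B', b m = 0) (j : Fin N) (s : ℤ) :
    IsExpansion i (xmN d A j s * P)
      (fun m => gN d A (-2 * s) * ((if i = j ∧ m = -s then P else 0) +
        ∑ r ∈ Finset.range (m - B).toNat,
          structCoeff (qp d A i j) r • (xUp d A j (s + r) * a (m - r))))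
      (fun m => gN d A (2 * s) * ((if i = j ∧ m = s then P else 0) +
        ∑ r ∈ Finset.range (m - B').toNat,
          structCoeff (qp d A i j)⁻¹ r • (xDown d A j (-s + r) * b (m - r)))) where
  low_left := ⟨min B (-s - 1), fun m hm => by
    rw [if_neg (by omega), show (m - B).toNat = 0 by omega, Finset.sum_range_zero, add_zero,
      mul_zero]⟩
  low_right := ⟨min B' (s - 1), fun m hm => by
    rw [if_neg (by omega), show (m - B').toNat = 0 by omega, Finset.sum_range_zero, add_zero,
      mul_zero]⟩
  expand k := by
    obtain ⟨c, c', hc, hc', hk⟩ := h.expand k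
    have h1 := ((hasModeSum_single (psiMode d A i) (-s) (if i = j then (P : Uq N d A) else 0) k).add
      (hc.exchange (xUp_psiMode H i j) (by simpa using hB) s)).central_mul (gU_comm (-2 * s))
    have h2 := ((hasModeSum_single (phiMode d A i) s (if i = j then (P : Uq N d A) else 0) (-k)).add
      (hc'.exchange (xDown_phiMode H i j) (by simpa using hB') (-s))).central_mul (gU_comm (2 * s))
    refine ⟨_, _, h1.congr fun m => ?_, h2.congr fun m => ?_, ?_⟩
    · simp only [MulMemClass.coe_mul, coe_gN, AddMemClass.coe_add, AddSubmonoidClass.coe_finsetSum,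
        SetLike.val_smul]
      congr 2
      split_ifs <;> simp_all
    · simp only [MulMemClass.coe_mul, coe_gN, AddMemClass.coe_add, AddSubmonoidClass.coe_finsetSum,
        SetLike.val_smul]
      congr 2
      split_ifs <;> simp_all
    · rw [mul_add, mul_add, gU_mul_psiMode, gU_mul_phiMode, ← mul_assoc _ (xUp d A j s : Uq N d A),
        ← mul_assoc _ (xDown d A j (-s) : Uq N d A), gU_mul_xUp, gU_mul_xDown]
      have hx := xp_xm H i j k s
      have hq := mul_inv_cancel₀ (qi_sub_inv_ne_zero (H.pos i))
      rw [MulMemClass.coe_mul, coe_xmN, commutator_mul, hx, smul_add,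
        ← mul_smul_comm _ (G d A (Gen.xm j s)), hk]
      split_ifs
      · rw [smul_mul_assoc, smul_smul, hq, one_smul, sub_mul, mul_sub, add_sub_add_comm]
      · rw [zero_mul, smul_zero, mul_zero, mul_zero, mul_sub, zero_add, zero_add, zero_add]

end IsExpansion

lemma _root_.IsOmegaFamily.isExpansion {Ωψ Ωφ : Fin N → ℤ → Nq d A →ₗ[Fq] Nq d A}
    (h : IsOmegaFamily d A Ωψ Ωφ) (H : CartanHyp d A) (i : Fin N) (P : Nq d A) :
    IsExpansion i P (fun m => Ωψ i m P) (fun m => Ωφ i (-m) P) where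
  low_left := h.1 i P
  low_right := by
    obtain ⟨b, hb⟩ := h.2.1 i P
    exact ⟨-b, fun m hm => hb _ (by omega)⟩
  expand k := by
    obtain ⟨M, hM, hk⟩ := h.2.2 i k P
    refine ⟨_, _, hasModeSum_of_le (M + 1) fun p hp => ?_,
      hasModeSum_of_le (M + 1) fun p hp => ?_, ?_⟩
    · rw [(hM p hp).1, ZeroMemClass.coe_zero]
    · rw [neg_sub, sub_neg_eq_add, add_comm, (hM p hp).2, ZeroMemClass.coe_zero]
    · rw [hk, smul_smul, mul_inv_cancel₀ (qi_sub_inv_ne_zero (H.pos i)), one_smul]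
      simp only [psiMode, phiMode, neg_sub, sub_neg_eq_add, add_comm]

end QAff

namespace QAff
open Filter

variable {N : ℕ} {d : Fin N → ℤ} {A : Fin N → Fin N → ℤ}

lemma gN_add (m n : ℤ) : gN d A (m + n) = gN d A m * gN d A n :=
  Subtype.ext (by rw [MulMemClass.coe_mul, coe_gN, coe_gN, coe_gN, gU_add])

lemma gN_zero : gN d A 0 = 1 := Subtype.ext (by rw [coe_gN, gU_zero]; rfl)

lemma xmN_eq_xUp (a : Fin N) (s : ℤ) : xmN d A a s = gN d A (-2 * s) * xUp d A a s :=
  Subtype.ext (by rw [MulMemClass.coe_mul, coe_gN, gU_mul_xUp, coe_xmN])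

lemma xmN_eq_xDown (a : Fin N) (s : ℤ) : xmN d A a s = gN d A (2 * s) * xDown d A a (-s) :=
  Subtype.ext (by rw [MulMemClass.coe_mul, coe_gN, gU_mul_xDown, coe_xmN])

lemma qp_symm (H : CartanHyp d A) (i j : Fin N) : qp d A i j = qp d A j i := by
  rw [qp, qp, H.symm]

section Family

variable {Ωψ Ωφ : Fin N → ℤ → Nq d A →ₗ[Fq] Nq d A}

lemma _root_.IsOmegaFamily.gN_mul (h : IsOmegaFamily d A Ωψ Ωφ) (H : CartanHyp d A) (i : Fin N) (z : ℤ)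
    (P : Nq d A) : (∀ m, Ωψ i m (gN d A z * P) = gN d A z * Ωψ i m P) ∧
      ∀ m, Ωφ i (-m) (gN d A z * P) = gN d A z * Ωφ i (-m) P :=
  (h.isExpansion H i _).ext H ((h.isExpansion H i P).gN_mul z)

lemma _root_.IsOmegaFamily.one (h : IsOmegaFamily d A Ωψ Ωφ) (H : CartanHyp d A) (i : Fin N) :
    (∀ m, Ωψ i m 1 = 0) ∧ ∀ m, Ωφ i (-m) 1 = 0 :=
  (h.isExpansion H i _).ext H (.one d A i)

lemma _root_.IsOmegaFamily.modeRule_psi (h : IsOmegaFamily d A Ωψ Ωφ) (H : CartanHyp d A) :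
    ModeRule (V := Nq d A) (qp d A) (fun a s => LinearMap.mulLeft Fq (xUp d A a s)) Ωψ where
  low := h.1
  rule i a m s P M hM := by
    obtain ⟨B, hB⟩ := (h.isExpansion H i P).low_left
    obtain ⟨B', hB'⟩ := (h.isExpansion H i P).low_right
    have := ((h.isExpansion H i _).ext H ((h.isExpansion H i P).xmN_mul H hB hB' a s)).1 m
    simp only [LinearMap.mulLeft_apply]
    rw [xUp, mul_assoc, (h.gN_mul H i _ _).1, this, ← mul_assoc, ← gN_add, show 2 * s + -2 * s = 0 by ring,
      gN_zero, one_mul]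
    congr 1
    refine (sum_range_eq_sum_range (fun r hr => ?_) fun r hr => ?_)
    · rw [hB _ (by omega), mul_zero, smul_zero]
    · rw [hM r hr, mul_zero, smul_zero]

lemma _root_.IsOmegaFamily.modeRule_phi (h : IsOmegaFamily d A Ωψ Ωφ) (H : CartanHyp d A) :
    ModeRule (V := Nq d A) (fun i j => (qp d A i j)⁻¹) (fun a s => LinearMap.mulLeft Fq (xDown d A a s))
      (fun i m => Ωφ i (-m)) where
  low i P := (h.isExpansion H i P).low_right
  rule i a m s P M hM := by
    obtain ⟨B, hB⟩ := (h.isExpansion H i P).low_left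
    obtain ⟨B', hB'⟩ := (h.isExpansion H i P).low_right
    have := ((h.isExpansion H i _).ext H ((h.isExpansion H i P).xmN_mul H hB hB' a (-s))).2 m
    simp only [LinearMap.mulLeft_apply]
    rw [xDown, mul_assoc, (h.gN_mul H i _ _).2, this, ← mul_assoc, ← gN_add, show 2 * s + 2 * -s = 0 by ring,
      gN_zero, one_mul, neg_neg]
    congr 1
    refine (sum_range_eq_sum_range (fun r hr => ?_) fun r hr => ?_)
    · rw [hB' _ (by omega), mul_zero, smul_zero]
    · rw [hM r hr, mul_zero, smul_zero]

end Family

lemma ModeRule.quadDefect_eq_zero {c : Fin N → Fin N → Fq} {x : Fin N → ℤ → Nq d A}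
    {Ω : Fin N → ℤ → Module.End Fq (Nq d A)}
    (h : ModeRule (V := Nq d A) c (fun a s => LinearMap.mulLeft Fq (x a s)) Ω) (hc : ∀ i j, c i j = c j i)
    (hz : ∀ i m z P, Ω i m (gN d A z * P) = gN d A z * Ω i m P) (h1 : ∀ i m, Ω i m 1 = 0)
    (hx : ∀ a s, ∃ z t, xmN d A a s = gN d A z * x a t) (i j : Fin N) (k l : ℤ) (P : Nq d A) :
    quadDefect (V := Nq d A) (c i j) (Ω i) (Ω j) k l P = 0 := by
  have hD (z : ℤ) (Q : Nq d A) (k l : ℤ) : quadDefect (V := Nq d A) (c i j) (Ω i) (Ω j) k l (gN d A z * Q) =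
      gN d A z * quadDefect (V := Nq d A) (c i j) (Ω i) (Ω j) k l Q := by
    have hL (i : Fin N) (m : ℤ) (v : Nq d A) : Ω i m (LinearMap.mulLeft Fq (gN d A z) v) =
        LinearMap.mulLeft Fq (gN d A z) (Ω i m v) := by
      rw [LinearMap.mulLeft_apply, LinearMap.mulLeft_apply, hz]
    have := quadDefect_map (V := Nq d A) (c i j) (hL i) (hL j) k l Q
    rwa [LinearMap.mulLeft_apply, LinearMap.mulLeft_apply] at this
  have key : ∀ (y : Uq N d A) (hy : y ∈ Nq d A) (Q : Nq d A),
      (∀ k l, quadDefect (V := Nq d A) (c i j) (Ω i) (Ω j) k l Q = 0) →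
      ∀ k l, quadDefect (V := Nq d A) (c i j) (Ω i) (Ω j) k l (⟨y, hy⟩ * Q) = 0 := by
    intro y hy
    induction hy using Algebra.adjoin_induction with
    | mem y hy =>
      intro Q hQ k l
      obtain (rfl | rfl) | ⟨⟨a, s⟩, rfl⟩ := hy
      · have := hD 1 Q k l
        rw [hQ, mul_zero] at this
        rwa [show gN d A 1 = g2N d A by simp [gN]] at this
      · have := hD (-1) Q k l
        rw [hQ, mul_zero] at this
        rwa [show gN d A (-1) = g2invN d A by simp [gN]] at this
      · obtain ⟨z, t, hzt⟩ := hx a s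
        change quadDefect (V := Nq d A) (c i j) (Ω i) (Ω j) k l (xmN d A a s * Q) = 0
        rw [hzt, mul_assoc, hD]
        have := h.quadDefect_X hc hQ a t k l
        rw [LinearMap.mulLeft_apply] at this
        rw [this, mul_zero]
    | algebraMap r =>
      intro Q hQ k l
      change quadDefect (V := Nq d A) (c i j) (Ω i) (Ω j) k l (algebraMap Fq (Nq d A) r * Q) = 0
      rw [← Algebra.smul_def, map_smul, hQ, smul_zero]
    | add y y' hy hy' ih ih' =>
      intro Q hQ k l
      change quadDefect (V := Nq d A) (c i j) (Ω i) (Ω j) k l ((⟨y, hy⟩ + ⟨y', hy'⟩) * Q) = 0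
      rw [add_mul, map_add, ih Q hQ, ih' Q hQ, add_zero]
    | mul y y' hy hy' ih ih' =>
      intro Q hQ k l
      change quadDefect (V := Nq d A) (c i j) (Ω i) (Ω j) k l (⟨y, hy⟩ * ⟨y', hy'⟩ * Q) = 0
      rw [mul_assoc]
      exact ih _ (ih' Q hQ) k l
  have := key P P.2 1 (fun k l => by
    simp only [quadDefect_apply, h1, map_zero, smul_zero, sub_self, add_zero]) k l
  rwa [mul_one] at this

section Relations

variable {Ωψ Ωφ : Fin N → ℤ → Nq d A →ₗ[Fq] Nq d A}

lemma _root_.IsOmegaFamily.quadratic_psi (h : IsOmegaFamily d A Ωψ Ωφ) (H : CartanHyp d A)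
    (i j : Fin N) (k l : ℤ) (P : Nq d A) :
    qp d A i j • Ωψ i (k + 1) (Ωψ j l P) - Ωψ j l (Ωψ i (k + 1) P) =
      Ωψ i k (Ωψ j (l + 1) P) - qp d A i j • Ωψ j (l + 1) (Ωψ i k P) := by
  have := (h.modeRule_psi H).quadDefect_eq_zero (qp_symm H)
    (fun i m z P => (h.gN_mul H i z P).1 m) (fun i => (h.one H i).1)
    (fun a s => ⟨_, _, xmN_eq_xUp a s⟩) i j k l P
  rw [quadDefect_apply] at this
  rw [← sub_eq_zero, ← this]
  abel

lemma _root_.IsOmegaFamily.quadratic_phi (h : IsOmegaFamily d A Ωψ Ωφ) (H : CartanHyp d A)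
    (i j : Fin N) (k l : ℤ) (P : Nq d A) :
    qp d A i j • Ωφ i (k + 1) (Ωφ j l P) - Ωφ j l (Ωφ i (k + 1) P) =
      Ωφ i k (Ωφ j (l + 1) P) - qp d A i j • Ωφ j (l + 1) (Ωφ i k P) := by
  have := (h.modeRule_phi H).quadDefect_eq_zero (fun i j => by rw [qp_symm H])
    (fun i m z P => (h.gN_mul H i z P).2 m) (fun i => (h.one H i).2)
    (fun a s => ⟨_, _, xmN_eq_xDown a s⟩) i j (-k - 1) (-l - 1) P
  rw [quadDefect_apply] at this
  have h2 := congr_arg (qp d A i j • ·) this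
  simp only [smul_add, smul_sub, smul_smul, mul_inv_cancel₀ (qp_ne_zero d A i j), one_smul,
    smul_zero, sub_add_cancel, neg_sub, sub_neg_eq_add, neg_neg] at h2
  rw [← sub_eq_zero, ← neg_eq_zero, ← h2, add_comm 1 k, add_comm 1 l]
  abel

end Relations

end QAff

/-- The quadratic relations among the operators `Ω_{ψ}`, and among the
operators `Ω_{φ}`, as operators on `N_q^-` (stated pointwise, i.e. as equalities of
operators applied to an arbitrary `P ∈ N_q^-`):
`q^{(α_i|α_j)} Ω_{ψ_i}(k+1) Ω_{ψ_j}(l) - Ω_{ψ_j}(l) Ω_{ψ_i}(k+1)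
  = Ω_{ψ_i}(k) Ω_{ψ_j}(l+1) - q^{(α_i|α_j)} Ω_{ψ_j}(l+1) Ω_{ψ_i}(k)`,
and the same identity with every `Ω_{ψ}` replaced by `Ω_{φ}`. -/
theorem omega_omega_relations
    (hN : 0 < N)
    (hdpos : ∀ i, 0 < d i)
    (hgcd : Finset.univ.gcd (fun i => (d i).natAbs) = 1)
    (hdiag : ∀ i, A i i = 2)
    (hoff : ∀ i j, i ≠ j → A i j ≤ 0)
    (hsym : ∀ i j, d i * A i j = d j * A j i)
    (Ωψ Ωφ : Fin N → ℤ → ((Nq d A) →ₗ[Fq] (Nq d A)))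
    (hfam : IsOmegaFamily d A Ωψ Ωφ)
    (i j : Fin N) (k l : ℤ) :
    (∀ P : Nq d A,
      qp d A i j • Ωψ i (k+1) (Ωψ j l P) - Ωψ j l (Ωψ i (k+1) P) =
        Ωψ i k (Ωψ j (l+1) P) - qp d A i j • Ωψ j (l+1) (Ωψ i k P)) ∧
    (∀ P : Nq d A,
      qp d A i j • Ωφ i (k+1) (Ωφ j l P) - Ωφ j l (Ωφ i (k+1) P) =
        Ωφ i k (Ωφ j (l+1) P) - qp d A i j • Ωφ j (l+1) (Ωφ i k P)) := by
  have H : QAff.CartanHyp d A := ⟨hdpos, hdiag, hoff, hsym⟩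
  exact ⟨hfam.quadratic_psi H i j k l, hfam.quadratic_phi H i j k l⟩

end
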